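/- Assume that the sequence (MSE_n)_{n≥1} with matched SNR λ' = λ converges uniformly in λ on compact subsets of ℝ₊. If σ' ≥ σ, then for all λ > 0, lim_{n→∞} MSE_n(σ,σ',λ,λ) = σ⁴ when λ ≤ 1/σ'⁴; = σ⁴ + 1/λ − (1/(λ^{3/2}σ'²))·(2 − 1/(√λ σ'²)) when 1/σ'⁴ ≤ λ ≤ 1/σ⁴; and = 2/λ − (1/(λ²σ'²))·(2/σ² − 1/σ'²) when λ ≥ 1/σ⁴. -/

import Mathlib

open MeasureTheory ProbabilityTheory Filter Matrix

noncomputable section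

instance {n : ℕ} : MeasurableSpace (Matrix (Fin n) (Fin n) ℝ) :=
  inferInstanceAs (MeasurableSpace (Fin n → Fin n → ℝ))

/-- Squared Frobenius norm of a matrix. -/
def frobSq {n : ℕ} (M : Matrix (Fin n) (Fin n) ℝ) : ℝ := ∑ i, ∑ j, (M i j) ^ 2

/-- i.i.d. centered Gaussian prior with variance `v` on `ℝⁿ`. -/
def gaussPrior (n : ℕ) (v : ℝ) : Measure (Fin n → ℝ) :=
  Measure.pi fun _ => gaussianReal 0 (Real.toNNReal v)

/-- Law of the symmetric noise matrix `Z`: independent `N(0,1)` entries above the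
diagonal and `N(0,2)` entries on the diagonal, extended symmetrically. -/
def noiseMeasure (n : ℕ) : Measure (Matrix (Fin n) (Fin n) ℝ) :=
  (Measure.pi fun p : Fin n × Fin n =>
      gaussianReal 0 (if p.1 = p.2 then 2 else 1)).map
    (fun g => Matrix.of fun i j => if i ≤ j then g (i, j) else g (j, i))

/-- Observation matrix `Y = √(λ/n) s sᵀ + Z`. -/
def obs (n : ℕ) (lam : ℝ) (s : Fin n → ℝ) (Z : Matrix (Fin n) (Fin n) ℝ) :
    Matrix (Fin n) (Fin n) ℝ :=
  Real.sqrt (lam / n) • Matrix.vecMulVec s s + Z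

/-- Posterior weight `exp(−¼‖Y−√(λ'/n) x xᵀ‖_F²)`. -/
def weight (n : ℕ) (lam' : ℝ) (Y : Matrix (Fin n) (Fin n) ℝ) (x : Fin n → ℝ) : ℝ :=
  Real.exp (-(1 / 4) * frobSq (Y - Real.sqrt (lam' / n) • Matrix.vecMulVec x x))

/-- Gibbs (mismatched posterior) average `⟨f(x)⟩_{λ',σ'}` of an observable `f`. -/
def gibbs (n : ℕ) (sig' lam' : ℝ) (Y : Matrix (Fin n) (Fin n) ℝ)
    (f : (Fin n → ℝ) → ℝ) : ℝ :=
  (∫ x, f x * weight n lam' Y x ∂gaussPrior n (sig' ^ 2)) /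
    (∫ x, weight n lam' Y x ∂gaussPrior n (sig' ^ 2))

/-- Posterior mean matrix `⟨x xᵀ⟩_{λ',σ'}`. -/
def gibbsMatrix (n : ℕ) (sig' lam' : ℝ) (Y : Matrix (Fin n) (Fin n) ℝ) :
    Matrix (Fin n) (Fin n) ℝ :=
  Matrix.of fun i j => gibbs n sig' lam' Y (fun x => x i * x j)

/-- Mismatched matrix-MSE `MSE_n(σ,σ',λ,λ')`. -/
def MSE (n : ℕ) (sig sig' lam lam' : ℝ) : ℝ :=
  (1 / (n : ℝ) ^ 2) *
    ∫ p, frobSq (Matrix.vecMulVec p.1 p.1 -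
        gibbsMatrix n sig' lam' (obs n lam p.1 p.2))
      ∂((gaussPrior n (sig ^ 2)).prod (noiseMeasure n))

/-! ### Gaussian integration by parts -/

lemma hasDerivAt_gaussPdf (v : NNReal) (hv : v ≠ 0) (x : ℝ) :
    HasDerivAt (gaussianPDFReal 0 v) (-(x / v) * gaussianPDFReal 0 v x) x := by
  have hv' : (v : ℝ) ≠ 0 := by exact_mod_cast hv
  have h1 : HasDerivAt (fun x : ℝ => -(x - 0) ^ 2 / (2 * (v : ℝ))) (-(x / v)) x := by
    have := (((hasDerivAt_id' x).sub_const 0).fun_pow 2).fun_neg.div_const (2 * (v : ℝ))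
    refine this.congr_deriv ?_
    simp; field_simp
  have h2 := h1.exp.const_mul ((Real.sqrt (2 * Real.pi * v))⁻¹)
  rw [gaussianPDFReal_def]
  refine h2.congr_deriv ?_
  ring

lemma integrable_gaussianReal_iff (v : NNReal) (hv : v ≠ 0) (f : ℝ → ℝ) :
    Integrable f (gaussianReal 0 v) ↔ Integrable (fun x => f x * gaussianPDFReal 0 v x) := by
  rw [gaussianReal_of_var_ne_zero _ hv,
    integrable_withDensity_iff_integrable_smul' (measurable_gaussianPDF 0 v)
      (Eventually.of_forall fun x => gaussianPDF_lt_top)]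
  simp only [toReal_gaussianPDF, smul_eq_mul, mul_comm]

lemma stein1 (v : NNReal) (hv : v ≠ 0) (f f' : ℝ → ℝ) (hd : ∀ x, HasDerivAt f (f' x) x)
    (hf : Integrable f (gaussianReal 0 v)) (hf' : Integrable f' (gaussianReal 0 v))
    (hxf : Integrable (fun x => x * f x) (gaussianReal 0 v)) :
    ∫ x, x * f x ∂gaussianReal 0 v = v * ∫ x, f' x ∂gaussianReal 0 v := by
  have hv' : (v : ℝ) ≠ 0 := by exact_mod_cast hv
  rw [integrable_gaussianReal_iff v hv] at hf hf' hxf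
  have e := integral_mul_deriv_eq_deriv_mul_of_integrable (u := f) (u' := f')
    (v := gaussianPDFReal 0 v) (v' := fun x => -(x / v) * gaussianPDFReal 0 v x)
    (fun x _ => hd x) (fun x _ => hasDerivAt_gaussPdf v hv x)
    (by
      convert hxf.const_mul (-(1 / (v : ℝ))) using 1
      funext x; simp; ring) hf' hf
  rw [integral_gaussianReal_eq_integral_smul hv, integral_gaussianReal_eq_integral_smul hv]
  simp only [smul_eq_mul]
  have e1 : ∫ x, f x * (-(x / v) * gaussianPDFReal 0 v x)
      = -(1 / (v : ℝ)) * ∫ x, gaussianPDFReal 0 v x * (x * f x) := by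
    rw [← integral_const_mul]; congr 1; funext x; ring
  have e2 : ∫ x, f' x * gaussianPDFReal 0 v x = ∫ x, gaussianPDFReal 0 v x * f' x := by
    congr 1; funext x; ring
  rw [e1, e2] at e
  generalize (∫ x, gaussianPDFReal 0 v x * (x * f x)) = I1 at e ⊢
  generalize (∫ x, gaussianPDFReal 0 v x * f' x) = I2 at e ⊢
  field_simp at e
  linarith

/-- Resampling one coordinate preserves a product measure. -/
lemma measurePreserving_update {ι : Type*} [Fintype ι] [DecidableEq ι] (m : ι → Measure ℝ)
    [∀ i, IsProbabilityMeasure (m i)] (k : ι) :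
    MeasurePreserving (fun p : (ι → ℝ) × ℝ => Function.update p.1 k p.2)
      ((Measure.pi m).prod (m k)) (Measure.pi m) := by
  have hmeas : Measurable (fun p : (ι → ℝ) × ℝ => Function.update p.1 k p.2) := by
    rw [measurable_pi_iff]
    intro i
    by_cases h : i = k
    · subst h; simpa using measurable_snd
    · simp only [Function.update_of_ne h]; fun_prop
  refine ⟨hmeas, ?_⟩
  symm
  apply Measure.pi_eq
  intro s hs
  rw [Measure.map_apply hmeas (MeasurableSet.univ_pi hs)]
  have : (fun p : (ι → ℝ) × ℝ => Function.update p.1 k p.2) ⁻¹' (Set.univ.pi s)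
      = (Set.univ.pi (Function.update s k Set.univ)) ×ˢ (s k) := by
    ext ⟨g, y⟩
    simp only [Set.mem_preimage, Set.mem_pi, Set.mem_univ, true_implies, Set.mem_prod]
    constructor
    · intro h
      refine ⟨fun i => ?_, by simpa using h k⟩
      by_cases hi : i = k
      · subst hi; simp
      · simpa [Function.update_of_ne hi] using h i
    · rintro ⟨h1, h2⟩ i
      by_cases hi : i = k
      · subst hi; simpa using h2
      · simpa [Function.update_of_ne hi] using h1 i
  rw [this, Measure.prod_prod, Measure.pi_pi]
  rw [← Finset.mul_prod_erase Finset.univ (fun i => (m i) (s i)) (Finset.mem_univ k),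
    ← Finset.mul_prod_erase Finset.univ (fun i => (m i) (Function.update s k Set.univ i))
      (Finset.mem_univ k)]
  simp only [Function.update_self, measure_univ, one_mul]
  rw [mul_comm]
  congr 1
  apply Finset.prod_congr rfl
  intro i hi
  rw [Function.update_of_ne (Finset.ne_of_mem_erase hi)]

lemma stein_pi {ι : Type*} [Fintype ι] [DecidableEq ι] (v : ι → NNReal) (hv : ∀ i, v i ≠ 0)
    (k : ι) (f f' : (ι → ℝ) → ℝ)
    (hd : ∀ g, HasDerivAt (fun y => f (Function.update g k y)) (f' g) (g k))
    (hf : Integrable f (Measure.pi fun i => gaussianReal 0 (v i)))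
    (hf' : Integrable f' (Measure.pi fun i => gaussianReal 0 (v i)))
    (hxf : Integrable (fun g => g k * f g) (Measure.pi fun i => gaussianReal 0 (v i))) :
    ∫ g, g k * f g ∂(Measure.pi fun i => gaussianReal 0 (v i))
      = v k * ∫ g, f' g ∂(Measure.pi fun i => gaussianReal 0 (v i)) := by
  have mp := measurePreserving_update (fun i => gaussianReal 0 (v i)) k
  have key : ∀ F : (ι → ℝ) → ℝ, Integrable F (Measure.pi fun i => gaussianReal 0 (v i)) →
      Integrable (fun p : (ι → ℝ) × ℝ => F (Function.update p.1 k p.2))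
        ((Measure.pi fun i => gaussianReal 0 (v i)).prod (gaussianReal 0 (v k))) ∧
      ∫ g, F g ∂(Measure.pi fun i => gaussianReal 0 (v i)) =
      ∫ g, (∫ y, F (Function.update g k y) ∂(gaussianReal 0 (v k)))
        ∂(Measure.pi fun i => gaussianReal 0 (v i)) := by
    intro F hF
    have h1 : Integrable (fun p : (ι → ℝ) × ℝ => F (Function.update p.1 k p.2))
        ((Measure.pi fun i => gaussianReal 0 (v i)).prod (gaussianReal 0 (v k))) :=
      mp.integrable_comp_of_integrable hF
    refine ⟨h1, ?_⟩
    rw [← integral_prod _ h1]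
    have := integral_map (μ := ((Measure.pi fun i => gaussianReal 0 (v i)).prod
      (gaussianReal 0 (v k)))) mp.measurable.aemeasurable (f := F)
      (by rw [mp.map_eq]; exact hF.aestronglyMeasurable)
    rw [mp.map_eq] at this
    exact this
  obtain ⟨i1, e1⟩ := key _ hf
  obtain ⟨i2, e2⟩ := key _ hf'
  obtain ⟨i3, e3⟩ := key _ hxf
  rw [e2, e3, ← integral_const_mul]
  apply integral_congr_ae
  filter_upwards [i1.prod_right_ae, i2.prod_right_ae, i3.prod_right_ae] with g h1 h2 h3
  simp only [Function.update_self] at h3 ⊢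
  refine stein1 (v k) (hv k) (fun y => f (Function.update g k y))
    (fun y => f' (Function.update g k y)) (fun y => ?_) h1 h2 h3
  have := hd (Function.update g k y)
  simpa using this

/-- Exponential growth bound. -/
def ExpGr {ι : Type*} [Fintype ι] (f : (ι → ℝ) → ℝ) : Prop :=
  ∃ C c : ℝ, 0 ≤ C ∧ 0 ≤ c ∧ ∀ g, |f g| ≤ C * Real.exp (c * ∑ i, |g i|)

lemma integrable_exp_abs_gauss (v : NNReal) (c : ℝ) :
    Integrable (fun x : ℝ => Real.exp (c * |x|)) (gaussianReal 0 v) := by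
  exact integrable_exp_mul_abs (X := fun x : ℝ => x) (integrable_exp_mul_gaussianReal c)
    (integrable_exp_mul_gaussianReal (-c))

lemma integrable_exp_sum {ι : Type*} [Fintype ι] (v : ι → NNReal) (c : ℝ) :
    Integrable (fun g : ι → ℝ => Real.exp (c * ∑ i, |g i|))
      (Measure.pi fun i => gaussianReal 0 (v i)) := by
  have := Integrable.fintype_prod (μ := fun i => gaussianReal 0 (v i))
    (f := fun i (x : ℝ) => Real.exp (c * |x|)) (fun i => integrable_exp_abs_gauss (v i) c)
  convert this using 2 with g
  rw [← Real.exp_sum, Finset.mul_sum]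

namespace ExpGr
variable {ι : Type*} [Fintype ι] {f h : (ι → ℝ) → ℝ}

lemma integrable (hf : ExpGr f) (v : ι → NNReal)
    (hm : AEStronglyMeasurable f (Measure.pi fun i => gaussianReal 0 (v i))) :
    Integrable f (Measure.pi fun i => gaussianReal 0 (v i)) := by
  obtain ⟨C, c, _, _, hb⟩ := hf
  exact Integrable.mono' ((integrable_exp_sum v c).const_mul C) hm
    (Eventually.of_forall fun g => by simpa using hb g)

lemma const (a : ℝ) : ExpGr (fun _ : ι → ℝ => a) :=
  ⟨|a|, 0, abs_nonneg _, le_rfl, fun g => by simp⟩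

lemma coord (k : ι) : ExpGr (fun g : ι → ℝ => g k) := by
  refine ⟨1, 1, by norm_num, by norm_num, fun g => ?_⟩
  have : |g k| ≤ ∑ i, |g i| := Finset.single_le_sum (f := fun i => |g i|)
    (fun i _ => abs_nonneg _) (Finset.mem_univ k)
  have := Real.add_one_le_exp (∑ i, |g i|)
  rw [one_mul, one_mul]; linarith

lemma of_le (hh : ExpGr h) (hle : ∀ g, |f g| ≤ |h g|) : ExpGr f := by
  obtain ⟨C, c, hC, hc, hb⟩ := hh
  exact ⟨C, c, hC, hc, fun g => (hle g).trans (hb g)⟩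

lemma add (hf : ExpGr f) (hh : ExpGr h) : ExpGr (fun g => f g + h g) := by
  obtain ⟨C, c, hC, hc, hb⟩ := hf
  obtain ⟨D, d, hD, hd, hb'⟩ := hh
  refine ⟨C + D, c + d, by positivity, by positivity, fun g => ?_⟩
  have hs : 0 ≤ ∑ i, |g i| := Finset.sum_nonneg fun i _ => abs_nonneg _
  have h1 : Real.exp (c * ∑ i, |g i|) ≤ Real.exp ((c + d) * ∑ i, |g i|) := by
    apply Real.exp_le_exp.2; nlinarith
  have h2 : Real.exp (d * ∑ i, |g i|) ≤ Real.exp ((c + d) * ∑ i, |g i|) := by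
    apply Real.exp_le_exp.2; nlinarith
  calc |f g + h g| ≤ |f g| + |h g| := abs_add_le _ _
    _ ≤ C * Real.exp (c * ∑ i, |g i|) + D * Real.exp (d * ∑ i, |g i|) := add_le_add (hb g) (hb' g)
    _ ≤ C * Real.exp ((c + d) * ∑ i, |g i|) + D * Real.exp ((c + d) * ∑ i, |g i|) := by gcongr
    _ = _ := by ring

lemma mul (hf : ExpGr f) (hh : ExpGr h) : ExpGr (fun g => f g * h g) := by
  obtain ⟨C, c, hC, hc, hb⟩ := hf
  obtain ⟨D, d, hD, hd, hb'⟩ := hh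
  refine ⟨C * D, c + d, by positivity, by positivity, fun g => ?_⟩
  rw [abs_mul, add_mul, Real.exp_add]
  calc |f g| * |h g| ≤ (C * Real.exp (c * ∑ i, |g i|)) * (D * Real.exp (d * ∑ i, |g i|)) := by
        gcongr
        · exact hb g
        · exact hb' g
    _ = _ := by ring

lemma const_mul (a : ℝ) (hf : ExpGr f) : ExpGr (fun g => a * f g) := (const a).mul hf

lemma abs (hf : ExpGr f) : ExpGr (fun g => |f g|) := hf.of_le fun g => by simp

lemma pow (hf : ExpGr f) (m : ℕ) : ExpGr (fun g => f g ^ m) := by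
  induction m with
  | zero => simpa using const 1
  | succ m ih => simpa [pow_succ] using ih.mul hf

lemma sum {κ : Type*} (s : Finset κ) {F : κ → (ι → ℝ) → ℝ} (hF : ∀ a ∈ s, ExpGr (F a)) :
    ExpGr (fun g => ∑ a ∈ s, F a g) := by
  classical
  induction s using Finset.induction_on with
  | empty => simpa using const 0
  | insert a s ha ih =>
    simp only [Finset.sum_insert ha]
    exact (hF a (Finset.mem_insert_self a s)).add
      (ih fun b hb => hF b (Finset.mem_insert_of_mem hb))

end ExpGr

lemma stein_gr {ι : Type*} [Fintype ι] [DecidableEq ι] (v : ι → NNReal) (hv : ∀ i, v i ≠ 0)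
    (k : ι) (f f' : (ι → ℝ) → ℝ)
    (hd : ∀ g, HasDerivAt (fun y => f (Function.update g k y)) (f' g) (g k))
    (mf : Measurable f) (mf' : Measurable f') (hf : ExpGr f) (hf' : ExpGr f') :
    ∫ g, g k * f g ∂(Measure.pi fun i => gaussianReal 0 (v i))
      = v k * ∫ g, f' g ∂(Measure.pi fun i => gaussianReal 0 (v i)) :=
  stein_pi v hv k f f' hd (hf.integrable v mf.aestronglyMeasurable)
    (hf'.integrable v mf'.aestronglyMeasurable)
    (((ExpGr.coord k).mul hf).integrable v
      ((measurable_pi_apply k).mul mf).aestronglyMeasurable)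

/-! ### Gibbs averages and derivative of the free energy -/

/-- Gibbs average of `f` with respect to `exp(H) dν`. -/
def gav {X : Type*} [MeasurableSpace X] (ν : Measure X) (H f : X → ℝ) : ℝ :=
  (∫ x, f x * Real.exp (H x) ∂ν) / ∫ x, Real.exp (H x) ∂ν

lemma hasDerivAt_int_exp {X : Type*} [MeasurableSpace X] (ν : Measure X) [IsFiniteMeasure ν]
    (ψ : X → ℝ) (h h' : ℝ → X → ℝ) (t0 r K K' : ℝ) (hr : 0 < r) (mψ : Measurable ψ)
    (mh : ∀ t, Measurable (h t)) (mh' : Measurable (h' t0))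
    (hd : ∀ᵐ x ∂ν, ∀ t ∈ Metric.ball t0 r, HasDerivAt (fun t => h t x) (h' t x) t)
    (hb : ∀ᵐ x ∂ν, |ψ x| * Real.exp (h t0 x) ≤ K)
    (hb' : ∀ᵐ x ∂ν, ∀ t ∈ Metric.ball t0 r, |ψ x| * |h' t x| * Real.exp (h t x) ≤ K') :
    HasDerivAt (fun t => ∫ x, ψ x * Real.exp (h t x) ∂ν)
      (∫ x, ψ x * h' t0 x * Real.exp (h t0 x) ∂ν) t0 := by
  refine (hasDerivAt_integral_of_dominated_loc_of_deriv_le (bound := fun _ => K')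
    (F := fun t x => ψ x * Real.exp (h t x))
    (F' := fun t x => ψ x * h' t x * Real.exp (h t x))
    (Metric.ball_mem_nhds t0 hr) ?_ ?_ ?_ ?_ (integrable_const _) ?_).2
  · exact Eventually.of_forall fun t => (mψ.mul (mh t).exp).aestronglyMeasurable
  · refine Integrable.mono' (integrable_const K) (mψ.mul (mh t0).exp).aestronglyMeasurable ?_
    filter_upwards [hb] with x hx
    simpa [abs_mul] using hx
  · exact ((mψ.mul mh').mul (mh t0).exp).aestronglyMeasurable
  · filter_upwards [hb'] with x hx t ht
    simpa [abs_mul] using hx t ht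
  · filter_upwards [hd] with x hx t ht
    refine ((hx t ht).exp.const_mul (ψ x)).congr_deriv ?_
    ring

structure GD (X ι : Type*) [MeasurableSpace X] [Fintype ι] where
  ν : Measure X
  φ : ι → X → ℝ
  c : ι → ℝ → ℝ
  c' : ι → ℝ → ℝ
  B : ℝ → X → ℝ
  B' : ℝ → X → ℝ
  U : X → ℝ

namespace GD
variable {X ι : Type*} [MeasurableSpace X] [Fintype ι]

def H (d : GD X ι) (t : ℝ) (g : ι → ℝ) (x : X) : ℝ := ∑ k, d.c k t * g k * d.φ k x + d.B t x

structure Good (d : GD X ι) (t0 r C : ℝ) : Prop where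
  hr : 0 < r
  fin : IsFiniteMeasure d.ν
  ne : d.ν ≠ 0
  mφ : ∀ k, Measurable (d.φ k)
  mB : ∀ t, Measurable (d.B t)
  mB' : ∀ t, Measurable (d.B' t)
  mU : Measurable d.U
  hx : ∀ᵐ x ∂d.ν, 1 ≤ d.U x ∧ (∀ k, |d.φ k x| ≤ d.U x) ∧ ∀ t ∈ Metric.ball t0 r,
    HasDerivAt (fun t => d.B t x) (d.B' t x) t ∧ |d.B' t x| ≤ C * d.U x ^ 2
  hc : ∀ k, ∀ t ∈ Metric.ball t0 r, HasDerivAt (d.c k) (d.c' k t) t ∧ |d.c k t| ≤ C ∧ |d.c' k t| ≤ C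
  H1 : ∀ M : ℝ, ∃ K : ℝ, ∀ᵐ x ∂d.ν, ∀ t ∈ Metric.ball t0 r, ∀ g : ι → ℝ, (∀ k, |g k| ≤ M) →
    d.U x ^ 2 * Real.exp (d.H t g x) ≤ K
  H2 : ∃ Γ : (ι → ℝ) → ℝ, ExpGr Γ ∧ ∀ t ∈ Metric.ball t0 r, ∀ g,
    ∫ x, d.U x ^ 2 * Real.exp (d.H t g x) ∂d.ν ≤ |Γ g| * ∫ x, Real.exp (d.H t g x) ∂d.ν
  H3 : ExpGr (fun g => Real.log (∫ x, Real.exp (d.H t0 g x) ∂d.ν))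

namespace Good
variable {d : GD X ι} {t0 r C : ℝ}

lemma t0mem (hd : d.Good t0 r C) : t0 ∈ Metric.ball t0 r := Metric.mem_ball_self hd.hr

lemma C0 (hd : d.Good t0 r C) : 0 ≤ C := by
  have := hd.fin
  have : ∃ x, 1 ≤ d.U x ∧ (∀ k, |d.φ k x| ≤ d.U x) ∧ ∀ t ∈ Metric.ball t0 r,
    HasDerivAt (fun t => d.B t x) (d.B' t x) t ∧ |d.B' t x| ≤ C * d.U x ^ 2 := by
    have : (ae d.ν).NeBot := ae_neBot.2 hd.ne
    exact hd.hx.exists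
  obtain ⟨x, h1, _, h3⟩ := this
  have := (h3 t0 hd.t0mem).2
  have h4 : 0 < d.U x ^ 2 := by positivity
  have := (abs_nonneg _).trans this
  exact nonneg_of_mul_nonneg_left this h4

lemma mH (hd : d.Good t0 r C) (t : ℝ) : Measurable (fun p : (ι → ℝ) × X => d.H t p.1 p.2) := by
  unfold GD.H
  have := hd.mφ
  have := hd.mB t
  fun_prop

lemma mHx (hd : d.Good t0 r C) (t : ℝ) (g : ι → ℝ) : Measurable (d.H t g) :=
  (hd.mH t).comp (measurable_const.prodMk measurable_id)

lemma mInt (hd : d.Good t0 r C) (t : ℝ) (ψ : X → ℝ) (mψ : Measurable ψ) :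
    Measurable (fun g : ι → ℝ => ∫ x, ψ x * Real.exp (d.H t g x) ∂d.ν) := by
  have := hd.fin
  have : StronglyMeasurable (fun p : (ι → ℝ) × X => ψ p.2 * Real.exp (d.H t p.1 p.2)) :=
    ((mψ.comp measurable_snd).mul (hd.mH t).exp).stronglyMeasurable
  exact (this.integral_prod_right' (ν := d.ν)).measurable

lemma mZ (hd : d.Good t0 r C) (t : ℝ) :
    Measurable (fun g : ι → ℝ => ∫ x, Real.exp (d.H t g x) ∂d.ν) := by
  simpa using hd.mInt t (fun _ => 1) measurable_const

lemma mgav (hd : d.Good t0 r C) (t : ℝ) (ψ : X → ℝ) (mψ : Measurable ψ) :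
    Measurable (fun g : ι → ℝ => gav d.ν (d.H t g) ψ) :=
  (hd.mInt t ψ mψ).div (hd.mZ t)

lemma bd (hd : d.Good t0 r C) (g : ι → ℝ) : ∃ K : ℝ, ∀ᵐ x ∂d.ν, ∀ t ∈ Metric.ball t0 r,
    d.U x ^ 2 * Real.exp (d.H t g x) ≤ K := by
  obtain ⟨K, hK⟩ := hd.H1 (∑ k, |g k|)
  refine ⟨K, ?_⟩
  filter_upwards [hK] with x hx t ht
  exact hx t ht g fun k => Finset.single_le_sum (f := fun i => |g i|)
    (fun i _ => abs_nonneg _) (Finset.mem_univ k)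

lemma intU (hd : d.Good t0 r C) {t : ℝ} (ht : t ∈ Metric.ball t0 r) (g : ι → ℝ) :
    Integrable (fun x => d.U x ^ 2 * Real.exp (d.H t g x)) d.ν := by
  have := hd.fin
  obtain ⟨K, hK⟩ := hd.bd g
  refine Integrable.mono' (integrable_const K)
    ((hd.mU.pow_const 2).mul (hd.mHx t g).exp).aestronglyMeasurable ?_
  filter_upwards [hK] with x hx
  rw [Real.norm_eq_abs, abs_of_nonneg (by positivity)]
  exact hx t ht

lemma int_of_le (hd : d.Good t0 r C) {t : ℝ} (ht : t ∈ Metric.ball t0 r) (g : ι → ℝ)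
    (ψ : X → ℝ) (mψ : Measurable ψ) (K : ℝ) (hψ : ∀ᵐ x ∂d.ν, |ψ x| ≤ K * d.U x ^ 2) :
    Integrable (fun x => ψ x * Real.exp (d.H t g x)) d.ν := by
  refine Integrable.mono' ((hd.intU ht g).const_mul K)
    (mψ.mul (hd.mHx t g).exp).aestronglyMeasurable ?_
  filter_upwards [hψ] with x hx
  rw [Real.norm_eq_abs, abs_mul, Real.abs_exp, ← mul_assoc]
  gcongr

lemma intZ (hd : d.Good t0 r C) {t : ℝ} (ht : t ∈ Metric.ball t0 r) (g : ι → ℝ) :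
    Integrable (fun x => Real.exp (d.H t g x)) d.ν := by
  have := hd.int_of_le ht g (fun _ => 1) measurable_const 1 (by
    filter_upwards [hd.hx] with x hx
    have := hx.1
    simp only [abs_one, one_mul]
    nlinarith)
  simpa using this

lemma Zpos (hd : d.Good t0 r C) {t : ℝ} (ht : t ∈ Metric.ball t0 r) (g : ι → ℝ) :
    0 < ∫ x, Real.exp (d.H t g x) ∂d.ν := by
  have := hd.fin
  have : NeZero d.ν := ⟨hd.ne⟩
  exact integral_exp_pos (hd.intZ ht g)

lemma gav_le (hd : d.Good t0 r C) {Γ : (ι → ℝ) → ℝ} {t : ℝ} (ht : t ∈ Metric.ball t0 r)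
    (g : ι → ℝ)
    (hΓ : ∫ x, d.U x ^ 2 * Real.exp (d.H t g x) ∂d.ν ≤ |Γ g| * ∫ x, Real.exp (d.H t g x) ∂d.ν)
    (ψ : X → ℝ) (K : ℝ) (hK : 0 ≤ K)
    (hψ : ∀ᵐ x ∂d.ν, |ψ x| ≤ K * d.U x ^ 2) : |gav d.ν (d.H t g) ψ| ≤ K * |Γ g| := by
  unfold gav
  rw [abs_div, abs_of_pos (hd.Zpos ht g), div_le_iff₀ (hd.Zpos ht g)]
  calc |∫ x, ψ x * Real.exp (d.H t g x) ∂d.ν| ≤ ∫ x, K * (d.U x ^ 2 * Real.exp (d.H t g x)) ∂d.ν := by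
        rw [← Real.norm_eq_abs]
        refine norm_integral_le_of_norm_le ((hd.intU ht g).const_mul K) ?_
        filter_upwards [hψ] with x hx
        rw [Real.norm_eq_abs, abs_mul, Real.abs_exp, ← mul_assoc]
        gcongr
    _ = K * ∫ x, d.U x ^ 2 * Real.exp (d.H t g x) ∂d.ν := integral_const_mul _ _
    _ ≤ K * (|Γ g| * ∫ x, Real.exp (d.H t g x) ∂d.ν) := by gcongr
    _ = _ := by ring

lemma phi_le (hd : d.Good t0 r C) (k : ι) : ∀ᵐ x ∂d.ν, |d.φ k x| ≤ 1 * d.U x ^ 2 := by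
  filter_upwards [hd.hx] with x hx
  have h1 := hx.1
  have := hx.2.1 k
  nlinarith

lemma phi2_le (hd : d.Good t0 r C) (k : ι) : ∀ᵐ x ∂d.ν, |d.φ k x ^ 2| ≤ 1 * d.U x ^ 2 := by
  filter_upwards [hd.hx] with x hx
  have h1 := hx.1
  have := hx.2.1 k
  rw [abs_pow, one_mul]
  gcongr

lemma B'_le (hd : d.Good t0 r C) {t : ℝ} (ht : t ∈ Metric.ball t0 r) :
    ∀ᵐ x ∂d.ν, |d.B' t x| ≤ C * d.U x ^ 2 := by
  filter_upwards [hd.hx] with x hx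
  exact (hx.2.2 t ht).2

/-- the `t`-derivative of the Hamiltonian -/
def _root_.GD.H' (d : GD X ι) (t : ℝ) (g : ι → ℝ) (x : X) : ℝ :=
  ∑ k, d.c' k t * g k * d.φ k x + d.B' t x

lemma H'_le (hd : d.Good t0 r C) (g : ι → ℝ) :
    ∀ᵐ x ∂d.ν, ∀ t ∈ Metric.ball t0 r,
      |d.H' t g x| ≤ (C * ∑ k, |g k| + C) * d.U x ^ 2 := by
  filter_upwards [hd.hx] with x hx t ht
  have hC := hd.C0
  unfold GD.H'
  have h1 : |∑ k, d.c' k t * g k * d.φ k x| ≤ C * (∑ k, |g k|) * d.U x ^ 2 := by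
    calc |∑ k, d.c' k t * g k * d.φ k x| ≤ ∑ k, |d.c' k t * g k * d.φ k x| :=
          Finset.abs_sum_le_sum_abs _ _
      _ ≤ ∑ k, C * |g k| * d.U x ^ 2 := by
          gcongr with k
          rw [abs_mul, abs_mul]
          have h1 := (hd.hc k t ht).2.2
          have h2 := hx.2.1 k
          have h3 := hx.1
          have h4 : |d.φ k x| ≤ d.U x ^ 2 := by nlinarith
          gcongr
      _ = _ := by rw [← Finset.sum_mul, Finset.mul_sum]
  have h2 := (hx.2.2 t ht).2
  have := abs_add_le (∑ k, d.c' k t * g k * d.φ k x) (d.B' t x)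
  linarith

lemma mH' (hd : d.Good t0 r C) (t : ℝ) (g : ι → ℝ) : Measurable (d.H' t g) := by
  unfold GD.H'
  have := hd.mφ
  have := hd.mB' t
  fun_prop

lemma derivZ (hd : d.Good t0 r C) {t : ℝ} (ht : t ∈ Metric.ball t0 r) (g : ι → ℝ) :
    HasDerivAt (fun t => Real.log (∫ x, Real.exp (d.H t g x) ∂d.ν))
      (gav d.ν (d.H t g) (d.H' t g)) t := by
  have := hd.fin
  obtain ⟨K, hK⟩ := hd.bd g
  obtain ⟨ε, hε, hsub⟩ := Metric.isOpen_iff.1 (Metric.isOpen_ball (x := t0) (ε := r)) t ht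
  have := hasDerivAt_int_exp d.ν (fun _ => 1) (fun t x => d.H t g x) (fun t x => d.H' t g x) t ε
    K ((C * ∑ k, |g k| + C) * K) hε measurable_const (fun t => hd.mHx t g) (hd.mH' t g) ?_ ?_ ?_
  · simp only [one_mul] at this
    exact this.log (hd.Zpos ht g).ne'
  · filter_upwards [hd.hx] with x hx t ht
    have ht := hsub ht
    unfold GD.H GD.H'
    refine HasDerivAt.add (HasDerivAt.fun_sum fun k _ => ?_) (hx.2.2 t ht).1
    exact ((hd.hc k t ht).1.mul_const _).mul_const _
  · filter_upwards [hK, hd.hx] with x hx hx2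
    have h1 := hx t ht
    have h2 := hx2.1
    have h3 := Real.exp_pos (d.H t g x)
    simp only [abs_one, one_mul]
    nlinarith [mul_le_mul_of_nonneg_right h2 h3.le]
  · filter_upwards [hd.H'_le g, hK] with x hx hx2 t ht
    have ht := hsub ht
    have hs : 0 ≤ C * ∑ k, |g k| + C := by
      have := hd.C0
      have : 0 ≤ ∑ k, |g k| := Finset.sum_nonneg fun i _ => abs_nonneg _
      positivity
    simp only [abs_one, one_mul]
    calc |d.H' t g x| * Real.exp (d.H t g x)
        ≤ ((C * ∑ k, |g k| + C) * d.U x ^ 2) * Real.exp (d.H t g x) := by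
          gcongr; exact hx t ht
      _ = (C * ∑ k, |g k| + C) * (d.U x ^ 2 * Real.exp (d.H t g x)) := by ring
      _ ≤ _ := by gcongr; exact hx2 t ht

lemma H_update [DecidableEq ι] (d : GD X ι) (t : ℝ) (g : ι → ℝ) (k : ι) (y : ℝ) (x : X) :
    d.H t (Function.update g k y) x = d.H t g x + d.c k t * (y - g k) * d.φ k x := by
  unfold GD.H
  rw [← Finset.add_sum_erase _ _ (Finset.mem_univ k),
    ← Finset.add_sum_erase Finset.univ (fun k => d.c k t * g k * d.φ k x) (Finset.mem_univ k)]
  have : ∑ i ∈ Finset.univ.erase k, d.c i t * (Function.update g k y) i * d.φ i x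
      = ∑ i ∈ Finset.univ.erase k, d.c i t * g i * d.φ i x := by
    apply Finset.sum_congr rfl
    intro i hi
    rw [Function.update_of_ne (Finset.ne_of_mem_erase hi)]
  rw [this, Function.update_self]
  ring

lemma derivG [DecidableEq ι] (hd : d.Good t0 r C) {t : ℝ} (ht : t ∈ Metric.ball t0 r)
    (g : ι → ℝ) (k : ι) (ψ : X → ℝ) (mψ : Measurable ψ) (hψ : ∀ᵐ x ∂d.ν, |ψ x| ≤ d.U x) :
    HasDerivAt (fun y => ∫ x, ψ x * Real.exp (d.H t (Function.update g k y) x) ∂d.ν)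
      (d.c k t * ∫ x, ψ x * d.φ k x * Real.exp (d.H t g x) ∂d.ν) (g k) := by
  have := hd.fin
  obtain ⟨K, hK⟩ := hd.H1 (∑ k, |g k| + 1)
  have hgb : ∀ y ∈ Metric.ball (g k) 1, ∀ i, |Function.update g k y i| ≤ ∑ k, |g k| + 1 := by
    intro y hy i
    have h0 : ∀ i, |g i| ≤ ∑ k, |g k| := fun i => Finset.single_le_sum (f := fun i => |g i|)
      (fun i _ => abs_nonneg _) (Finset.mem_univ i)
    by_cases hi : i = k
    · subst hi
      rw [Function.update_self]
      have h1 : |y - g i| < 1 := by simpa [Real.dist_eq] using hy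
      have h2 : |y| ≤ |y - g i| + |g i| := by
        have := abs_add_le (y - g i) (g i); simpa using this
      have := h0 i
      linarith
    · rw [Function.update_of_ne hi]
      have := h0 i
      linarith
  have := hasDerivAt_int_exp d.ν ψ (fun y x => d.H t (Function.update g k y) x)
    (fun _ x => d.c k t * d.φ k x) (g k) 1 K (C * K) one_pos mψ
    (fun y => hd.mHx t _) ((hd.mφ k).const_mul _) ?_ ?_ ?_
  · refine this.congr_deriv ?_
    rw [← integral_const_mul]
    congr 1; funext x
    rw [Function.update_eq_self]; ring
  · refine Eventually.of_forall fun x y _ => ?_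
    simp only [H_update]
    have := (((hasDerivAt_id y).sub_const (g k)).const_mul (d.c k t)).mul_const (d.φ k x)
    refine (this.const_add (d.H t g x)).congr_deriv ?_
    ring
  · filter_upwards [hK, hd.hx, hψ] with x hx hx2 hx3
    have h1 := hx t ht _ (hgb _ (Metric.mem_ball_self one_pos))
    refine le_trans ?_ h1
    have h2 := hx2.1
    gcongr
    nlinarith
  · filter_upwards [hK, hd.hx, hψ] with x hx hx2 hx3 y hy
    have h1 := hx t ht _ (hgb y hy)
    have h2 := hx2.1
    have h3 := hx2.2.1 k
    have h4 := (hd.hc k t ht).2.1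
    have hC := hd.C0
    rw [abs_mul]
    calc |ψ x| * (|d.c k t| * |d.φ k x|) * Real.exp (d.H t (Function.update g k y) x)
        ≤ d.U x * (C * d.U x) * Real.exp (d.H t (Function.update g k y) x) := by gcongr
      _ = C * (d.U x ^ 2 * Real.exp (d.H t (Function.update g k y) x)) := by ring
      _ ≤ _ := by gcongr

lemma derivGav [DecidableEq ι] (hd : d.Good t0 r C) {t : ℝ} (ht : t ∈ Metric.ball t0 r)
    (g : ι → ℝ) (k : ι) :
    HasDerivAt (fun y => gav d.ν (d.H t (Function.update g k y)) (d.φ k))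
      (d.c k t * (gav d.ν (d.H t g) (fun x => d.φ k x ^ 2) - gav d.ν (d.H t g) (d.φ k) ^ 2))
      (g k) := by
  have h1 := hd.derivG ht g k (d.φ k) (hd.mφ k) (by filter_upwards [hd.hx] with x hx using hx.2.1 k)
  have h2 := hd.derivG ht g k (fun _ => 1) measurable_const
    (by filter_upwards [hd.hx] with x hx; simpa using hx.1)
  simp only [one_mul] at h2
  have hz := (hd.Zpos ht g).ne'
  have := h1.div h2 (by rw [Function.update_eq_self]; exact hz)
  refine this.congr_deriv ?_
  rw [Function.update_eq_self]
  unfold gav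
  have e : ∀ x, d.φ k x ^ 2 * Real.exp (d.H t g x) = d.φ k x * d.φ k x * Real.exp (d.H t g x) :=
    fun x => by ring
  simp only [e]
  field_simp

/-- Gaussian integration by parts for the Gibbs average. -/
lemma stein (hd : d.Good t0 r C) (v : ι → NNReal) (hv : ∀ i, v i ≠ 0) {t : ℝ}
    (ht : t ∈ Metric.ball t0 r) (k : ι) :
    ∫ g, g k * gav d.ν (d.H t g) (d.φ k) ∂(Measure.pi fun i => gaussianReal 0 (v i))
      = v k * ∫ g, d.c k t * (gav d.ν (d.H t g) (fun x => d.φ k x ^ 2)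
        - gav d.ν (d.H t g) (d.φ k) ^ 2) ∂(Measure.pi fun i => gaussianReal 0 (v i)) := by
  classical
  obtain ⟨Γ, hΓ, hΓ2⟩ := hd.H2
  have m1 := hd.mgav t _ (hd.mφ k)
  have m2 := hd.mgav t _ ((hd.mφ k).pow_const 2)
  have g1 : ExpGr (fun g => gav d.ν (d.H t g) (d.φ k)) := hΓ.of_le fun g => by
    simpa using hd.gav_le ht g (hΓ2 t ht g) _ 1 zero_le_one (hd.phi_le k)
  have g2 : ExpGr (fun g => gav d.ν (d.H t g) (fun x => d.φ k x ^ 2)) := hΓ.of_le fun g => by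
    simpa using hd.gav_le ht g (hΓ2 t ht g) _ 1 zero_le_one (hd.phi2_le k)
  refine stein_gr v hv k _ _ (fun g => hd.derivGav ht g k) m1
    (measurable_const.mul (m2.sub (m1.pow_const 2))) g1 ?_
  simpa [sub_eq_add_neg] using (g2.add ((g1.pow 2).const_mul (-1))).const_mul (d.c k t)

lemma gavH' (hd : d.Good t0 r C) {t : ℝ} (ht : t ∈ Metric.ball t0 r) (g : ι → ℝ) :
    gav d.ν (d.H t g) (d.H' t g) = ∑ k, d.c' k t * (g k * gav d.ν (d.H t g) (d.φ k))
      + gav d.ν (d.H t g) (d.B' t) := by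
  unfold gav GD.H'
  have : ∀ x, (∑ k, d.c' k t * g k * d.φ k x + d.B' t x) * Real.exp (d.H t g x)
    = ∑ k, d.c' k t * g k * (d.φ k x * Real.exp (d.H t g x)) + d.B' t x * Real.exp (d.H t g x) := by
    intro x
    rw [add_mul, Finset.sum_mul]; congr 1
    apply Finset.sum_congr rfl; intros; ring
  simp only [this]
  rw [integral_add, integral_finsetSum]
  · rw [add_div, Finset.sum_div]
    congr 1
    apply Finset.sum_congr rfl; intro k _
    rw [integral_const_mul]; ring
  · intro k _
    exact (hd.int_of_le ht g _ (hd.mφ k) 1 (hd.phi_le k)).const_mul _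
  · refine integrable_finsetSum _ fun k _ => ?_
    exact (hd.int_of_le ht g _ (hd.mφ k) 1 (hd.phi_le k)).const_mul _
  · exact hd.int_of_le ht g _ (hd.mB' t) C (hd.B'_le ht)

/-- The derivative of the averaged free energy. -/
theorem main (hd : d.Good t0 r C) (v : ι → NNReal) (hv : ∀ i, v i ≠ 0) :
    HasDerivAt (fun t => ∫ g, Real.log (∫ x, Real.exp (d.H t g x) ∂d.ν)
        ∂(Measure.pi fun i => gaussianReal 0 (v i)))
      (∫ g, (gav d.ν (d.H t0 g) (d.B' t0) + ∑ k, v k * d.c k t0 * d.c' k t0 *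
        (gav d.ν (d.H t0 g) (fun x => d.φ k x ^ 2) - gav d.ν (d.H t0 g) (d.φ k) ^ 2))
        ∂(Measure.pi fun i => gaussianReal 0 (v i))) t0 := by
  obtain ⟨Γ, hΓ, hΓ2⟩ := hd.H2
  have hC := hd.C0
  have ht := hd.t0mem
  have m1 := fun k => hd.mgav t0 _ (hd.mφ k)
  have m2 := fun k => hd.mgav t0 _ ((hd.mφ k).pow_const 2)
  have m3 := hd.mgav t0 _ (hd.mB' t0)
  have g1 : ∀ k, ExpGr (fun g => gav d.ν (d.H t0 g) (d.φ k)) := fun k => hΓ.of_le fun g => by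
    simpa using hd.gav_le ht g (hΓ2 t0 ht g) _ 1 zero_le_one (hd.phi_le k)
  have g2 : ∀ k, ExpGr (fun g => gav d.ν (d.H t0 g) (fun x => d.φ k x ^ 2)) := fun k =>
    hΓ.of_le fun g => by
    simpa using hd.gav_le ht g (hΓ2 t0 ht g) _ 1 zero_le_one (hd.phi2_le k)
  have g3 : ExpGr (fun g => gav d.ν (d.H t0 g) (d.B' t0)) := (hΓ.const_mul C).of_le fun g => by
    rw [abs_mul, abs_of_nonneg hC]
    exact hd.gav_le ht g (hΓ2 t0 ht g) _ C hC (hd.B'_le ht)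
  have hb : ExpGr (fun g => (C * ∑ k, |g k| + C) * |Γ g|) :=
    (((ExpGr.sum Finset.univ fun k _ => (ExpGr.coord k).abs).const_mul C).add
      (ExpGr.const C)).mul hΓ.abs
  obtain ⟨A, a, _, _, hA⟩ := hb
  have hs : ∀ g : ι → ℝ, 0 ≤ C * ∑ k, |g k| + C := by
    intro g
    have : 0 ≤ ∑ k, |g k| := Finset.sum_nonneg fun i _ => abs_nonneg _
    positivity
  have D := (hasDerivAt_integral_of_dominated_loc_of_deriv_le
    (μ := Measure.pi fun i => gaussianReal 0 (v i))
    (bound := fun g => A * Real.exp (a * ∑ i, |g i|))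
    (F := fun t g => Real.log (∫ x, Real.exp (d.H t g x) ∂d.ν))
    (F' := fun t g => gav d.ν (d.H t g) (d.H' t g))
    (Metric.ball_mem_nhds t0 hd.hr) ?_ ?_ ?_ ?_ ?_ ?_).2
  · refine D.congr_deriv ?_
    simp only [hd.gavH' ht]
    have i1 : ∀ k, Integrable (fun g : ι → ℝ => d.c' k t0 * (g k * gav d.ν (d.H t0 g) (d.φ k)))
        (Measure.pi fun i => gaussianReal 0 (v i)) := fun k =>
      (((ExpGr.coord k).mul (g1 k)).integrable v
        ((measurable_pi_apply k).mul (m1 k)).aestronglyMeasurable).const_mul _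
    have i3 := g3.integrable v m3.aestronglyMeasurable
    have gg : ∀ k, ExpGr (fun g => (gav d.ν (d.H t0 g) (fun x => d.φ k x ^ 2)
        - gav d.ν (d.H t0 g) (d.φ k) ^ 2)) := fun k => by
      simpa [sub_eq_add_neg] using ((g2 k).add (((g1 k).pow 2).const_mul (-1)))
    have i2 : ∀ k, Integrable (fun g => (gav d.ν (d.H t0 g) (fun x => d.φ k x ^ 2)
        - gav d.ν (d.H t0 g) (d.φ k) ^ 2)) (Measure.pi fun i => gaussianReal 0 (v i)) := fun k =>
      (gg k).integrable v ((m2 k).sub ((m1 k).pow_const 2)).aestronglyMeasurable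
    rw [integral_add (integrable_finsetSum _ fun k _ => i1 k) i3,
      integral_add i3 (integrable_finsetSum _ fun k _ => (i2 k).const_mul _),
      integral_finsetSum _ fun k _ => i1 k,
      integral_finsetSum _ fun k _ => (i2 k).const_mul _, add_comm]
    congr 1
    apply Finset.sum_congr rfl
    intro k _
    rw [integral_const_mul, hd.stein v hv ht k, integral_const_mul, integral_const_mul]
    ring
  · exact Eventually.of_forall fun t => (hd.mZ t).log.aestronglyMeasurable
  · exact hd.H3.integrable v (hd.mZ t0).log.aestronglyMeasurable
  · have : (fun g => gav d.ν (d.H t0 g) (d.H' t0 g)) = fun g =>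
        ∑ k, d.c' k t0 * (g k * gav d.ν (d.H t0 g) (d.φ k))
          + gav d.ν (d.H t0 g) (d.B' t0) := by
      funext g; exact hd.gavH' ht g
    rw [this]
    refine Measurable.aestronglyMeasurable ?_
    refine (Finset.measurable_fun_sum _ fun k _ => ?_).add m3
    exact measurable_const.mul ((measurable_pi_apply k).mul (m1 k))
  · refine Eventually.of_forall fun g t ht => ?_
    refine le_trans ?_ ((le_abs_self _).trans (hA g))
    rw [Real.norm_eq_abs]
    refine hd.gav_le ht g (hΓ2 t ht g) _ _ (hs g) ?_
    filter_upwards [hd.H'_le g] with x hx using hx t ht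
  · exact (integrable_exp_sum v a).const_mul A
  · exact Eventually.of_forall fun g t ht => hd.derivZ ht g

end Good
end GD

/-! ### Bounded systems, features of the noise matrix -/

lemma abs_log_int_exp_le {X : Type*} [MeasurableSpace X] (ν : Measure X) [IsFiniteMeasure ν]
    (hne : ν ≠ 0) (H : X → ℝ) (mH : Measurable H) (L : ℝ) (hL : ∀ᵐ x ∂ν, |H x| ≤ L) :
    |Real.log (∫ x, Real.exp (H x) ∂ν)| ≤ L + |Real.log (ν.real Set.univ)| := by
  have : NeZero ν := ⟨hne⟩
  have hpos : 0 < ν.real Set.univ := by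
    rw [measureReal_def]
    exact ENNReal.toReal_pos (by simpa using hne) (measure_ne_top _ _)
  have hintg : Integrable (fun x => Real.exp (H x)) ν := by
    refine Integrable.mono' (integrable_const (Real.exp L)) mH.exp.aestronglyMeasurable ?_
    filter_upwards [hL] with x hx
    rw [Real.norm_eq_abs, Real.abs_exp]
    exact Real.exp_le_exp.2 ((le_abs_self _).trans hx)
  have h1 : ∫ x, Real.exp (H x) ∂ν ≤ Real.exp L * ν.real Set.univ := by
    calc ∫ x, Real.exp (H x) ∂ν ≤ ∫ x, Real.exp L ∂ν := by
          refine integral_mono_ae hintg (integrable_const _) ?_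
          filter_upwards [hL] with x hx
          exact Real.exp_le_exp.2 ((le_abs_self _).trans hx)
      _ = _ := by simp [mul_comm]
  have h2 : Real.exp (-L) * ν.real Set.univ ≤ ∫ x, Real.exp (H x) ∂ν := by
    calc _ = ∫ x, Real.exp (-L) ∂ν := by simp [mul_comm]
      _ ≤ _ := by
          refine integral_mono_ae (integrable_const _) hintg ?_
          filter_upwards [hL] with x hx
          exact Real.exp_le_exp.2 (abs_le.1 hx).1
  have hz := integral_exp_pos hintg
  have l1 := Real.log_le_log hz h1
  have l2 := Real.log_le_log (by positivity) h2
  rw [Real.log_mul (Real.exp_pos _).ne' hpos.ne', Real.log_exp] at l1 l2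
  rw [abs_le]
  constructor
  · have := neg_abs_le (Real.log (ν.real Set.univ)); linarith
  · have := le_abs_self (Real.log (ν.real Set.univ)); linarith

lemma GD.good_of_bounded {X ι : Type*} [MeasurableSpace X] [Fintype ι] (d : GD X ι)
    (t0 r C M : ℝ) (hr : 0 < r) (fin : IsFiniteMeasure d.ν) (ne : d.ν ≠ 0)
    (mφ : ∀ k, Measurable (d.φ k)) (mB : ∀ t, Measurable (d.B t)) (mB' : ∀ t, Measurable (d.B' t))
    (hM : 1 ≤ M) (hU : d.U = fun _ => M) (hC : 0 ≤ C)
    (hx : ∀ᵐ x ∂d.ν, (∀ k, |d.φ k x| ≤ M) ∧ ∀ t ∈ Metric.ball t0 r,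
      HasDerivAt (fun t => d.B t x) (d.B' t x) t ∧ |d.B t x| ≤ M ∧ |d.B' t x| ≤ M)
    (hc : ∀ k, ∀ t ∈ Metric.ball t0 r,
      HasDerivAt (d.c k) (d.c' k t) t ∧ |d.c k t| ≤ C ∧ |d.c' k t| ≤ C) :
    d.Good t0 r (C + M) := by
  have hH : ∀ᵐ x ∂d.ν, ∀ t ∈ Metric.ball t0 r, ∀ g, |d.H t g x| ≤ C * M * ∑ k, |g k| + M := by
    filter_upwards [hx] with x hx t ht g
    unfold GD.H
    have h1 : |∑ k, d.c k t * g k * d.φ k x| ≤ C * M * (∑ k, |g k|) := by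
      calc |∑ k, d.c k t * g k * d.φ k x| ≤ ∑ k, |d.c k t * g k * d.φ k x| :=
            Finset.abs_sum_le_sum_abs _ _
        _ ≤ ∑ k, C * |g k| * M := by
            gcongr with k
            rw [abs_mul, abs_mul]
            have h1 := (hc k t ht).2.1
            have h2 := hx.1 k
            gcongr
        _ = _ := by rw [Finset.mul_sum]; apply Finset.sum_congr rfl; intros; ring
    have := abs_add_le (∑ k, d.c k t * g k * d.φ k x) (d.B t x)
    have := (hx.2 t ht).2.1
    linarith
  have mHx : ∀ t g, Measurable (d.H t g) := by
    intro t g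
    unfold GD.H
    have := mB t
    fun_prop
  refine ⟨hr, fin, ne, mφ, mB, mB', by rw [hU]; exact measurable_const, ?_, ?_, ?_, ?_, ?_⟩
  · filter_upwards [hx] with x hx
    rw [hU]
    refine ⟨hM, hx.1, fun t ht => ⟨(hx.2 t ht).1, (hx.2 t ht).2.2.trans ?_⟩⟩
    have : (1:ℝ) ≤ M ^ 2 := by nlinarith
    nlinarith
  · intro k t ht
    obtain ⟨h1, h2, h3⟩ := hc k t ht
    exact ⟨h1, by linarith, by linarith⟩
  · intro L
    refine ⟨M ^ 2 * Real.exp (C * M * ∑ k : ι, L + M), ?_⟩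
    filter_upwards [hH] with x hx t ht g hg
    rw [hU]
    gcongr
    refine (le_abs_self _).trans ((hx t ht g).trans ?_)
    gcongr with k
    exact hg k
  · refine ⟨fun _ => M ^ 2, ExpGr.const _, fun t ht g => ?_⟩
    rw [hU]
    simp only
    rw [integral_const_mul, abs_of_nonneg (by positivity)]
  · refine ExpGr.of_le (h := fun g => C * M * ∑ k, |g k| + (M + |Real.log (d.ν.real Set.univ)|))
      (((ExpGr.sum Finset.univ fun k _ => (ExpGr.coord k).abs).const_mul _).add
        (ExpGr.const _)) fun g => ?_
    have := abs_log_int_exp_le d.ν ne (d.H t0 g) (mHx t0 g) (C * M * ∑ k, |g k| + M) (by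
      filter_upwards [hH] with x hx
      exact hx t0 (Metric.mem_ball_self hr) g)
    refine this.trans (le_trans (le_of_eq ?_) (le_abs_self _))
    ring

/-- variances of the independent noise entries -/
def nv {n : ℕ} (p : Fin n × Fin n) : NNReal := if p.1 = p.2 then 2 else 1

lemma nv_ne {n : ℕ} (p : Fin n × Fin n) : nv p ≠ 0 := by
  unfold nv; split_ifs <;> norm_num

/-- law of the independent noise entries -/
def gpi (n : ℕ) : Measure (Fin n × Fin n → ℝ) :=
  Measure.pi fun p => gaussianReal 0 (nv p)

instance (n : ℕ) : IsProbabilityMeasure (gpi n) := by unfold gpi; infer_instance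

/-- symmetric extension -/
def symZ {n : ℕ} (g : Fin n × Fin n → ℝ) : Matrix (Fin n) (Fin n) ℝ :=
  Matrix.of fun i j => if i ≤ j then g (i, j) else g (j, i)

lemma measurable_symZ (n : ℕ) : Measurable (symZ : (Fin n × Fin n → ℝ) → Matrix (Fin n) (Fin n) ℝ) := by
  change Measurable (fun g : Fin n × Fin n → ℝ => fun i j => if i ≤ j then g (i, j) else g (j, i))
  refine measurable_pi_lambda _ fun i => measurable_pi_lambda _ fun j => ?_
  split_ifs <;> fun_prop

lemma noise_eq (n : ℕ) : noiseMeasure n = (gpi n).map symZ := rfl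

/-- features -/
def ft {n : ℕ} (T : Fin n → Fin n → ℝ) (p : Fin n × Fin n) : ℝ :=
  if p.1 < p.2 then T p.1 p.2 else if p.1 = p.2 then T p.1 p.1 / 2 else 0

lemma sum_symm {n : ℕ} (F : Fin n → Fin n → ℝ) (hF : ∀ i j, F i j = F j i) :
    ∑ p : Fin n × Fin n, (if p.1 < p.2 then 2 * F p.1 p.2 else if p.1 = p.2 then F p.1 p.1 else 0)
      = ∑ i, ∑ j, F i j := by
  have h1 : ∀ i j : Fin n, F i j = (if i < j then F i j else 0) + (if i = j then F i i else 0)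
      + (if j < i then F j i else 0) := by
    intro i j
    rcases lt_trichotomy i j with h | h | h
    · simp [h, h.ne, not_lt.2 h.le]
    · subst h; simp
    · simp [h, h.ne', not_lt.2 h.le, hF i j]
  have h2 : ∑ i, ∑ j, F i j = ∑ i, ∑ j, (if i < j then F i j else 0)
      + ∑ i, ∑ j, (if i = j then F i i else 0) + ∑ i, ∑ j, (if j < i then F j i else 0) := by
    rw [← Finset.sum_add_distrib, ← Finset.sum_add_distrib]
    apply Finset.sum_congr rfl; intro i _
    rw [← Finset.sum_add_distrib, ← Finset.sum_add_distrib]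
    apply Finset.sum_congr rfl; intro j _
    exact h1 i j
  rw [h2, Finset.sum_comm (f := fun i j => if j < i then F j i else 0), Fintype.sum_prod_type,
    ← Finset.sum_add_distrib, ← Finset.sum_add_distrib]
  apply Finset.sum_congr rfl; intro i _
  rw [← Finset.sum_add_distrib, ← Finset.sum_add_distrib]
  apply Finset.sum_congr rfl; intro j _
  rcases lt_trichotomy i j with h | h | h
  · simp [h, h.ne]; ring
  · subst h; simp
  · simp [h.ne', not_lt.2 h.le]

lemma ft_noise {n : ℕ} (g : Fin n × Fin n → ℝ) (T : Fin n → Fin n → ℝ) (hT : ∀ i j, T i j = T j i) :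
    ∑ p, g p * ft T p = 1 / 2 * ∑ i, ∑ j, symZ g i j * T i j := by
  rw [← sum_symm (fun i j => symZ g i j * T i j), Finset.mul_sum]
  · apply Finset.sum_congr rfl
    rintro ⟨i, j⟩ _
    simp only [ft, symZ, Matrix.of_apply]
    rcases lt_trichotomy i j with h | h | h
    · simp [h, h.le]
    · subst h; simp; ring
    · simp [h.ne', not_lt.2 h.le]
  · intro i j
    simp only [symZ, Matrix.of_apply, hT i j]
    rcases lt_trichotomy i j with h | h | h
    · simp [h.le, not_le.2 h]
    · subst h; simp
    · simp [h.le, not_le.2 h]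

lemma ft_inner {n : ℕ} (S T : Fin n → Fin n → ℝ) (hS : ∀ i j, S i j = S j i)
    (hT : ∀ i j, T i j = T j i) :
    ∑ p, (nv p : ℝ) * (ft S p * ft T p) = 1 / 2 * ∑ i, ∑ j, S i j * T i j := by
  rw [← sum_symm (fun i j => S i j * T i j) (fun i j => by rw [hS, hT]), Finset.mul_sum]
  apply Finset.sum_congr rfl
  rintro ⟨i, j⟩ _
  simp only [ft, nv]
  rcases lt_trichotomy i j with h | h | h
  · simp [h, h.ne]
  · subst h; simp; ring
  · simp [h.ne', not_lt.2 h.le]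

/-- quadratic features of a vector -/
def qf {n : ℕ} (p : Fin n × Fin n) (x : Fin n → ℝ) : ℝ := ft (fun i j => x i * x j) p

lemma measurable_qf {n : ℕ} (p : Fin n × Fin n) : Measurable (qf p) := by
  unfold qf ft; split_ifs <;> fun_prop

lemma sum_mul_dot {n : ℕ} (x y : Fin n → ℝ) :
    ∑ i, ∑ j, (x i * x j) * (y i * y j) = (x ⬝ᵥ y) ^ 2 := by
  simp only [dotProduct, sq, Finset.sum_mul_sum]
  apply Finset.sum_congr rfl; intro i _
  apply Finset.sum_congr rfl; intro j _
  ring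

lemma qf_inner {n : ℕ} (x y : Fin n → ℝ) :
    ∑ p, (nv p : ℝ) * (qf p x * qf p y) = 1 / 2 * (x ⬝ᵥ y) ^ 2 := by
  unfold qf
  rw [ft_inner _ _ (fun i j => mul_comm _ _) (fun i j => mul_comm _ _), sum_mul_dot]

lemma qf_noise {n : ℕ} (g : Fin n × Fin n → ℝ) (x : Fin n → ℝ) :
    ∑ p, g p * qf p x = 1 / 2 * (x ⬝ᵥ (symZ g *ᵥ x)) := by
  unfold qf
  rw [ft_noise g _ (fun i j => mul_comm _ _)]
  congr 1
  simp only [dotProduct, mulVec, Finset.mul_sum]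
  apply Finset.sum_congr rfl; intro i _
  apply Finset.sum_congr rfl; intro j _
  ring

lemma abs_qf_le {n : ℕ} (p : Fin n × Fin n) (x : Fin n → ℝ) : |qf p x| ≤ x ⬝ᵥ x := by
  have hi : ∀ i, x i * x i ≤ x ⬝ᵥ x := fun i =>
    Finset.single_le_sum (f := fun i => x i * x i) (fun i _ => mul_self_nonneg _)
      (Finset.mem_univ i)
  have h0 : 0 ≤ x ⬝ᵥ x := Finset.sum_nonneg fun i _ => mul_self_nonneg _
  unfold qf ft
  split_ifs with h1 h2
  · have hh : x p.1 * x p.1 + x p.2 * x p.2 ≤ x ⬝ᵥ x := by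
      rw [← Finset.sum_pair (f := fun i => x i * x i) h1.ne]
      exact Finset.sum_le_sum_of_subset_of_nonneg (Finset.subset_univ _)
        (fun _ _ _ => mul_self_nonneg _)
    rw [abs_le]
    constructor <;> nlinarith [sq_nonneg (x p.1 + x p.2), sq_nonneg (x p.1 - x p.2)]
  · have := hi p.1
    have := mul_self_nonneg (x p.1)
    rw [abs_of_nonneg (by positivity)]
    linarith
  · simpa using h0

lemma dot_sq_le {n : ℕ} (x y : Fin n → ℝ) : (x ⬝ᵥ y) ^ 2 ≤ (x ⬝ᵥ x) * (y ⬝ᵥ y) := by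
  have := Finset.sum_mul_sq_le_sq_mul_sq Finset.univ x y
  simpa [dotProduct, sq] using this

lemma dot_self_nonneg {n : ℕ} (x : Fin n → ℝ) : 0 ≤ x ⬝ᵥ x :=
  Finset.sum_nonneg fun i _ => mul_self_nonneg _

lemma gav_const_mul {X : Type*} [MeasurableSpace X] (ν : Measure X) (H f : X → ℝ) (a : ℝ) :
    gav ν H (fun x => a * f x) = a * gav ν H f := by
  unfold gav
  simp only [mul_assoc]
  rw [integral_const_mul, mul_div_assoc]

lemma gav_ft {n : ℕ} {X : Type*} [MeasurableSpace X] (ν : Measure X) (H : X → ℝ)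
    (T : X → Fin n → Fin n → ℝ) (p : Fin n × Fin n) :
    gav ν H (fun x => ft (T x) p) = ft (fun i j => gav ν H (fun x => T x i j)) p := by
  unfold ft
  split_ifs with h1 h2
  · rfl
  · have := gav_const_mul ν H (fun x => T x p.1 p.1) (1 / 2)
    convert this using 2
    · funext x; ring
    · ring
  · simp [gav]

lemma gav_finset_sum {X κ : Type*} [MeasurableSpace X] (ν : Measure X) (H : X → ℝ)
    (s : Finset κ) (f : κ → X → ℝ)
    (hf : ∀ k ∈ s, Integrable (fun x => f k x * Real.exp (H x)) ν) :
    gav ν H (fun x => ∑ k ∈ s, f k x) = ∑ k ∈ s, gav ν H (f k) := by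
  unfold gav
  simp only [Finset.sum_mul]
  rw [integral_finsetSum _ hf, Finset.sum_div]

lemma gav_add {X : Type*} [MeasurableSpace X] (ν : Measure X) (H f h : X → ℝ)
    (hf : Integrable (fun x => f x * Real.exp (H x)) ν)
    (hh : Integrable (fun x => h x * Real.exp (H x)) ν) :
    gav ν H (fun x => f x + h x) = gav ν H f + gav ν H h := by
  unfold gav
  simp only [add_mul]
  rw [integral_add hf hh, add_div]

lemma gav_mono {X : Type*} [MeasurableSpace X] (ν : Measure X) (H f h : X → ℝ)
    (hf : Integrable (fun x => f x * Real.exp (H x)) ν)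
    (hh : Integrable (fun x => h x * Real.exp (H x)) ν) (hle : ∀ᵐ x ∂ν, f x ≤ h x) :
    gav ν H f ≤ gav ν H h := by
  unfold gav
  refine div_le_div_of_nonneg_right (integral_mono_ae hf hh ?_)
    (integral_nonneg fun x => (Real.exp_pos _).le)
  filter_upwards [hle] with x hx
  exact mul_le_mul_of_nonneg_right hx (Real.exp_pos _).le

lemma gav_sq_le {X : Type*} [MeasurableSpace X] (ν : Measure X) (H f : X → ℝ)
    (h0 : Integrable (fun x => Real.exp (H x)) ν)
    (hf : Integrable (fun x => f x * Real.exp (H x)) ν)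
    (hf2 : Integrable (fun x => f x ^ 2 * Real.exp (H x)) ν)
    (hz : 0 < ∫ x, Real.exp (H x) ∂ν) :
    gav ν H f ^ 2 ≤ gav ν H (fun x => f x ^ 2) := by
  set m := gav ν H f with hm
  have h1 : 0 ≤ ∫ x, (f x - m) ^ 2 * Real.exp (H x) ∂ν :=
    integral_nonneg fun x => by positivity
  have h2 : ∫ x, (f x - m) ^ 2 * Real.exp (H x) ∂ν
      = ∫ x, f x ^ 2 * Real.exp (H x) ∂ν - 2 * m * (∫ x, f x * Real.exp (H x) ∂ν)
        + m ^ 2 * ∫ x, Real.exp (H x) ∂ν := by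
    have e : ∀ x, (f x - m) ^ 2 * Real.exp (H x) = (f x ^ 2 * Real.exp (H x)
        - 2 * m * (f x * Real.exp (H x))) + m ^ 2 * Real.exp (H x) := fun x => by ring
    simp only [e]
    rw [integral_add, integral_sub hf2 (hf.const_mul _), integral_const_mul, integral_const_mul]
    · exact hf2.sub (hf.const_mul _)
    · exact h0.const_mul _
  rw [h2] at h1
  have h3 : ∫ x, f x * Real.exp (H x) ∂ν = m * ∫ x, Real.exp (H x) ∂ν := by
    rw [hm]; unfold gav; field_simp
  have h4 : gav ν H (fun x => f x ^ 2) = (∫ x, f x ^ 2 * Real.exp (H x) ∂ν) / ∫ x, Real.exp (H x) ∂ν := rfl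
  rw [h3] at h1
  rw [h4, le_div_iff₀ hz]
  nlinarith

/-! ### The I-MMSE identity for fixed signal -/

lemma moment_bound {X : Type*} [MeasurableSpace X] (P : Measure X) [IsProbabilityMeasure P]
    (u H : X → ℝ) (mu : Measurable u) (mH : Measurable H) (hu : ∀ x, 0 ≤ u x)
    (hu1 : Integrable u P) (hu2 : Integrable (fun x => u x ^ 2) P) (b δ0 δ1 : ℝ) (hb : 0 ≤ b)
    (hδ0 : 0 < δ0) (hδ1 : 0 ≤ δ1) (hlo : ∀ x, -(b * u x) - δ1 * u x ^ 2 ≤ H x)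
    (hhi : ∀ x, H x ≤ b * u x - δ0 * u x ^ 2) :
    Real.log (∫ x, Real.exp (H x) ∂P) ≤ b ^ 2 / (4 * δ0) ∧
    -(b * (∫ x, u x ∂P) + δ1 * ∫ x, u x ^ 2 ∂P) ≤ Real.log (∫ x, Real.exp (H x) ∂P) ∧
    ∫ x, u x ^ 2 * Real.exp (H x) ∂P ≤ (2 / δ0) * (b ^ 2 / (2 * δ0) +
      (b * (∫ x, u x ∂P) + δ1 * ∫ x, u x ^ 2 ∂P)) * ∫ x, Real.exp (H x) ∂P := by
  have hHle : ∀ x, H x ≤ b ^ 2 / (4 * δ0) := by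
    intro x
    refine (hhi x).trans ?_
    rw [le_div_iff₀ (by positivity)]
    nlinarith [sq_nonneg (b - 2 * δ0 * u x)]
  set M := Real.exp (b ^ 2 / (4 * δ0)) with hM
  have hEle : ∀ x, Real.exp (H x) ≤ M := fun x => Real.exp_le_exp.2 (hHle x)
  have iE : Integrable (fun x => Real.exp (H x)) P :=
    Integrable.mono' (integrable_const M) mH.exp.aestronglyMeasurable
      (Eventually.of_forall fun x => by rw [Real.norm_eq_abs, Real.abs_exp]; exact hEle x)
  have iH : Integrable H P := by
    refine Integrable.mono' ((hu1.const_mul b).add (hu2.const_mul (δ0 + δ1))) mH.aestronglyMeasurable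
      (Eventually.of_forall fun x => ?_)
    rw [Real.norm_eq_abs, abs_le]
    have := hlo x
    have := hhi x
    have := hu x
    simp only [Pi.add_apply]
    have h3 : 0 ≤ u x ^ 2 := by positivity
    have h4 : 0 ≤ δ0 * u x ^ 2 := by positivity
    have h5 : 0 ≤ δ1 * u x ^ 2 := by positivity
    have h6 : 0 ≤ b * u x := by positivity
    constructor <;> nlinarith
  have imul : ∀ f : X → ℝ, Measurable f → Integrable f P →
      Integrable (fun x => f x * Real.exp (H x)) P := fun f mf hf => by
    refine hf.mul_bdd (c := M) mH.exp.aestronglyMeasurable (Eventually.of_forall fun x => ?_)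
    rw [Real.norm_eq_abs, Real.abs_exp]; exact hEle x
  have hZ : 0 < ∫ x, Real.exp (H x) ∂P := integral_exp_pos iE
  have hJ : ∫ x, H x ∂P ≤ Real.log (∫ x, Real.exp (H x) ∂P) := by
    rw [Real.le_log_iff_exp_le hZ]
    set m := ∫ x, H x ∂P
    have h1 : ∫ x, Real.exp m * (H x + (1 - m)) ∂P ≤ ∫ x, Real.exp (H x) ∂P := by
      refine integral_mono ((iH.add (integrable_const _)).const_mul _) iE fun x => ?_
      have := Real.add_one_le_exp (H x - m)
      have h2 : Real.exp (H x) = Real.exp m * Real.exp (H x - m) := by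
        rw [← Real.exp_add]; ring_nf
      simp only [h2]
      gcongr
      linarith
    rw [integral_const_mul, integral_add iH (integrable_const _)] at h1
    simpa [m] using h1
  have hlow : -(b * (∫ x, u x ∂P) + δ1 * ∫ x, u x ^ 2 ∂P) ≤ Real.log (∫ x, Real.exp (H x) ∂P) := by
    refine le_trans ?_ hJ
    have : ∫ x, (-b * u x + -δ1 * u x ^ 2) ∂P ≤ ∫ x, H x ∂P :=
      integral_mono ((hu1.const_mul _).add (hu2.const_mul _)) iH fun x => by
        have := hlo x; simp only; linarith
    rw [integral_add (hu1.const_mul _) (hu2.const_mul _), integral_const_mul,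
      integral_const_mul] at this
    linarith
  refine ⟨?_, hlow, ?_⟩
  · rw [Real.log_le_iff_le_exp hZ]
    calc ∫ x, Real.exp (H x) ∂P ≤ ∫ _, M ∂P := integral_mono iE (integrable_const _) hEle
      _ = M := by simp
  · set Z := ∫ x, Real.exp (H x) ∂P with hZdef
    set K := b * (∫ x, u x ∂P) + δ1 * ∫ x, u x ^ 2 ∂P
    -- entropy inequality
    have h1 : Z * Real.log Z ≤ ∫ x, H x * Real.exp (H x) ∂P := by
      have : ∫ x, (Real.log Z * Real.exp (H x) + (Real.exp (H x) - Z)) ∂P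
          ≤ ∫ x, H x * Real.exp (H x) ∂P := by
        refine integral_mono ((iE.const_mul _).add (iE.sub (integrable_const _))) (imul H mH iH)
          fun x => ?_
        have h2 := Real.add_one_le_exp (Real.log Z - H x)
        have h3 : Real.exp (H x) * Real.exp (Real.log Z - H x) = Z := by
          rw [← Real.exp_add, add_sub_cancel, Real.exp_log hZ]
        have h4 := Real.exp_pos (H x)
        have h5 := mul_le_mul_of_nonneg_left h2 h4.le
        rw [h3] at h5
        simp only
        nlinarith
      rw [integral_add (iE.const_mul _) (by exact iE.sub (integrable_const _)), integral_const_mul,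
        integral_sub iE (integrable_const _)] at this
      simp at this
      rw [← hZdef] at this
      linarith
    have h2 : ∫ x, H x * Real.exp (H x) ∂P ≤
        ∫ x, (b ^ 2 / (2 * δ0) * Real.exp (H x) - δ0 / 2 * (u x ^ 2 * Real.exp (H x))) ∂P := by
      refine integral_mono (imul H mH iH) ((iE.const_mul _).sub
        ((imul _ (mu.pow_const 2) hu2).const_mul _)) fun x => ?_
      have h3 : H x ≤ b ^ 2 / (2 * δ0) - δ0 / 2 * u x ^ 2 := by
        refine (hhi x).trans ?_
        have : b * u x ≤ b ^ 2 / (2 * δ0) + δ0 / 2 * u x ^ 2 := by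
          have e : b ^ 2 / (2 * δ0) + δ0 / 2 * u x ^ 2 - b * u x
            = (b - δ0 * u x) ^ 2 / (2 * δ0) := by field_simp; ring
          have : 0 ≤ (b - δ0 * u x) ^ 2 / (2 * δ0) := by positivity
          linarith
        linarith
      have h4 := mul_le_mul_of_nonneg_right h3 (Real.exp_pos (H x)).le
      simp only
      linarith
    rw [integral_sub (iE.const_mul _) ((imul _ (mu.pow_const 2) hu2).const_mul _),
      integral_const_mul, integral_const_mul, ← hZdef] at h2
    have h5 : Z * (-K) ≤ Z * Real.log Z := by gcongr
    have h6 : δ0 / 2 * (∫ x, u x ^ 2 * Real.exp (H x) ∂P) ≤ (b ^ 2 / (2 * δ0) + K) * Z := by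
      linarith
    calc ∫ x, u x ^ 2 * Real.exp (H x) ∂P
        = 2 / δ0 * (δ0 / 2 * (∫ x, u x ^ 2 * Real.exp (H x) ∂P)) := by field_simp
      _ ≤ 2 / δ0 * ((b ^ 2 / (2 * δ0) + K) * Z) := by gcongr
      _ = _ := by ring

instance (n : ℕ) (v : ℝ) : IsProbabilityMeasure (gaussPrior n v) := by
  unfold gaussPrior; infer_instance

/-- Growth in the vector variable. -/
lemma expGr_dot (n : ℕ) : ExpGr (fun x : Fin n → ℝ => x ⬝ᵥ x) := by
  unfold dotProduct
  exact ExpGr.sum _ fun i _ => (ExpGr.coord i).mul (ExpGr.coord i)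

@[fun_prop]
lemma measurable_dot {Ω : Type*} [MeasurableSpace Ω] {n : ℕ} {f h : Ω → Fin n → ℝ}
    (hf : Measurable f) (hh : Measurable h) : Measurable (fun ω => f ω ⬝ᵥ h ω) := by
  unfold dotProduct
  fun_prop

lemma int_dot_pow (n : ℕ) (v : ℝ) (m : ℕ) :
    Integrable (fun x : Fin n → ℝ => (x ⬝ᵥ x) ^ m) (gaussPrior n v) :=
  ((expGr_dot n).pow m).integrable _ (by
    have : Measurable (fun x : Fin n → ℝ => (x ⬝ᵥ x) ^ m) := by fun_prop
    exact this.aestronglyMeasurable)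

lemma int_dot (n : ℕ) (v : ℝ) :
    Integrable (fun x : Fin n → ℝ => x ⬝ᵥ x) (gaussPrior n v) := by
  simpa using int_dot_pow n v 1

/-- The Hamiltonian. -/
def Hs (n : ℕ) (s : Fin n → ℝ) (lam : ℝ) (g : Fin n × Fin n → ℝ) (x : Fin n → ℝ) : ℝ :=
  ∑ p, Real.sqrt (lam / n) * g p * qf p x +
    (lam / (2 * n) * (s ⬝ᵥ x) ^ 2 - lam / (4 * n) * (x ⬝ᵥ x) ^ 2)

def dI (n : ℕ) (v : ℝ) (s : Fin n → ℝ) : GD (Fin n → ℝ) (Fin n × Fin n) where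
  ν := gaussPrior n v
  φ := qf
  c := fun _ lam => Real.sqrt (lam / n)
  c' := fun _ lam => (1 / n) / (2 * Real.sqrt (lam / n))
  B := fun lam x => lam / (2 * n) * (s ⬝ᵥ x) ^ 2 - lam / (4 * n) * (x ⬝ᵥ x) ^ 2
  B' := fun _ x => 1 / (2 * n) * (s ⬝ᵥ x) ^ 2 - 1 / (4 * n) * (x ⬝ᵥ x) ^ 2
  U := fun x => 1 + x ⬝ᵥ x

lemma dI_H (n : ℕ) (v : ℝ) (s : Fin n → ℝ) : (dI n v s).H = Hs n s := rfl

def bI (n : ℕ) (lam0 : ℝ) (s : Fin n → ℝ) (g : Fin n × Fin n → ℝ) : ℝ :=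
  Real.sqrt (2 * lam0 / n) * ∑ p, |g p| + lam0 / n * (s ⬝ᵥ s)

lemma bI_nonneg (n : ℕ) (lam0 : ℝ) (h0 : 0 < lam0) (s : Fin n → ℝ) (g : Fin n × Fin n → ℝ) :
    0 ≤ bI n lam0 s g := by
  unfold bI
  have := dot_self_nonneg s
  have : 0 ≤ ∑ p, |g p| := Finset.sum_nonneg fun i _ => abs_nonneg _
  positivity

lemma abs_sum_qf_le {n : ℕ} (c : ℝ) (hc : 0 ≤ c) (g : Fin n × Fin n → ℝ) (x : Fin n → ℝ) :
    |∑ p, c * g p * qf p x| ≤ c * (∑ p, |g p|) * (x ⬝ᵥ x) := by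
  calc |∑ p, c * g p * qf p x| ≤ ∑ p, |c * g p * qf p x| := Finset.abs_sum_le_sum_abs _ _
    _ ≤ ∑ p, c * |g p| * (x ⬝ᵥ x) := by
        gcongr with p
        rw [abs_mul, abs_mul, abs_of_nonneg hc]
        gcongr
        exact abs_qf_le p x
    _ = _ := by rw [Finset.mul_sum, Finset.sum_mul]

lemma Hs_bounds (n : ℕ) (hn : 1 ≤ n) (lam0 : ℝ) (h0 : 0 < lam0) (lam : ℝ)
    (hl : lam ∈ Metric.ball lam0 (lam0 / 2)) (s : Fin n → ℝ) (g : Fin n × Fin n → ℝ)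
    (x : Fin n → ℝ) :
    -(bI n lam0 s g * (x ⬝ᵥ x)) - lam0 / (2 * n) * (x ⬝ᵥ x) ^ 2 ≤ Hs n s lam g x ∧
    Hs n s lam g x ≤ bI n lam0 s g * (x ⬝ᵥ x) - lam0 / (8 * n) * (x ⬝ᵥ x) ^ 2 := by
  have hn' : (0:ℝ) < n := by exact_mod_cast hn
  rw [Metric.mem_ball, Real.dist_eq, abs_lt] at hl
  have hl1 : lam0 / 2 ≤ lam := by linarith
  have hl2 : lam ≤ 2 * lam0 := by linarith
  have hl0 : 0 < lam := by linarith
  have hG : 0 ≤ ∑ p, |g p| := Finset.sum_nonneg fun i _ => abs_nonneg _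
  have hu := dot_self_nonneg x
  have hs := dot_self_nonneg s
  have h1 := abs_sum_qf_le (Real.sqrt (lam / n)) (Real.sqrt_nonneg _) g x
  have h2 : Real.sqrt (lam / n) * (∑ p, |g p|) * (x ⬝ᵥ x)
      ≤ Real.sqrt (2 * lam0 / n) * (∑ p, |g p|) * (x ⬝ᵥ x) := by gcongr
  have h3 := dot_sq_le s x
  have h4 : lam / (2 * n) * (s ⬝ᵥ x) ^ 2 ≤ lam0 / n * (s ⬝ᵥ s) * (x ⬝ᵥ x) := by
    calc lam / (2 * n) * (s ⬝ᵥ x) ^ 2 ≤ (2 * lam0) / (2 * n) * ((s ⬝ᵥ s) * (x ⬝ᵥ x)) := by gcongr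
      _ = _ := by field_simp
  have h5 : 0 ≤ lam / (2 * n) * (s ⬝ᵥ x) ^ 2 := by positivity
  have h5' : 0 ≤ lam0 / n * (s ⬝ᵥ s) * (x ⬝ᵥ x) := by positivity
  have h6 : lam / (4 * n) * (x ⬝ᵥ x) ^ 2 ≤ lam0 / (2 * n) * (x ⬝ᵥ x) ^ 2 := by
    calc _ ≤ (2 * lam0) / (4 * n) * (x ⬝ᵥ x) ^ 2 := by gcongr
      _ = _ := by field_simp; ring
  have h7 : lam0 / (8 * n) * (x ⬝ᵥ x) ^ 2 ≤ lam / (4 * n) * (x ⬝ᵥ x) ^ 2 := by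
    calc _ = (lam0 / 2) / (4 * n) * (x ⬝ᵥ x) ^ 2 := by field_simp; ring
      _ ≤ _ := by gcongr
  have h8 := abs_le.1 h1
  unfold Hs bI
  constructor <;> nlinarith

/-- moment control constant -/
def gamI (n : ℕ) (v lam0 : ℝ) (s : Fin n → ℝ) (g : Fin n × Fin n → ℝ) : ℝ :=
  (2 / (lam0 / (8 * n))) * (bI n lam0 s g ^ 2 / (2 * (lam0 / (8 * n))) +
      (bI n lam0 s g * (∫ x, x ⬝ᵥ x ∂gaussPrior n v) +
        lam0 / (2 * n) * ∫ x, (x ⬝ᵥ x) ^ 2 ∂gaussPrior n v))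

lemma measurable_Hs (n : ℕ) (lam : ℝ) :
    Measurable (fun p : ((Fin n → ℝ) × (Fin n × Fin n → ℝ)) × (Fin n → ℝ) =>
      Hs n p.1.1 lam p.1.2 p.2) := by
  unfold Hs
  have := @measurable_qf n
  fun_prop

lemma measurable_Hsx (n : ℕ) (lam : ℝ) (s : Fin n → ℝ) (g : Fin n × Fin n → ℝ) :
    Measurable (Hs n s lam g) :=
  (measurable_Hs n lam).comp (f := fun x => ((s, g), x)) (by fun_prop)

lemma Hs_moments (n : ℕ) (hn : 1 ≤ n) (v lam0 : ℝ) (h0 : 0 < lam0) (lam : ℝ)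
    (hl : lam ∈ Metric.ball lam0 (lam0 / 2)) (s : Fin n → ℝ) (g : Fin n × Fin n → ℝ) :
    |Real.log (∫ x, Real.exp (Hs n s lam g x) ∂gaussPrior n v)| ≤ bI n lam0 s g ^ 2 /
      (4 * (lam0 / (8 * n))) + (bI n lam0 s g * (∫ x, x ⬝ᵥ x ∂gaussPrior n v) +
        lam0 / (2 * n) * ∫ x, (x ⬝ᵥ x) ^ 2 ∂gaussPrior n v) ∧
    ∫ x, (x ⬝ᵥ x) ^ 2 * Real.exp (Hs n s lam g x) ∂gaussPrior n v
      ≤ gamI n v lam0 s g * ∫ x, Real.exp (Hs n s lam g x) ∂gaussPrior n v := by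
  have hn' : (0:ℝ) < n := by exact_mod_cast hn
  obtain ⟨h1, h2, h3⟩ := moment_bound (gaussPrior n v) (fun x => x ⬝ᵥ x) (Hs n s lam g)
    (by fun_prop) (measurable_Hsx n lam s g) dot_self_nonneg (int_dot n v) (int_dot_pow n v 2)
    (bI n lam0 s g) (lam0 / (8 * n)) (lam0 / (2 * n)) (bI_nonneg n lam0 h0 s g) (by positivity)
    (by positivity) (fun x => (Hs_bounds n hn lam0 h0 lam hl s g x).1)
    (fun x => (Hs_bounds n hn lam0 h0 lam hl s g x).2)
  refine ⟨?_, h3⟩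
  have hb := bI_nonneg n lam0 h0 s g
  have i1 : 0 ≤ ∫ x, x ⬝ᵥ x ∂gaussPrior n v := integral_nonneg fun x => dot_self_nonneg x
  have i2 : 0 ≤ ∫ x, (x ⬝ᵥ x) ^ 2 ∂gaussPrior n v := integral_nonneg fun x => sq_nonneg _
  have a1 : 0 ≤ bI n lam0 s g * (∫ x, x ⬝ᵥ x ∂gaussPrior n v) +
        lam0 / (2 * n) * ∫ x, (x ⬝ᵥ x) ^ 2 ∂gaussPrior n v := by positivity
  have a2 : 0 ≤ bI n lam0 s g ^ 2 / (4 * (lam0 / (8 * n))) := by positivity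
  rw [abs_le]
  constructor <;> linarith

lemma gamI_nonneg (n : ℕ) (v lam0 : ℝ) (h0 : 0 < lam0) (s : Fin n → ℝ)
    (g : Fin n × Fin n → ℝ) : 0 ≤ gamI n v lam0 s g := by
  unfold gamI
  have hb := bI_nonneg n lam0 h0 s g
  have i1 : 0 ≤ ∫ x, x ⬝ᵥ x ∂gaussPrior n v := integral_nonneg fun x => dot_self_nonneg x
  have i2 : 0 ≤ ∫ x, (x ⬝ᵥ x) ^ 2 ∂gaussPrior n v := integral_nonneg fun x => sq_nonneg _
  positivity

lemma expGr_bI (n : ℕ) (lam0 : ℝ) (s : Fin n → ℝ) : ExpGr (bI n lam0 s) :=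
  ((ExpGr.sum Finset.univ fun k _ => (ExpGr.coord k).abs).const_mul _).add (ExpGr.const _)

lemma intUI (n : ℕ) (hn : 1 ≤ n) (v lam0 : ℝ) (h0 : 0 < lam0) (lam : ℝ)
    (hl : lam ∈ Metric.ball lam0 (lam0 / 2)) (s : Fin n → ℝ) (g : Fin n × Fin n → ℝ)
    (f : (Fin n → ℝ) → ℝ) (mf : Measurable f) (hf : Integrable f (gaussPrior n v)) :
    Integrable (fun x => f x * Real.exp (Hs n s lam g x)) (gaussPrior n v) := by
  have hn' : (0:ℝ) < n := by exact_mod_cast hn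
  refine hf.mul_bdd (c := Real.exp (bI n lam0 s g ^ 2 / (4 * (lam0 / (8 * n)))))
    (measurable_Hsx n lam s g).exp.aestronglyMeasurable (Eventually.of_forall fun x => ?_)
  rw [Real.norm_eq_abs, Real.abs_exp, Real.exp_le_exp]
  refine (Hs_bounds n hn lam0 h0 lam hl s g x).2.trans ?_
  have : 0 < lam0 / (8 * n) := by positivity
  rw [le_div_iff₀ (by positivity)]
  nlinarith [sq_nonneg (bI n lam0 s g - 2 * (lam0 / (8 * n)) * (x ⬝ᵥ x))]

lemma dI_good (n : ℕ) (hn : 1 ≤ n) (v : ℝ) (s : Fin n → ℝ) (lam0 : ℝ) (h0 : 0 < lam0) :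
    ∃ C, (dI n v s).Good lam0 (lam0 / 2) C := by
  have hn' : (0:ℝ) < n := by exact_mod_cast hn
  have hs := dot_self_nonneg s
  set C1 := Real.sqrt (2 * lam0 / n) with hC1
  set C2 := (1 / (n:ℝ)) / (2 * Real.sqrt (lam0 / 2 / n)) with hC2
  set C3 := s ⬝ᵥ s + 1 with hC3
  have hC10 : 0 ≤ C1 := Real.sqrt_nonneg _
  have hC20 : 0 ≤ C2 := by positivity
  refine ⟨C1 + C2 + C3, by linarith, by unfold dI; infer_instance, ?_, measurable_qf, ?_, ?_, ?_, ?_, ?_, ?_, ?_, ?_⟩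
  · exact IsProbabilityMeasure.ne_zero (gaussPrior n v)
  · intro t; simp only [dI]; fun_prop
  · intro t; simp only [dI]; fun_prop
  · simp only [dI]; fun_prop
  · refine Eventually.of_forall fun x => ?_
    have hu := dot_self_nonneg x
    refine ⟨by simp only [dI]; linarith, fun k => (abs_qf_le k x).trans (by simp only [dI]; linarith), fun t ht => ⟨?_, ?_⟩⟩
    · simp only [dI]
      have h1 := ((hasDerivAt_id' t).div_const (2 * (n:ℝ))).mul_const ((s ⬝ᵥ x) ^ 2)
      have h2 := ((hasDerivAt_id' t).div_const (4 * (n:ℝ))).mul_const ((x ⬝ᵥ x) ^ 2)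
      exact h1.sub h2
    · simp only [dI]
      have h3 := dot_sq_le s x
      have hn1 : (1:ℝ) ≤ n := by exact_mod_cast hn
      have e1 : 1 / (2 * (n:ℝ)) ≤ 1 := by rw [div_le_one (by positivity)]; linarith
      have e2 : 1 / (4 * (n:ℝ)) ≤ 1 := by rw [div_le_one (by positivity)]; linarith
      have a1 : 0 ≤ 1 / (2 * (n:ℝ)) * (s ⬝ᵥ x) ^ 2 := by positivity
      have a2 : 0 ≤ 1 / (4 * (n:ℝ)) * (x ⬝ᵥ x) ^ 2 := by positivity
      have b1 : 1 / (2 * (n:ℝ)) * (s ⬝ᵥ x) ^ 2 ≤ (s ⬝ᵥ s) * (x ⬝ᵥ x) := by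
        calc _ ≤ 1 * ((s ⬝ᵥ s) * (x ⬝ᵥ x)) := by gcongr
          _ = _ := one_mul _
      have b2 : 1 / (4 * (n:ℝ)) * (x ⬝ᵥ x) ^ 2 ≤ (x ⬝ᵥ x) ^ 2 := by
        calc _ ≤ 1 * (x ⬝ᵥ x) ^ 2 := by gcongr
          _ = _ := one_mul _
      have hU : (s ⬝ᵥ s) * (x ⬝ᵥ x) + (x ⬝ᵥ x) ^ 2 ≤ C3 * (1 + x ⬝ᵥ x) ^ 2 := by
        rw [hC3]; nlinarith [mul_nonneg hs hu, mul_nonneg hs (sq_nonneg (x ⬝ᵥ x))]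
      have hU2 : C3 * (1 + x ⬝ᵥ x) ^ 2 ≤ (C1 + C2 + C3) * (1 + x ⬝ᵥ x) ^ 2 := by
        gcongr; linarith
      rw [abs_le]; constructor <;> linarith
  · intro k t ht
    rw [Metric.mem_ball, Real.dist_eq, abs_lt] at ht
    have ht1 : lam0 / 2 ≤ t := by linarith
    have ht2 : t ≤ 2 * lam0 := by linarith
    have ht0 : 0 < t := by linarith
    have hC30 : 0 ≤ C3 := by linarith
    simp only [dI]
    refine ⟨?_, ?_, ?_⟩
    · exact ((hasDerivAt_id' t).div_const (n:ℝ)).sqrt (by positivity)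
    · rw [abs_of_nonneg (Real.sqrt_nonneg _)]
      have : Real.sqrt (t / n) ≤ C1 := by rw [hC1]; gcongr
      linarith
    · rw [abs_of_nonneg (by positivity)]
      have : (1 / (n:ℝ)) / (2 * Real.sqrt (t / n)) ≤ C2 := by rw [hC2]; gcongr
      linarith
  · intro M
    set bM := Real.sqrt (2 * lam0 / n) * ∑ p : Fin n × Fin n, M + lam0 / n * (s ⬝ᵥ s)
    refine ⟨Real.exp ((bM + 2) ^ 2 / (4 * (lam0 / (8 * n)))), ?_⟩
    refine Eventually.of_forall fun x t ht g hg => ?_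
    have hu := dot_self_nonneg x
    rw [dI_H]
    simp only [dI]
    have h1 := (Hs_bounds n hn lam0 h0 t ht s g x).2
    have h2 : bI n lam0 s g ≤ bM := by
      unfold bI
      simp only [bM]
      gcongr with p
      exact hg p
    have h3 : 1 + x ⬝ᵥ x ≤ Real.exp (x ⬝ᵥ x) := by
      have := Real.add_one_le_exp (x ⬝ᵥ x); linarith
    calc (1 + x ⬝ᵥ x) ^ 2 * Real.exp (Hs n s t g x)
        ≤ Real.exp (x ⬝ᵥ x) ^ 2 * Real.exp (bM * (x ⬝ᵥ x) - lam0 / (8 * n) * (x ⬝ᵥ x) ^ 2) := by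
          gcongr
          refine h1.trans ?_
          gcongr
      _ = Real.exp (2 * (x ⬝ᵥ x) + (bM * (x ⬝ᵥ x) - lam0 / (8 * n) * (x ⬝ᵥ x) ^ 2)) := by
          rw [← Real.exp_nat_mul, ← Real.exp_add]; norm_num
      _ ≤ _ := by
          rw [Real.exp_le_exp]
          have : 0 < lam0 / (8 * n) := by positivity
          rw [le_div_iff₀ (by positivity)]
          nlinarith [sq_nonneg (bM + 2 - 2 * (lam0 / (8 * n)) * (x ⬝ᵥ x))]
  · refine ⟨fun g => 2 + 2 * gamI n v lam0 s g, ?_, fun t ht g => ?_⟩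
    · refine (ExpGr.const 2).add (ExpGr.const_mul 2 ?_)
      unfold gamI
      simp only [div_eq_mul_inv]
      exact ((((expGr_bI n lam0 s).pow 2).mul (ExpGr.const _)).add
        (((expGr_bI n lam0 s).mul (ExpGr.const _)).add (ExpGr.const _))).const_mul _
    · rw [dI_H]
      simp only [dI]
      have hg := gamI_nonneg n v lam0 h0 s g
      rw [abs_of_nonneg (by positivity)]
      have h2 := (Hs_moments n hn v lam0 h0 t ht s g).2
      have i1 := intUI n hn v lam0 h0 t ht s g (fun x => (x ⬝ᵥ x) ^ 2) (by fun_prop) (int_dot_pow n v 2)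
      have i0 := intUI n hn v lam0 h0 t ht s g (fun x => 1) (by fun_prop) (integrable_const _)
      have i2 := intUI n hn v lam0 h0 t ht s g (fun x => (1 + x ⬝ᵥ x) ^ 2) (by fun_prop) (by
        have : (fun x : Fin n → ℝ => (1 + x ⬝ᵥ x) ^ 2)
          = fun x => 1 + (2 * (x ⬝ᵥ x) + (x ⬝ᵥ x) ^ 2) := by funext x; ring
        rw [this]
        exact (integrable_const _).add (((int_dot n v).const_mul _).add (int_dot_pow n v 2)))
      simp only [one_mul] at i0
      calc ∫ x, (1 + x ⬝ᵥ x) ^ 2 * Real.exp (Hs n s t g x) ∂gaussPrior n v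
          ≤ ∫ x, (2 * Real.exp (Hs n s t g x) + 2 * ((x ⬝ᵥ x) ^ 2 * Real.exp (Hs n s t g x)))
            ∂gaussPrior n v := by
            refine integral_mono i2 ((i0.const_mul _).add (i1.const_mul _)) fun x => ?_
            have := Real.exp_pos (Hs n s t g x)
            have h3 : (1 + x ⬝ᵥ x) ^ 2 ≤ 2 + 2 * (x ⬝ᵥ x) ^ 2 := by
              nlinarith [sq_nonneg (1 - x ⬝ᵥ x)]
            have := mul_le_mul_of_nonneg_right h3 this.le
            simp only
            linarith
        _ = 2 * (∫ x, Real.exp (Hs n s t g x) ∂gaussPrior n v)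
            + 2 * ∫ x, (x ⬝ᵥ x) ^ 2 * Real.exp (Hs n s t g x) ∂gaussPrior n v := by
            rw [integral_add (i0.const_mul _) (i1.const_mul _), integral_const_mul,
              integral_const_mul]
        _ ≤ _ := by linarith
  · rw [dI_H]
    refine ExpGr.of_le (h := fun g => bI n lam0 s g ^ 2 /
      (4 * (lam0 / (8 * n))) + (bI n lam0 s g * (∫ x, x ⬝ᵥ x ∂gaussPrior n v) +
        lam0 / (2 * n) * ∫ x, (x ⬝ᵥ x) ^ 2 ∂gaussPrior n v)) ?_ fun g => ?_
    · simp only [div_eq_mul_inv]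
      exact ((((expGr_bI n lam0 s).pow 2).mul (ExpGr.const _)).add
        (((expGr_bI n lam0 s).mul (ExpGr.const _)).add (ExpGr.const _)))
    · exact ((Hs_moments n hn v lam0 h0 lam0 (Metric.mem_ball_self (by linarith)) s g).1).trans
        (le_abs_self _)

/-- Gibbs covariance matrix in Hamiltonian form -/
def Tm (n : ℕ) (v : ℝ) (s : Fin n → ℝ) (lam : ℝ) (g : Fin n × Fin n → ℝ) :
    Matrix (Fin n) (Fin n) ℝ :=
  Matrix.of fun i j => gav (gaussPrior n v) (Hs n s lam g) (fun x => x i * x j)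

/-- log partition function -/
def lZ (n : ℕ) (v : ℝ) (s : Fin n → ℝ) (lam : ℝ) (g : Fin n × Fin n → ℝ) : ℝ :=
  Real.log (∫ x, Real.exp (Hs n s lam g x) ∂gaussPrior n v)

lemma weight_eq (n : ℕ) (lam : ℝ) (hl : 0 < lam) (s : Fin n → ℝ) (g : Fin n × Fin n → ℝ)
    (x : Fin n → ℝ) : weight n lam (obs n lam s (symZ g)) x =
      Real.exp (-(1 / 4) * frobSq (obs n lam s (symZ g))) * Real.exp (Hs n s lam g x) := by
  unfold weight
  rw [← Real.exp_add]
  congr 1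
  set r := Real.sqrt (lam / n) with hr
  have hr2 : r ^ 2 = lam / n := Real.sq_sqrt (by positivity)
  have e1 : Hs n s lam g x = r * (1 / 2 * ∑ i, ∑ j, symZ g i j * (x i * x j)) +
      (r ^ 2 / 2 * ∑ i, ∑ j, (s i * s j) * (x i * x j)
        - r ^ 2 / 4 * ∑ i, ∑ j, (x i * x j) * (x i * x j)) := by
    unfold Hs
    rw [← ft_noise g _ (fun i j => mul_comm _ _), sum_mul_dot, sum_mul_dot, Finset.mul_sum, hr2]
    congr 1
    · apply Finset.sum_congr rfl; intro p _; unfold qf; ring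
    · ring
  rw [e1]
  unfold frobSq
  simp only [Finset.mul_sum, ← Finset.sum_add_distrib, ← Finset.sum_sub_distrib]
  apply Finset.sum_congr rfl; intro i _
  apply Finset.sum_congr rfl; intro j _
  simp only [obs, Matrix.sub_apply, Matrix.add_apply, Matrix.smul_apply, Matrix.vecMulVec_apply,
    smul_eq_mul, ← hr]
  ring

lemma gibbsMatrix_eq (n : ℕ) (sig' lam : ℝ) (hl : 0 < lam) (s : Fin n → ℝ)
    (g : Fin n × Fin n → ℝ) :
    gibbsMatrix n sig' lam (obs n lam s (symZ g)) = Tm n (sig' ^ 2) s lam g := by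
  ext i j
  simp only [gibbsMatrix, Tm, Matrix.of_apply, gibbs, gav, weight_eq n lam hl]
  simp only [mul_left_comm _ (Real.exp (-(1 / 4) * frobSq (obs n lam s (symZ g))))]
  rw [integral_const_mul, integral_const_mul, mul_div_mul_left _ _ (Real.exp_ne_zero _)]

/-- derivative integrand -/
def eI (n : ℕ) (v : ℝ) (s : Fin n → ℝ) (lam : ℝ) (g : Fin n × Fin n → ℝ) : ℝ :=
  ((s ⬝ᵥ s) ^ 2 - frobSq (Matrix.vecMulVec s s - Tm n v s lam g)) / (4 * n)

section
variable {n : ℕ} (hn : 1 ≤ n) (v : ℝ) (s : Fin n → ℝ) {lam : ℝ} (hl : 0 < lam)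
  (g : Fin n × Fin n → ℝ)
include hn hl

lemma int_le (f : (Fin n → ℝ) → ℝ) (mf : Measurable f) (K : ℝ)
    (hf : ∀ x, |f x| ≤ K * (1 + x ⬝ᵥ x) ^ 2) :
    Integrable (fun x => f x * Real.exp (Hs n s lam g x)) (gaussPrior n v) := by
  refine intUI n hn v lam hl lam (Metric.mem_ball_self (by linarith)) s g f mf ?_
  refine Integrable.mono' (g := fun x => K * (1 + (2 * (x ⬝ᵥ x) + (x ⬝ᵥ x) ^ 2)))
    (((integrable_const _).add (((int_dot n v).const_mul _).add (int_dot_pow n v 2))).const_mul K)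
    mf.aestronglyMeasurable (Eventually.of_forall fun x => ?_)
  rw [Real.norm_eq_abs]
  refine (hf x).trans (le_of_eq (by ring))

omit hl hn in
lemma coord_mul_le (x : Fin n → ℝ) (i j : Fin n) : |x i * x j| ≤ x ⬝ᵥ x := by
  have hi : ∀ i, x i * x i ≤ x ⬝ᵥ x := fun i =>
    Finset.single_le_sum (f := fun i => x i * x i) (fun i _ => mul_self_nonneg _)
      (Finset.mem_univ i)
  have := hi i
  have := hi j
  rw [abs_le]
  constructor <;> nlinarith [sq_nonneg (x i + x j), sq_nonneg (x i - x j)]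

lemma int_xx (i j : Fin n) :
    Integrable (fun x => (x i * x j) * Real.exp (Hs n s lam g x)) (gaussPrior n v) := by
  refine int_le hn v s hl g _ (by fun_prop) 1 fun x => ?_
  have := coord_mul_le x i j
  have := dot_self_nonneg x
  nlinarith

lemma int_xx2 (i j : Fin n) :
    Integrable (fun x => (x i * x j) ^ 2 * Real.exp (Hs n s lam g x)) (gaussPrior n v) := by
  refine int_le hn v s hl g _ (by fun_prop) 1 fun x => ?_
  have h1 := coord_mul_le x i j
  have := dot_self_nonneg x
  rw [abs_pow]
  have : |x i * x j| ^ 2 ≤ (x ⬝ᵥ x) ^ 2 := by gcongr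
  nlinarith

lemma int_e : Integrable (fun x => Real.exp (Hs n s lam g x)) (gaussPrior n v) := by
  have := int_le hn v s hl g (fun _ => 1) (by fun_prop) 1 fun x => by
    have := dot_self_nonneg x
    simp only [abs_one]
    nlinarith
  simpa using this

lemma int_u2 : Integrable (fun x => (x ⬝ᵥ x) ^ 2 * Real.exp (Hs n s lam g x)) (gaussPrior n v) := by
  refine int_le hn v s hl g _ (by fun_prop) 1 fun x => ?_
  have := dot_self_nonneg x
  rw [abs_of_nonneg (by positivity)]
  nlinarith

lemma Z_pos : 0 < ∫ x, Real.exp (Hs n s lam g x) ∂(gaussPrior n v) :=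
  integral_exp_pos (int_e hn v s hl g)

lemma gav_sx (y : Fin n → ℝ) : gav (gaussPrior n v) (Hs n s lam g) (fun x => (y ⬝ᵥ x) ^ 2)
    = ∑ i, ∑ j, (y i * y j) * Tm n v s lam g i j := by
  have : (fun x : Fin n → ℝ => (y ⬝ᵥ x) ^ 2) = fun x => ∑ i, ∑ j, (y i * y j) * (x i * x j) := by
    funext x; rw [sum_mul_dot]
  rw [this, gav_finset_sum]
  · apply Finset.sum_congr rfl; intro i _
    rw [gav_finset_sum]
    · apply Finset.sum_congr rfl; intro j _
      rw [gav_const_mul]; rfl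
    · intro j _
      simp only [mul_assoc (y i * y j)]
      exact (int_xx hn v s hl g i j).const_mul _
  · intro i _
    simp only [Finset.sum_mul]
    refine integrable_finsetSum _ fun j _ => ?_
    simp only [mul_assoc (y i * y j)]
    exact (int_xx hn v s hl g i j).const_mul _

lemma frob_T_le : frobSq (Tm n v s lam g) ≤
    gav (gaussPrior n v) (Hs n s lam g) (fun x => (x ⬝ᵥ x) ^ 2) := by
  have : (fun x : Fin n → ℝ => (x ⬝ᵥ x) ^ 2) = fun x => ∑ i, ∑ j, (x i * x j) ^ 2 := by
    funext x; rw [← sum_mul_dot]; simp only [sq]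
  rw [this, gav_finset_sum]
  · unfold frobSq
    refine Finset.sum_le_sum fun i _ => ?_
    rw [gav_finset_sum]
    · refine Finset.sum_le_sum fun j _ => ?_
      exact gav_sq_le _ _ _ (int_e hn v s hl g) (int_xx hn v s hl g i j) (int_xx2 hn v s hl g i j)
        (Z_pos hn v s hl g)
    · intro j _; exact int_xx2 hn v s hl g i j
  · intro i _
    simp only [Finset.sum_mul]
    exact integrable_finsetSum _ fun j _ => int_xx2 hn v s hl g i j

omit hn hl in
lemma eI_eq : eI n v s lam g = (2 * (∑ i, ∑ j, (s i * s j) * Tm n v s lam g i j)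
    - frobSq (Tm n v s lam g)) / (4 * n) := by
  unfold eI frobSq
  congr 1
  rw [← sum_mul_dot]
  simp only [Finset.mul_sum, ← Finset.sum_sub_distrib]
  apply Finset.sum_congr rfl; intro i _
  apply Finset.sum_congr rfl; intro j _
  simp only [Matrix.sub_apply, Matrix.vecMulVec_apply]
  ring

lemma eI_le : |eI n v s lam g| ≤ (s ⬝ᵥ s) ^ 2 +
    gav (gaussPrior n v) (Hs n s lam g) (fun x => (x ⬝ᵥ x) ^ 2) := by
  have hn' : (0:ℝ) < n := by exact_mod_cast hn
  have hn1 : (1:ℝ) ≤ n := by exact_mod_cast hn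
  rw [eI_eq, ← gav_sx hn v s hl g s]
  have h1 := frob_T_le hn v s hl g
  set G := gav (gaussPrior n v) (Hs n s lam g) (fun x => (x ⬝ᵥ x) ^ 2) with hG
  have hZ := Z_pos hn v s hl g
  have i1 : Integrable (fun x => (s ⬝ᵥ x) ^ 2 * Real.exp (Hs n s lam g x)) (gaussPrior n v) := by
    refine int_le hn v s hl g _ (by fun_prop) (s ⬝ᵥ s) fun x => ?_
    have := dot_self_nonneg x
    have := dot_self_nonneg s
    rw [abs_of_nonneg (by positivity)]
    refine (dot_sq_le s x).trans ?_
    gcongr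
    nlinarith
  have h2 : gav (gaussPrior n v) (Hs n s lam g) (fun x => (s ⬝ᵥ x) ^ 2) ≤ (s ⬝ᵥ s) ^ 2 + G := by
    have hc : gav (gaussPrior n v) (Hs n s lam g) (fun _ => (s ⬝ᵥ s) ^ 2) = (s ⬝ᵥ s) ^ 2 := by
      unfold gav
      rw [integral_const_mul, mul_div_assoc, div_self hZ.ne', mul_one]
    rw [hG]
    nth_rw 1 [← hc]
    rw [← gav_add _ _ _ _ ((int_e hn v s hl g).const_mul _) (int_u2 hn v s hl g)]
    refine gav_mono _ _ _ _ i1 ?_ (Eventually.of_forall fun x => ?_)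
    · simp only [add_mul]
      exact ((int_e hn v s hl g).const_mul _).add (int_u2 hn v s hl g)
    · refine (dot_sq_le s x).trans ?_
      nlinarith [sq_nonneg (s ⬝ᵥ s - x ⬝ᵥ x), sq_nonneg (s ⬝ᵥ s), sq_nonneg (x ⬝ᵥ x)]
  have h3 : 0 ≤ gav (gaussPrior n v) (Hs n s lam g) (fun x => (s ⬝ᵥ x) ^ 2) :=
    div_nonneg (integral_nonneg fun x => by positivity) hZ.le
  have h4 : 0 ≤ frobSq (Tm n v s lam g) := by unfold frobSq; positivity
  rw [abs_div, abs_of_pos (by positivity : (0:ℝ) < 4 * n), div_le_iff₀ (by positivity), abs_le]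
  have h5 := sq_nonneg (s ⬝ᵥ s)
  have : ((s ⬝ᵥ s) ^ 2 + G) * 4 ≤ ((s ⬝ᵥ s) ^ 2 + G) * (4 * n) := by
    refine mul_le_mul_of_nonneg_left ?_ ?_ <;> linarith
  constructor <;> nlinarith

/-- I-MMSE for fixed s. -/
lemma deriv_fixed : HasDerivAt (fun t => ∫ g, lZ n v s t g ∂gpi n)
    (∫ g, eI n v s lam g ∂gpi n) lam := by
  have hn' : (0:ℝ) < n := by exact_mod_cast hn
  obtain ⟨C, hC⟩ := dI_good n hn v s lam hl
  have h := hC.main (fun p => nv p) (fun p => nv_ne p)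
  refine h.congr_deriv ?_
  change ∫ g, _ ∂gpi n = _
  refine integral_congr_ae (Eventually.of_forall fun g => ?_)
  simp only [dI_H]
  simp only [dI]
  have hr : Real.sqrt (lam / n) ≠ 0 := by positivity
  have e0 : ∀ p : Fin n × Fin n, (nv p : ℝ) * Real.sqrt (lam / n) *
      (1 / n / (2 * Real.sqrt (lam / n))) *
      (gav (gaussPrior n v) (Hs n s lam g) (fun x => qf p x ^ 2) -
        gav (gaussPrior n v) (Hs n s lam g) (qf p) ^ 2) =
      1 / (2 * n) * (nv p * gav (gaussPrior n v) (Hs n s lam g) (fun x => qf p x ^ 2))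
        - 1 / (2 * n) * (nv p * (ft (fun i j => Tm n v s lam g i j) p * ft (fun i j => Tm n v s lam g i j) p)) := by
    intro p
    have : gav (gaussPrior n v) (Hs n s lam g) (qf p) = ft (fun i j => Tm n v s lam g i j) p :=
      gav_ft _ _ (fun (x : Fin n → ℝ) i j => x i * x j) p
    rw [this]
    field_simp
  rw [Finset.sum_congr rfl fun p _ => e0 p, Finset.sum_sub_distrib, ← Finset.mul_sum,
    ← Finset.mul_sum, ft_inner]
  rotate_left
  · intro i j; simp only [Tm, Matrix.of_apply, mul_comm]
  · intro i j; simp only [Tm, Matrix.of_apply, mul_comm]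
  have iq : ∀ p, Integrable (fun x => qf p x ^ 2 * Real.exp (Hs n s lam g x)) (gaussPrior n v) := by
    intro p
    have := measurable_qf p
    refine int_le hn v s hl g _ (by fun_prop) 1 fun x => ?_
    have h1 := abs_qf_le p x
    have := dot_self_nonneg x
    rw [abs_pow]
    have : |qf p x| ^ 2 ≤ (x ⬝ᵥ x) ^ 2 := by gcongr
    nlinarith
  have e1 : ∑ p, (nv p : ℝ) * gav (gaussPrior n v) (Hs n s lam g) (fun x => qf p x ^ 2)
      = 1 / 2 * gav (gaussPrior n v) (Hs n s lam g) (fun x => (x ⬝ᵥ x) ^ 2) := by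
    rw [← gav_const_mul]
    have : (fun x : Fin n → ℝ => 1 / 2 * (x ⬝ᵥ x) ^ 2) = fun x => ∑ p, (nv p : ℝ) * qf p x ^ 2 := by
      funext x; rw [← qf_inner]; simp only [sq]
    rw [this, gav_finset_sum]
    · simp only [gav_const_mul]
    · intro p _
      simp only [mul_assoc]
      exact (iq p).const_mul _
  have e2 : gav (gaussPrior n v) (Hs n s lam g)
      (fun x => 1 / (2 * n) * (s ⬝ᵥ x) ^ 2 - 1 / (4 * n) * (x ⬝ᵥ x) ^ 2) =
      1 / (2 * n) * (∑ i, ∑ j, (s i * s j) * Tm n v s lam g i j) -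
      1 / (4 * n) * gav (gaussPrior n v) (Hs n s lam g) (fun x => (x ⬝ᵥ x) ^ 2) := by
    rw [← gav_sx hn v s hl g s, sub_eq_add_neg, ← neg_mul, ← gav_const_mul, ← gav_const_mul,
      ← gav_add]
    · congr 1; funext x; ring
    · simp only [mul_assoc]
      refine Integrable.const_mul ?_ _
      refine int_le hn v s hl g _ (by fun_prop) (s ⬝ᵥ s) fun x => ?_
      have := dot_self_nonneg x
      have := dot_self_nonneg s
      rw [abs_of_nonneg (by positivity)]
      refine (dot_sq_le s x).trans ?_
      gcongr
      nlinarith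
    · simp only [mul_assoc]
      exact (int_u2 hn v s hl g).const_mul _
  rw [e1, e2, eI_eq]
  unfold frobSq
  simp only [← sq]
  field_simp
  ring

end

lemma mInt_joint (n : ℕ) (v lam : ℝ) (f : (Fin n → ℝ) → ℝ) (mf : Measurable f) :
    Measurable (fun p : (Fin n → ℝ) × (Fin n × Fin n → ℝ) =>
      ∫ x, f x * Real.exp (Hs n p.1 lam p.2 x) ∂gaussPrior n v) := by
  have : StronglyMeasurable (fun p : ((Fin n → ℝ) × (Fin n × Fin n → ℝ)) × (Fin n → ℝ) =>
      f p.2 * Real.exp (Hs n p.1.1 lam p.1.2 p.2)) :=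
    ((mf.comp measurable_snd).mul (measurable_Hs n lam).exp).stronglyMeasurable
  exact (this.integral_prod_right' (ν := gaussPrior n v)).measurable

lemma mZ_joint (n : ℕ) (v lam : ℝ) :
    Measurable (fun p : (Fin n → ℝ) × (Fin n × Fin n → ℝ) =>
      ∫ x, Real.exp (Hs n p.1 lam p.2 x) ∂gaussPrior n v) := by
  simpa using mInt_joint n v lam (fun _ => 1) measurable_const

lemma mlZ_joint (n : ℕ) (v lam : ℝ) :
    Measurable (fun p : (Fin n → ℝ) × (Fin n × Fin n → ℝ) => lZ n v p.1 lam p.2) :=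
  (mZ_joint n v lam).log

lemma mTm_joint (n : ℕ) (v lam : ℝ) (i j : Fin n) :
    Measurable (fun p : (Fin n → ℝ) × (Fin n × Fin n → ℝ) => Tm n v p.1 lam p.2 i j) :=
  (mInt_joint n v lam (fun x => x i * x j) (by fun_prop)).div (mZ_joint n v lam)

lemma meI_joint (n : ℕ) (v lam : ℝ) :
    Measurable (fun p : (Fin n → ℝ) × (Fin n × Fin n → ℝ) => eI n v p.1 lam p.2) := by
  have := mTm_joint n v lam
  unfold eI frobSq
  simp only [Matrix.sub_apply, Matrix.vecMulVec_apply]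
  fun_prop

lemma int_absg_pow (n m : ℕ) :
    Integrable (fun g : Fin n × Fin n → ℝ => (∑ p, |g p|) ^ m) (gpi n) :=
  (((ExpGr.sum Finset.univ fun k _ => (ExpGr.coord k).abs)).pow m).integrable _ (by
    have : Measurable (fun g : Fin n × Fin n → ℝ => (∑ p, |g p|) ^ m) := by fun_prop
    exact this.aestronglyMeasurable)

lemma int_bI2 (n : ℕ) (v0 lam0 : ℝ) :
    Integrable (fun p : (Fin n → ℝ) × (Fin n × Fin n → ℝ) => bI n lam0 p.1 p.2 ^ 2)
      ((gaussPrior n v0).prod (gpi n)) := by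
  have h1 := (int_dot_pow n v0 0).mul_prod (int_absg_pow n 2)
  have h2 := (int_dot_pow n v0 1).mul_prod (int_absg_pow n 1)
  have h3 := (int_dot_pow n v0 2).mul_prod (int_absg_pow n 0)
  refine (((h1.const_mul (Real.sqrt (2 * lam0 / n) ^ 2)).add
    (h2.const_mul (2 * Real.sqrt (2 * lam0 / n) * (lam0 / n)))).add
      (h3.const_mul ((lam0 / n) ^ 2))).congr (Eventually.of_forall fun p => ?_)
  simp only [Pi.add_apply, bI]
  ring

lemma int_bI (n : ℕ) (v0 lam0 : ℝ) :
    Integrable (fun p : (Fin n → ℝ) × (Fin n × Fin n → ℝ) => bI n lam0 p.1 p.2)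
      ((gaussPrior n v0).prod (gpi n)) := by
  have h2 := (int_dot_pow n v0 0).mul_prod (int_absg_pow n 1)
  have h3 := (int_dot_pow n v0 1).mul_prod (int_absg_pow n 0)
  refine ((h2.const_mul (Real.sqrt (2 * lam0 / n))).add (h3.const_mul (lam0 / n))).congr
    (Eventually.of_forall fun p => ?_)
  simp only [Pi.add_apply, bI]
  ring

lemma int_gamI (n : ℕ) (v0 v lam0 : ℝ) :
    Integrable (fun p : (Fin n → ℝ) × (Fin n × Fin n → ℝ) => gamI n v lam0 p.1 p.2)
      ((gaussPrior n v0).prod (gpi n)) := by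
  unfold gamI
  exact (((int_bI2 n v0 lam0).div_const _).add (((int_bI n v0 lam0).mul_const _).add
    (integrable_const _))).const_mul _

lemma int_lZ (n : ℕ) (hn : 1 ≤ n) (v0 v lam : ℝ) (hl : 0 < lam) :
    Integrable (fun p : (Fin n → ℝ) × (Fin n × Fin n → ℝ) => lZ n v p.1 lam p.2)
      ((gaussPrior n v0).prod (gpi n)) := by
  refine Integrable.mono' (((int_bI2 n v0 lam).div_const (4 * (lam / (8 * n)))).add
    (((int_bI n v0 lam).mul_const (∫ x, x ⬝ᵥ x ∂gaussPrior n v)).add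
    (integrable_const (lam / (2 * n) * ∫ x, (x ⬝ᵥ x) ^ 2 ∂gaussPrior n v))))
    (mlZ_joint n v lam).aestronglyMeasurable (Eventually.of_forall fun p => ?_)
  exact (Hs_moments n hn v lam hl lam (Metric.mem_ball_self (by linarith)) p.1 p.2).1

lemma int_dot2_fst (n : ℕ) (v0 : ℝ) :
    Integrable (fun p : (Fin n → ℝ) × (Fin n × Fin n → ℝ) => (p.1 ⬝ᵥ p.1) ^ 2)
      ((gaussPrior n v0).prod (gpi n)) :=
  (int_dot_pow n v0 2).comp_fst _

lemma eI_le_ball (n : ℕ) (hn : 1 ≤ n) (v lam0 : ℝ) (h0 : 0 < lam0) (lam : ℝ)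
    (hl : lam ∈ Metric.ball lam0 (lam0 / 2)) (s : Fin n → ℝ) (g : Fin n × Fin n → ℝ) :
    |eI n v s lam g| ≤ (s ⬝ᵥ s) ^ 2 + gamI n v lam0 s g := by
  have hlp : 0 < lam := by
    rw [Metric.mem_ball, Real.dist_eq, abs_lt] at hl; linarith
  refine (eI_le hn v s hlp g).trans ?_
  gcongr
  unfold gav
  rw [div_le_iff₀ (Z_pos hn v s hlp g)]
  exact (Hs_moments n hn v lam0 h0 lam hl s g).2

lemma int_eI (n : ℕ) (hn : 1 ≤ n) (v0 v lam : ℝ) (hl : 0 < lam) :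
    Integrable (fun p : (Fin n → ℝ) × (Fin n × Fin n → ℝ) => eI n v p.1 lam p.2)
      ((gaussPrior n v0).prod (gpi n)) := by
  refine Integrable.mono' ((int_dot2_fst n v0).add (int_gamI n v0 v lam))
    (meI_joint n v lam).aestronglyMeasurable (Eventually.of_forall fun p => ?_)
  exact eI_le_ball n hn v lam hl lam (Metric.mem_ball_self (by linarith)) p.1 p.2

/-- free energy -/
def Fn (n : ℕ) (v0 v lam : ℝ) : ℝ :=
  (1 / n) * ∫ s, ∫ g, lZ n v s lam g ∂gpi n ∂gaussPrior n v0

lemma deriv_Fn_aux (n : ℕ) (hn : 1 ≤ n) (v0 v lam : ℝ) (hl : 0 < lam) :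
    HasDerivAt (fun t => ∫ s, ∫ g, lZ n v s t g ∂gpi n ∂gaussPrior n v0)
      (∫ s, ∫ g, eI n v s lam g ∂gpi n ∂gaussPrior n v0) lam := by
  have hgam := (int_dot2_fst n v0).add (int_gamI n v0 v lam)
  refine (hasDerivAt_integral_of_dominated_loc_of_deriv_le (Metric.ball_mem_nhds lam (half_pos hl))
    (F := fun t s => ∫ g, lZ n v s t g ∂gpi n) (F' := fun t s => ∫ g, eI n v s t g ∂gpi n)
    (bound := fun s => ∫ g, ((s ⬝ᵥ s) ^ 2 + gamI n v lam s g) ∂gpi n) ?_ ?_ ?_ ?_ ?_ ?_).2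
  · refine Eventually.of_forall fun t => ?_
    exact ((mlZ_joint n v t).stronglyMeasurable.integral_prod_right' (ν := gpi n)).aestronglyMeasurable
  · exact (int_lZ n hn v0 v lam hl).integral_prod_left
  · exact ((meI_joint n v lam).stronglyMeasurable.integral_prod_right' (ν := gpi n)).aestronglyMeasurable
  · filter_upwards [hgam.prod_right_ae] with s hs t ht
    have h1 : ∀ g, |eI n v s t g| ≤ (s ⬝ᵥ s) ^ 2 + gamI n v lam s g := fun g =>
      eI_le_ball n hn v lam hl t ht s g
    refine (norm_integral_le_integral_norm _).trans ?_
    refine integral_mono_of_nonneg (Eventually.of_forall fun g => norm_nonneg _) hs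
      (Eventually.of_forall fun g => h1 g)
  · exact hgam.integral_prod_left
  · refine Eventually.of_forall fun s t ht => ?_
    have hlp : 0 < t := by
      rw [Metric.mem_ball, Real.dist_eq, abs_lt] at ht; linarith
    exact deriv_fixed hn v s hlp

lemma frob_eq (n : ℕ) (hn : 1 ≤ n) (v : ℝ) (s : Fin n → ℝ) (lam : ℝ) (g : Fin n × Fin n → ℝ) :
    frobSq (Matrix.vecMulVec s s - Tm n v s lam g) = (s ⬝ᵥ s) ^ 2 - 4 * n * eI n v s lam g := by
  have hn' : (0:ℝ) < n := by exact_mod_cast hn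
  unfold eI
  field_simp
  ring

lemma measurable_entry (n : ℕ) (i j : Fin n) :
    Measurable (fun M : Matrix (Fin n) (Fin n) ℝ => M i j) := by
  change Measurable (fun M : Fin n → Fin n → ℝ => M i j)
  fun_prop

lemma MSE_eq (n : ℕ) (hn : 1 ≤ n) (sig sig' lam : ℝ) (hl : 0 < lam) :
    MSE n sig sig' lam lam = (1 / (n : ℝ) ^ 2) * ((∫ s, (s ⬝ᵥ s) ^ 2 ∂gaussPrior n (sig ^ 2))
      - 4 * n * ∫ s, ∫ g, eI n (sig' ^ 2) s lam g ∂gpi n ∂gaussPrior n (sig ^ 2)) := by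
  unfold MSE
  congr 1
  have hmap : (gaussPrior n (sig ^ 2)).prod (noiseMeasure n) =
      ((gaussPrior n (sig ^ 2)).prod (gpi n)).map (Prod.map id symZ) := by
    rw [noise_eq, ← Measure.map_prod_map _ _ measurable_id (measurable_symZ n), Measure.map_id]
  have key : ∀ p : (Fin n → ℝ) × (Fin n × Fin n → ℝ), frobSq (Matrix.vecMulVec p.1 p.1 -
        gibbsMatrix n sig' lam (obs n lam p.1 (symZ p.2))) =
        (p.1 ⬝ᵥ p.1) ^ 2 - 4 * n * eI n (sig' ^ 2) p.1 lam p.2 := fun p => by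
    rw [gibbsMatrix_eq n sig' lam hl, frob_eq n hn]
  rw [hmap, integral_map]
  rotate_left
  · exact (measurable_id.prodMap (measurable_symZ n)).aemeasurable
  · -- measurability of the integrand
    have mobs : Measurable (fun q : (Fin n → ℝ) × Matrix (Fin n) (Fin n) ℝ => obs n lam q.1 q.2) := by
      refine measurable_pi_lambda _ fun i => measurable_pi_lambda _ fun j => ?_
      simp only [obs, Matrix.add_apply, Matrix.smul_apply, Matrix.vecMulVec_apply]
      have : Measurable (fun q : (Fin n → ℝ) × Matrix (Fin n) (Fin n) ℝ => q.2 i j) :=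
        (measurable_entry n i j).comp measurable_snd
      fun_prop
    have mw : Measurable (fun q : ((Fin n → ℝ) × Matrix (Fin n) (Fin n) ℝ) × (Fin n → ℝ) =>
        weight n lam (obs n lam q.1.1 q.1.2) q.2) := by
      unfold weight frobSq
      have : ∀ i j, Measurable (fun q : ((Fin n → ℝ) × Matrix (Fin n) (Fin n) ℝ) × (Fin n → ℝ) =>
          obs n lam q.1.1 q.1.2 i j) := fun i j =>
        (measurable_entry n i j).comp (mobs.comp measurable_fst)
      simp only [Matrix.sub_apply, Matrix.smul_apply, Matrix.vecMulVec_apply]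
      fun_prop
    have mi : ∀ f : (Fin n → ℝ) → ℝ, Measurable f →
        Measurable (fun q : (Fin n → ℝ) × Matrix (Fin n) (Fin n) ℝ =>
          ∫ x, f x * weight n lam (obs n lam q.1 q.2) x ∂gaussPrior n (sig' ^ 2)) := fun f mf => by
      have : StronglyMeasurable (fun q : ((Fin n → ℝ) × Matrix (Fin n) (Fin n) ℝ) × (Fin n → ℝ) =>
        f q.2 * weight n lam (obs n lam q.1.1 q.1.2) q.2) :=
        ((mf.comp measurable_snd).mul mw).stronglyMeasurable
      exact (this.integral_prod_right' (ν := gaussPrior n (sig' ^ 2))).measurable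
    have mi0 := mi (fun _ => 1) measurable_const
    simp only [one_mul] at mi0
    have mg : ∀ i j, Measurable (fun q : (Fin n → ℝ) × Matrix (Fin n) (Fin n) ℝ =>
        gibbsMatrix n sig' lam (obs n lam q.1 q.2) i j) := fun i j =>
      (mi (fun x => x i * x j) (by fun_prop)).div mi0
    refine Measurable.aestronglyMeasurable ?_
    unfold frobSq
    simp only [Matrix.sub_apply, Matrix.vecMulVec_apply]
    fun_prop
  simp only [Prod.map_fst, Prod.map_snd, id_eq, key]
  rw [integral_sub (int_dot2_fst n _) ((int_eI n hn _ _ lam hl).const_mul _), integral_const_mul,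
    integral_prod _ (int_eI n hn _ _ lam hl), integral_prod _ (int_dot2_fst n _)]
  simp

/-- I-MMSE identity -/
theorem deriv_Fn (n : ℕ) (hn : 1 ≤ n) (sig sig' lam : ℝ) (hl : 0 < lam) :
    HasDerivAt (Fn n (sig ^ 2) (sig' ^ 2))
      ((1 / 4) * ((1 / (n : ℝ) ^ 2) * (∫ s, (s ⬝ᵥ s) ^ 2 ∂gaussPrior n (sig ^ 2))
        - MSE n sig sig' lam lam)) lam := by
  have hn' : (0:ℝ) < n := by exact_mod_cast hn
  refine ((deriv_Fn_aux n hn (sig ^ 2) (sig' ^ 2) lam hl).const_mul (1 / (n:ℝ))).congr_deriv ?_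
  rw [MSE_eq n hn sig sig' lam hl]
  field_simp
  ring

lemma gauss_quad (v : NNReal) (hv : v ≠ 0) (b κ : ℝ) (h : 0 < 1 + v * κ) :
    Integrable (fun x => Real.exp (b * x - κ * x ^ 2 / 2)) (gaussianReal 0 v) ∧
    ∫ x, Real.exp (b * x - κ * x ^ 2 / 2) ∂gaussianReal 0 v =
      (Real.sqrt (1 + v * κ))⁻¹ * Real.exp (v * b ^ 2 / (2 * (1 + v * κ))) := by
  have hv0 : (0:ℝ) < v := by positivity
  set w := 1 + v * κ with hw
  set v' : NNReal := ⟨v / w, by positivity⟩ with hv'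
  have hv'c : (v' : ℝ) = v / w := rfl
  have hv'0 : v' ≠ 0 := by
    intro h0
    have : (v' : ℝ) = 0 := by rw [h0]; rfl
    rw [hv'c] at this
    have : 0 < (v:ℝ) / w := by positivity
    linarith
  set C := (Real.sqrt w)⁻¹ * Real.exp (v * b ^ 2 / (2 * w)) with hC
  have key : ∀ x, gaussianPDFReal 0 v x * Real.exp (b * x - κ * x ^ 2 / 2)
      = C * gaussianPDFReal (v * b / w) v' x := by
    intro x
    simp only [gaussianPDFReal_def, hv'c, hC]
    have e1 : Real.sqrt (2 * Real.pi * v) = Real.sqrt w * Real.sqrt (2 * Real.pi * (v / w)) := by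
      rw [← Real.sqrt_mul h.le]; congr 1; field_simp
    rw [e1, mul_inv]
    have e2 : Real.exp (-(x - 0) ^ 2 / (2 * v)) * Real.exp (b * x - κ * x ^ 2 / 2) =
        Real.exp (v * b ^ 2 / (2 * w)) * Real.exp (-(x - v * b / w) ^ 2 / (2 * (v / w))) := by
      rw [← Real.exp_add, ← Real.exp_add]
      congr 1
      have hκ : κ = (w - 1) / v := by rw [hw]; field_simp; ring
      rw [hκ]
      field_simp
      ring
    calc _ = (Real.sqrt w)⁻¹ * (Real.sqrt (2 * Real.pi * (v / w)))⁻¹ *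
        (Real.exp (-(x - 0) ^ 2 / (2 * v)) * Real.exp (b * x - κ * x ^ 2 / 2)) := by ring
      _ = _ := by rw [e2]; ring
  constructor
  · rw [gaussianReal_of_var_ne_zero _ hv]
    rw [integrable_withDensity_iff (measurable_gaussianPDF _ _)
      (Eventually.of_forall fun x => ENNReal.ofReal_lt_top)]
    refine ((integrable_gaussianPDFReal (v * b / w) v').const_mul C).congr
      (Eventually.of_forall fun x => ?_)
    simp only
    rw [toReal_gaussianPDF, ← key x, mul_comm]
  · rw [integral_gaussianReal_eq_integral_smul hv]
    simp only [smul_eq_mul, key]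
    rw [integral_const_mul, integral_gaussianPDFReal_eq_one _ hv'0, mul_one]

lemma toNNReal_ne {v : ℝ} (hv : 0 < v) : Real.toNNReal v ≠ 0 := by
  simpa using hv

lemma gauss_vec (n : ℕ) (v : ℝ) (hv : 0 < v) (b : Fin n → ℝ) (κ : ℝ) (h : 0 < 1 + v * κ) :
    Integrable (fun x => Real.exp (b ⬝ᵥ x - κ * (x ⬝ᵥ x) / 2)) (gaussPrior n v) ∧
    ∫ x, Real.exp (b ⬝ᵥ x - κ * (x ⬝ᵥ x) / 2) ∂gaussPrior n v =
      (Real.sqrt (1 + v * κ))⁻¹ ^ n * Real.exp (v * (b ⬝ᵥ b) / (2 * (1 + v * κ))) := by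
  have e : (fun x : Fin n → ℝ => Real.exp (b ⬝ᵥ x - κ * (x ⬝ᵥ x) / 2)) =
      fun x => ∏ i, Real.exp (b i * x i - κ * x i ^ 2 / 2) := by
    funext x
    rw [← Real.exp_sum]
    congr 1
    simp only [dotProduct, Finset.sum_sub_distrib, Finset.mul_sum, Finset.sum_div, sq]
  have hc : ((Real.toNNReal v : NNReal) : ℝ) = v := Real.coe_toNNReal v hv.le
  have hq := fun i => gauss_quad (Real.toNNReal v) (toNNReal_ne hv) (b i) κ (by rw [hc]; exact h)
  rw [e]
  unfold gaussPrior
  constructor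
  · exact Integrable.fintype_prod fun i => (hq i).1
  · rw [integral_fintype_prod_eq_prod (fun i y => Real.exp (b i * y - κ * y ^ 2 / 2))]
    rw [Finset.prod_congr rfl fun i _ => (hq i).2, Finset.prod_mul_distrib, Finset.prod_const,
      ← Real.exp_sum, hc]
    simp only [Finset.card_univ, Fintype.card_fin]
    congr 2
    rw [dotProduct, Finset.mul_sum, Finset.sum_div]
    simp only [sq]

lemma gauss_spike (n : ℕ) (v : ℝ) (hv : 0 < v) (b s : Fin n → ℝ) (κ θ : ℝ) (h : 0 < 1 + v * κ)
    (hθ : 0 ≤ θ) (h2 : θ * v * (s ⬝ᵥ s) / (1 + v * κ) < 1) :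
    Integrable (fun x => Real.exp (b ⬝ᵥ x - κ * (x ⬝ᵥ x) / 2 + θ * (s ⬝ᵥ x) ^ 2 / 2))
      (gaussPrior n v) ∧
    ∫ x, Real.exp (b ⬝ᵥ x - κ * (x ⬝ᵥ x) / 2 + θ * (s ⬝ᵥ x) ^ 2 / 2) ∂gaussPrior n v =
      (Real.sqrt (1 + v * κ))⁻¹ ^ n * Real.exp (v * (b ⬝ᵥ b) / (2 * (1 + v * κ))) *
      ((Real.sqrt (1 - θ * v * (s ⬝ᵥ s) / (1 + v * κ)))⁻¹ *
        Real.exp (θ * (v * (s ⬝ᵥ b) / (1 + v * κ)) ^ 2 /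
          (2 * (1 - θ * v * (s ⬝ᵥ s) / (1 + v * κ))))) := by
  set w := 1 + v * κ with hw
  set r := Real.sqrt θ with hr
  have hr2 : r ^ 2 = θ := Real.sq_sqrt hθ
  set G := gaussianReal 0 1
  set f : (Fin n → ℝ) × ℝ → ℝ := fun p =>
    Real.exp ((b + (r * p.2) • s) ⬝ᵥ p.1 - κ * (p.1 ⬝ᵥ p.1) / 2) with hf
  have mf : Measurable f := by
    simp only [hf, add_dotProduct, smul_dotProduct, smul_eq_mul]
    fun_prop
  have hx : ∀ ξ : ℝ, ∫ x, f (x, ξ) ∂gaussPrior n v =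
      ((Real.sqrt w)⁻¹ ^ n * Real.exp (v * (b ⬝ᵥ b) / (2 * w))) *
      Real.exp ((v * r * (s ⬝ᵥ b) / w) * ξ - (-(θ * v * (s ⬝ᵥ s) / w)) * ξ ^ 2 / 2) := by
    intro ξ
    simp only [hf]
    rw [(gauss_vec n v hv (b + (r * ξ) • s) κ h).2, mul_assoc, ← Real.exp_add, ← hw]
    congr 2
    simp only [add_dotProduct, smul_dotProduct, dotProduct_add, dotProduct_smul, smul_eq_mul]
    rw [dotProduct_comm b s, ← hr2]
    field_simp
    ring
  have q1 := gauss_quad 1 one_ne_zero (v * r * (s ⬝ᵥ b) / w) (-(θ * v * (s ⬝ᵥ s) / w))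
    (by simp only [NNReal.coe_one]; linarith)
  have hintg : Integrable f ((gaussPrior n v).prod G) := by
    rw [integrable_prod_iff' mf.aestronglyMeasurable]
    constructor
    · exact Eventually.of_forall fun ξ => (gauss_vec n v hv (b + (r * ξ) • s) κ h).1
    · have : (fun ξ => ∫ x, ‖f (x, ξ)‖ ∂gaussPrior n v) = fun ξ => ∫ x, f (x, ξ) ∂gaussPrior n v := by
        funext ξ
        simp only [hf, Real.norm_eq_abs, Real.abs_exp]
      rw [this]
      simp only [hx]
      exact q1.1.const_mul _
  have hξ : ∀ x, ∫ ξ, f (x, ξ) ∂G =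
      Real.exp (b ⬝ᵥ x - κ * (x ⬝ᵥ x) / 2 + θ * (s ⬝ᵥ x) ^ 2 / 2) := by
    intro x
    have q2 := (gauss_quad 1 one_ne_zero (r * (s ⬝ᵥ x)) 0 (by norm_num)).2
    have : ∀ ξ, f (x, ξ) = Real.exp (b ⬝ᵥ x - κ * (x ⬝ᵥ x) / 2) *
        Real.exp ((r * (s ⬝ᵥ x)) * ξ - 0 * ξ ^ 2 / 2) := by
      intro ξ
      rw [← Real.exp_add]
      simp only [hf, add_dotProduct, smul_dotProduct, smul_eq_mul]
      congr 1; ring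
    simp only [this]
    rw [integral_const_mul, q2, ← hr2, Real.exp_add]
    congr 1
    simp
    ring_nf
  have hfin := hintg.integral_prod_left
  simp only [hξ] at hfin
  refine ⟨hfin, ?_⟩
  have hsw := integral_integral_swap (f := fun x ξ => f (x, ξ)) hintg
  simp only [hξ, hx] at hsw
  rw [hsw, integral_const_mul, q1.2]
  congr 1
  simp only [NNReal.coe_one, one_mul]
  rw [← sub_eq_add_neg, ← hr2]
  congr 3
  ring

/-! Gaussian norm moments -/

lemma mom_dot (n : ℕ) (v : ℝ) (hv : 0 < v) : ∫ s, s ⬝ᵥ s ∂gaussPrior n v = n * v := by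
  have hc : ((Real.toNNReal v : NNReal) : ℝ) = v := Real.coe_toNNReal v hv.le
  have h1 : ∀ k : Fin n, ∫ s, s k * s k ∂gaussPrior n v = v := by
    intro k
    have := stein_gr (fun _ : Fin n => Real.toNNReal v) (fun _ => toNNReal_ne hv) k
      (fun s => s k) (fun _ => 1) (fun s => by simpa using hasDerivAt_id' (s k))
      (by fun_prop) (by fun_prop) (ExpGr.coord k) (ExpGr.const 1)
    unfold gaussPrior
    simpa [hc] using this
  unfold dotProduct
  rw [integral_finsetSum]
  · simp [h1]
  · intro k _
    exact ((ExpGr.coord k).mul (ExpGr.coord k)).integrable _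
      (by have : Measurable (fun x : Fin n → ℝ => x k * x k) := by fun_prop
          exact this.aestronglyMeasurable)

lemma mom_dot2 (n : ℕ) (v : ℝ) (hv : 0 < v) :
    ∫ s, (s ⬝ᵥ s) ^ 2 ∂gaussPrior n v = n * v * ((n + 2) * v) := by
  have hc : ((Real.toNNReal v : NNReal) : ℝ) = v := Real.coe_toNNReal v hv.le
  have mi : ∀ f : (Fin n → ℝ) → ℝ, Measurable f → ExpGr f → Integrable f (gaussPrior n v) :=
    fun f mf hf => hf.integrable _ mf.aestronglyMeasurable
  have h1 : ∀ k : Fin n, ∫ s, s k * (s k * (s ⬝ᵥ s)) ∂gaussPrior n v =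
      v * ∫ s, (s ⬝ᵥ s + 2 * (s k * s k)) ∂gaussPrior n v := by
    intro k
    have := stein_gr (fun _ : Fin n => Real.toNNReal v) (fun _ => toNNReal_ne hv) k
      (fun s => s k * (s ⬝ᵥ s)) (fun s => s ⬝ᵥ s + 2 * (s k * s k)) (fun s => ?_)
      (by fun_prop) (by fun_prop) ((ExpGr.coord k).mul (expGr_dot n))
      ((expGr_dot n).add (((ExpGr.coord k).mul (ExpGr.coord k)).const_mul 2))
    · rw [hc] at this; exact this
    · have hd : ∀ i, HasDerivAt (fun y => Function.update s k y i) (if i = k then 1 else 0) (s k) := by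
        intro i
        by_cases h : i = k
        · subst h; simpa using hasDerivAt_id' (s i)
        · simpa [h] using hasDerivAt_const (s k) (s i)
      have h2 : HasDerivAt (fun y => Function.update s k y ⬝ᵥ Function.update s k y)
          (2 * s k) (s k) := by
        unfold dotProduct
        refine (HasDerivAt.fun_sum fun i _ => (hd i).mul (hd i)).congr_deriv ?_
        simp [Finset.sum_add_distrib]
        ring
      refine ((hd k).mul h2).congr_deriv ?_
      simp
      ring
  have e : (fun s : Fin n → ℝ => (s ⬝ᵥ s) ^ 2) = fun s => ∑ k, s k * (s k * (s ⬝ᵥ s)) := by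
    funext s
    rw [sq]
    nth_rw 1 [dotProduct]
    rw [Finset.sum_mul]
    simp only [mul_assoc]
  rw [e, integral_finsetSum]
  · rw [Finset.sum_congr rfl fun k _ => h1 k, ← Finset.mul_sum, ← integral_finsetSum]
    · have : (fun s : Fin n → ℝ => ∑ k, (s ⬝ᵥ s + 2 * (s k * s k))) =
          fun s => ((n:ℝ) + 2) * (s ⬝ᵥ s) := by
        funext s
        rw [Finset.sum_add_distrib, ← Finset.mul_sum]
        simp [dotProduct]
        ring
      rw [this, integral_const_mul, mom_dot n v hv]
      ring
    · intro k _
      exact mi _ (by fun_prop) ((expGr_dot n).add (((ExpGr.coord k).mul (ExpGr.coord k)).const_mul 2))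
  · intro k _
    exact mi _ (by fun_prop) ((ExpGr.coord k).mul ((ExpGr.coord k).mul (expGr_dot n)))

lemma mom_var (n : ℕ) (hn : 1 ≤ n) (v : ℝ) (hv : 0 < v) :
    ∫ s, ((s ⬝ᵥ s) / n - v) ^ 2 ∂gaussPrior n v = 2 * v ^ 2 / n := by
  have hn' : (0:ℝ) < n := by exact_mod_cast hn
  have e : (fun s : Fin n → ℝ => ((s ⬝ᵥ s) / n - v) ^ 2) = fun s =>
      (1 / (n:ℝ) ^ 2) * (s ⬝ᵥ s) ^ 2 + ((-2 * v / n) * (s ⬝ᵥ s) + v ^ 2) := by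
    funext s; field_simp; ring
  rw [e, integral_add, integral_add, integral_const_mul, integral_const_mul, mom_dot n v hv,
    mom_dot2 n v hv]
  · simp
    field_simp
    ring
  · exact (int_dot n v).const_mul _
  · exact integrable_const _
  · exact (int_dot_pow n v 2).const_mul _
  · exact ((int_dot n v).const_mul _).add (integrable_const _)

def ballu (n : ℕ) (r : ℝ) : Set (Fin n → ℝ) := {x | x ⬝ᵥ x ≤ r}

lemma measurableSet_ballu (n : ℕ) (r : ℝ) : MeasurableSet (ballu n r) :=
  measurableSet_le (by fun_prop) measurable_const

/-- truncated prior -/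
def tP (n : ℕ) (v r : ℝ) : Measure (Fin n → ℝ) := (gaussPrior n v).restrict (ballu n r)

instance (n : ℕ) (v r : ℝ) : IsFiniteMeasure (tP n v r) := by unfold tP; infer_instance

lemma tP_ae (n : ℕ) (v r : ℝ) : ∀ᵐ x ∂tP n v r, x ⬝ᵥ x ≤ r :=
  ae_restrict_mem (measurableSet_ballu n r)

section generic
variable {n : ℕ} (ν : Measure (Fin n → ℝ)) (H : (Fin n → ℝ) → ℝ)

/-- second moment matrix of a Gibbs measure -/
def gT (i j : Fin n) : ℝ := gav ν H (fun x => x i * x j)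

/-- mean of a Gibbs measure -/
def gm (i : Fin n) : ℝ := gav ν H (fun x => x i)

lemma gav_quad (hI : ∀ i j, Integrable (fun x => (x i * x j) * Real.exp (H x)) ν)
    (y : Fin n → ℝ) : gav ν H (fun x => (y ⬝ᵥ x) ^ 2) = ∑ i, ∑ j, (y i * y j) * gT ν H i j := by
  have : (fun x : Fin n → ℝ => (y ⬝ᵥ x) ^ 2) = fun x => ∑ i, ∑ j, (y i * y j) * (x i * x j) := by
    funext x; rw [sum_mul_dot]
  rw [this, gav_finset_sum]
  · apply Finset.sum_congr rfl; intro i _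
    rw [gav_finset_sum]
    · apply Finset.sum_congr rfl; intro j _
      rw [gav_const_mul]; rfl
    · intro j _
      simp only [mul_assoc (y i * y j)]
      exact (hI i j).const_mul _
  · intro i _
    simp only [Finset.sum_mul]
    refine integrable_finsetSum _ fun j _ => ?_
    simp only [mul_assoc (y i * y j)]
    exact (hI i j).const_mul _

lemma gav_dot (hI : ∀ i, Integrable (fun x => x i * Real.exp (H x)) ν) (y : Fin n → ℝ) :
    gav ν H (fun x => y ⬝ᵥ x) = y ⬝ᵥ gm ν H := by
  unfold dotProduct
  rw [gav_finset_sum]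
  · simp only [gav_const_mul]; rfl
  · intro i _
    simp only [mul_assoc]
    exact (hI i).const_mul _

lemma frob_ge (hZ : Integrable (fun x => Real.exp (H x)) ν) (hp : 0 < ∫ x, Real.exp (H x) ∂ν)
    (hI1 : ∀ i, Integrable (fun x => x i * Real.exp (H x)) ν)
    (hI : ∀ i j, Integrable (fun x => (x i * x j) * Real.exp (H x)) ν) :
    (gm ν H ⬝ᵥ gm ν H) ^ 2 ≤ ∑ i, ∑ j, gT ν H i j ^ 2 := by
  set m := gm ν H with hm
  have h1 := gav_quad ν H hI m
  have h2 := gav_dot ν H hI1 m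
  have h3 := gav_sq_le ν H (fun x => m ⬝ᵥ x) hZ ?_ ?_ hp
  · rw [h1, h2] at h3
    have h4 : 0 ≤ ∑ i, ∑ j, (gT ν H i j - m i * m j) ^ 2 := by positivity
    have h5 : ∑ i, ∑ j, (gT ν H i j - m i * m j) ^ 2 = ∑ i, ∑ j, gT ν H i j ^ 2
        - 2 * (∑ i, ∑ j, (m i * m j) * gT ν H i j) + (m ⬝ᵥ m) ^ 2 := by
      rw [← sum_mul_dot]
      simp only [Finset.mul_sum, ← Finset.sum_sub_distrib, ← Finset.sum_add_distrib]
      apply Finset.sum_congr rfl; intro i _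
      apply Finset.sum_congr rfl; intro j _
      ring
    have h6 : m ⬝ᵥ gm ν H = m ⬝ᵥ m := rfl
    rw [h6] at h3
    linarith
  · simp only [dotProduct, Finset.sum_mul, mul_assoc]
    exact integrable_finsetSum _ fun i _ => (hI1 i).const_mul _
  · have : (fun x : Fin n → ℝ => (m ⬝ᵥ x) ^ 2 * Real.exp (H x)) =
        fun x => ∑ i, ∑ j, (m i * m j) * ((x i * x j) * Real.exp (H x)) := by
      funext x; rw [← sum_mul_dot]; simp only [Finset.sum_mul, mul_assoc]
    rw [this]
    exact integrable_finsetSum _ fun i _ => integrable_finsetSum _ fun j _ => (hI i j).const_mul _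

end generic

/-- Guerra interpolation data -/
def dG (n : ℕ) (v : ℝ) (s : Fin n → ℝ) (lam q r : ℝ) :
    GD (Fin n → ℝ) ((Fin n × Fin n) ⊕ Fin n) where
  ν := tP n v r
  φ := Sum.elim qf (fun i x => x i)
  c := Sum.elim (fun _ t => Real.sqrt (lam / n) * Real.sin t)
    (fun _ t => Real.sqrt (lam * q) * Real.cos t)
  c' := Sum.elim (fun _ t => Real.sqrt (lam / n) * Real.cos t)
    (fun _ t => Real.sqrt (lam * q) * -Real.sin t)
  B := fun t x => -(Real.sin t ^ 2 * (lam / (4 * n) * (x ⬝ᵥ x) ^ 2)) -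
    Real.cos t ^ 2 * (lam * q / 2 * (x ⬝ᵥ x)) + lam / (2 * n) * (s ⬝ᵥ x) ^ 2
  B' := fun t x => Real.sin t * Real.cos t * (-(lam / (2 * n) * (x ⬝ᵥ x) ^ 2) +
    lam * q * (x ⬝ᵥ x))
  U := fun _ => 1 + r + lam * r ^ 2 + lam * q * r + lam * (s ⬝ᵥ s) * r

def vG (n : ℕ) : (Fin n × Fin n) ⊕ Fin n → NNReal := Sum.elim nv (fun _ => 1)

lemma vG_ne (n : ℕ) (i) : vG n i ≠ 0 := by
  rcases i with p | i
  · exact nv_ne p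
  · exact one_ne_zero

lemma dG_good (n : ℕ) (hn : 1 ≤ n) (v : ℝ) (s : Fin n → ℝ) (lam q r : ℝ) (hl : 0 < lam)
    (hq : 0 ≤ q) (hr : 0 ≤ r) (hne : tP n v r ≠ 0) (t0 : ℝ) :
    ∃ C, (dG n v s lam q r).Good t0 1 C := by
  have hn' : (0:ℝ) < n := by exact_mod_cast hn
  have hn1 : (1:ℝ) ≤ n := by exact_mod_cast hn
  have hs := dot_self_nonneg s
  have p1 : 0 ≤ lam * r ^ 2 := by positivity
  have p2 : 0 ≤ lam * q * r := by positivity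
  have p3 : 0 ≤ lam * (s ⬝ᵥ s) * r := by positivity
  refine ⟨_, GD.good_of_bounded (dG n v s lam q r) t0 1
    (Real.sqrt (lam / n) + Real.sqrt (lam * q))
    (1 + r + lam * r ^ 2 + lam * q * r + lam * (s ⬝ᵥ s) * r) one_pos
    (by simp only [dG]; infer_instance) hne ?_ ?_ ?_ (by linarith) rfl (by positivity) ?_ ?_⟩
  · rintro (p | i)
    · exact measurable_qf p
    · exact measurable_pi_apply i
  · intro t; simp only [dG]; fun_prop
  · intro t; simp only [dG]; fun_prop
  · filter_upwards [tP_ae n v r] with x hx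
    have hu := dot_self_nonneg x
    refine ⟨?_, fun t _ => ⟨?_, ?_, ?_⟩⟩
    · rintro (p | i)
      · have := abs_qf_le p x
        simp only [dG, Sum.elim_inl]; linarith
      · have h1 := coord_mul_le x i i
        simp only [dG, Sum.elim_inr]
        have : |x i| ≤ 1 + x ⬝ᵥ x := by
          rw [abs_mul] at h1
          nlinarith [abs_nonneg (x i), sq_nonneg (|x i| - 1)]
        linarith
    · simp only [dG]
      have h1 := ((Real.hasDerivAt_sin t).fun_pow 2).mul_const (lam / (4 * n) * (x ⬝ᵥ x) ^ 2)
      have h2 := ((Real.hasDerivAt_cos t).fun_pow 2).mul_const (lam * q / 2 * (x ⬝ᵥ x))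
      refine ((h1.fun_neg.fun_sub h2).add_const (lam / (2 * n) * (s ⬝ᵥ x) ^ 2)).congr_deriv ?_
      field_simp
      ring
    all_goals
      have hu2 : (x ⬝ᵥ x) ^ 2 ≤ r ^ 2 := by gcongr
      have hsin := Real.sin_sq_le_one t
      have hcos := Real.cos_sq_le_one t
      have hs2 := sq_nonneg (Real.sin t)
      have hc2 := sq_nonneg (Real.cos t)
    · simp only [dG]
      have a1 : lam / (4 * n) * (x ⬝ᵥ x) ^ 2 ≤ lam * r ^ 2 := by
        gcongr
        rw [div_le_iff₀ (by positivity)]; nlinarith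
      have a1' : Real.sin t ^ 2 * (lam / (4 * n) * (x ⬝ᵥ x) ^ 2) ≤ lam * r ^ 2 := by
        refine (mul_le_of_le_one_left (by positivity) hsin).trans a1
      have a2 : lam * q / 2 * (x ⬝ᵥ x) ≤ lam * q * r := by
        gcongr
        have : 0 ≤ lam * q := by positivity
        linarith
      have a2' : Real.cos t ^ 2 * (lam * q / 2 * (x ⬝ᵥ x)) ≤ lam * q * r := by
        refine (mul_le_of_le_one_left (by positivity) hcos).trans a2
      have a3 : lam / (2 * n) * (s ⬝ᵥ x) ^ 2 ≤ lam * (s ⬝ᵥ s) * r := by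
        calc lam / (2 * n) * (s ⬝ᵥ x) ^ 2 ≤ lam * ((s ⬝ᵥ s) * r) := by
              gcongr
              · rw [div_le_iff₀ (by positivity)]; nlinarith
              · refine (dot_sq_le s x).trans ?_
                gcongr
          _ = _ := by ring
      have b1 : 0 ≤ Real.sin t ^ 2 * (lam / (4 * n) * (x ⬝ᵥ x) ^ 2) := by positivity
      have b2 : 0 ≤ Real.cos t ^ 2 * (lam * q / 2 * (x ⬝ᵥ x)) := by positivity
      have b3 : 0 ≤ lam / (2 * n) * (s ⬝ᵥ x) ^ 2 := by positivity
      rw [abs_le]; constructor <;> linarith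
    · simp only [dG]
      rw [abs_mul]
      have h3 : |Real.sin t * Real.cos t| ≤ 1 := by
        rw [abs_mul]
        exact mul_le_one₀ (Real.abs_sin_le_one t) (abs_nonneg _) (Real.abs_cos_le_one t)
      refine (mul_le_of_le_one_left (abs_nonneg _) h3).trans ?_
      have a1 : lam / (2 * n) * (x ⬝ᵥ x) ^ 2 ≤ lam * r ^ 2 := by
        gcongr
        rw [div_le_iff₀ (by positivity)]; nlinarith
      have a2 : lam * q * (x ⬝ᵥ x) ≤ lam * q * r := by gcongr
      have b1 : 0 ≤ lam / (2 * n) * (x ⬝ᵥ x) ^ 2 := by positivity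
      have b2 : 0 ≤ lam * q * (x ⬝ᵥ x) := by positivity
      rw [abs_le]; constructor <;> linarith
  · have e1 := Real.sqrt_nonneg (lam / n)
    have e2 := Real.sqrt_nonneg (lam * q)
    rintro (p | i) t _
    · simp only [dG, Sum.elim_inl]
      refine ⟨(Real.hasDerivAt_sin t).const_mul _, ?_, ?_⟩
      · rw [abs_mul, abs_of_nonneg e1]
        nlinarith [Real.abs_sin_le_one t]
      · rw [abs_mul, abs_of_nonneg e1]
        nlinarith [Real.abs_cos_le_one t]
    · simp only [dG, Sum.elim_inr]
      refine ⟨(Real.hasDerivAt_cos t).const_mul _, ?_, ?_⟩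
      · rw [abs_mul, abs_of_nonneg e2]
        nlinarith [Real.abs_cos_le_one t]
      · rw [abs_mul, abs_of_nonneg e2, abs_neg]
        nlinarith [Real.abs_sin_le_one t]

section
variable {n : ℕ} (hn : 1 ≤ n) (v : ℝ) (s : Fin n → ℝ) {lam q r : ℝ} (hl : 0 < lam)
    (hq : 0 ≤ q) (hr : 0 ≤ r) (hne : tP n v r ≠ 0) (t : ℝ) 
include hn hl hq hr hne

lemma dG_int (g) (f : (Fin n → ℝ) → ℝ) (mf : Measurable f) (K : ℝ)
    (hf : ∀ x, x ⬝ᵥ x ≤ r → |f x| ≤ K) :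
    Integrable (fun x => f x * Real.exp ((dG n v s lam q r).H t g x)) (tP n v r) := by
  obtain ⟨C, hC⟩ := dG_good n hn v s lam q r hl hq hr hne t
  have hM : ∀ᵐ x ∂(dG n v s lam q r).ν, 1 ≤ (dG n v s lam q r).U x := hC.hx.mono fun x hx => hx.1
  refine hC.int_of_le hC.t0mem g f mf |K| ?_
  filter_upwards [hM, tP_ae n v r] with x h1 h2
  have h3 := hf x h2
  have h4 := le_abs_self K
  have h5 : 1 ≤ (dG n v s lam q r).U x ^ 2 := one_le_pow₀ h1
  exact (h3.trans h4).trans (le_mul_of_one_le_right (abs_nonneg K) h5)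

lemma dG_intZ (g) :
    Integrable (fun x => Real.exp ((dG n v s lam q r).H t g x)) (tP n v r) := by
  simpa using dG_int hn v s hl hq hr hne t g (fun _ => 1) (by fun_prop) 1 (by simp)

lemma dG_intx (g) (i : Fin n) :
    Integrable (fun x => x i * Real.exp ((dG n v s lam q r).H t g x)) (tP n v r) := by
  refine dG_int hn v s hl hq hr hne t g (fun x => x i) (by fun_prop) (1 + r) fun x hx => ?_
  have h1 := coord_mul_le x i i
  rw [abs_mul] at h1
  nlinarith [abs_nonneg (x i), sq_nonneg (|x i| - 1)]

lemma dG_intxx (g) (i j : Fin n) :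
    Integrable (fun x => (x i * x j) * Real.exp ((dG n v s lam q r).H t g x)) (tP n v r) :=
  dG_int hn v s hl hq hr hne t g (fun x => x i * x j) (by fun_prop) r fun x hx =>
    (coord_mul_le x i j).trans hx

lemma dG_Zpos (g) :
    0 < ∫ x, Real.exp ((dG n v s lam q r).H t g x) ∂(tP n v r) := by
  obtain ⟨C, hC⟩ := dG_good n hn v s lam q r hl hq hr hne t
  exact hC.Zpos hC.t0mem g

lemma dG_deriv :
    HasDerivAt (fun t => ∫ g, Real.log (∫ x, Real.exp ((dG n v s lam q r).H t g x) ∂(tP n v r))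
        ∂(Measure.pi fun i => gaussianReal 0 (vG n i)))
      (∫ g, lam * Real.sin t * Real.cos t * (q * (gm (tP n v r) ((dG n v s lam q r).H t g) ⬝ᵥ
        gm (tP n v r) ((dG n v s lam q r).H t g)) -
        (∑ i, ∑ j, gT (tP n v r) ((dG n v s lam q r).H t g) i j ^ 2) / (2 * n))
        ∂(Measure.pi fun i => gaussianReal 0 (vG n i))) t := by
  have hn' : (0:ℝ) < n := by exact_mod_cast hn
  obtain ⟨C, hC⟩ := dG_good n hn v s lam q r hl hq hr hne t
  refine (hC.main (vG n) (vG_ne n)).congr_deriv ?_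
  refine integral_congr_ae (Eventually.of_forall fun g => ?_)
  have iI := dG_int hn v s hl hq hr hne t g
  have ixx := dG_intxx hn v s hl hq hr hne t g
  change gav (tP n v r) ((dG n v s lam q r).H t g) _ + ∑ k, _ * (gav (tP n v r) _ _ - gav (tP n v r) _ _ ^ 2) = _
  set H := (dG n v s lam q r).H t g with hH
  set ν := tP n v r
  change _ = lam * Real.sin t * Real.cos t * (q * (gm ν H ⬝ᵥ gm ν H) -
    (∑ i, ∑ j, gT ν H i j ^ 2) / (2 * n))
  clear_value H
  rw [Fintype.sum_sum_type]
  simp only [dG, vG, Sum.elim_inl, Sum.elim_inr]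
  have hT : ∀ p, gav ν H (qf p) = ft (fun i j => gT ν H i j) p := fun p =>
    gav_ft ν H (fun (x : Fin n → ℝ) i j => x i * x j) p
  have hsq : Real.sqrt (lam / n) * Real.sqrt (lam / n) = lam / n :=
    Real.mul_self_sqrt (by positivity)
  have hsq2 : Real.sqrt (lam * q) * Real.sqrt (lam * q) = lam * q :=
    Real.mul_self_sqrt (by positivity)
  have e0 : ∀ p : Fin n × Fin n, (nv p : ℝ) * (Real.sqrt (lam / n) * Real.sin t) *
      (Real.sqrt (lam / n) * Real.cos t) *
      (gav ν H (fun x => qf p x ^ 2) - gav ν H (qf p) ^ 2) =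
      lam / n * (Real.sin t * Real.cos t) * (nv p * gav ν H (fun x => qf p x ^ 2))
        - lam / n * (Real.sin t * Real.cos t) * (nv p * (ft (fun i j => gT ν H i j) p *
          ft (fun i j => gT ν H i j) p)) := by
    intro p
    rw [hT]
    linear_combination (nv p * Real.sin t * Real.cos t * (gav ν H (fun x => qf p x ^ 2) -
      ft (fun i j => gT ν H i j) p ^ 2)) * hsq
  have e0' : ∀ i : Fin n, ((1 : NNReal) : ℝ) * (Real.sqrt (lam * q) * Real.cos t) *
      (Real.sqrt (lam * q) * -Real.sin t) *
      (gav ν H (fun x => x i ^ 2) - gav ν H (fun x => x i) ^ 2) =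
      -(lam * q * (Real.sin t * Real.cos t)) * gav ν H (fun x => x i * x i)
        + lam * q * (Real.sin t * Real.cos t) * (gm ν H i * gm ν H i) := by
    intro i
    simp only [gm, sq, NNReal.coe_one]
    linear_combination (-(Real.sin t * Real.cos t * (gav ν H (fun x => x i * x i) -
      gav ν H (fun x => x i) * gav ν H (fun x => x i)))) * hsq2
  rw [Finset.sum_congr rfl fun p _ => e0 p, Finset.sum_sub_distrib, ← Finset.mul_sum,
    ← Finset.mul_sum, ft_inner, Finset.sum_congr rfl fun p _ => e0' p, Finset.sum_add_distrib,
    ← Finset.mul_sum, ← Finset.mul_sum]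
  rotate_left
  · intro i j; simp only [gT, mul_comm]
  · intro i j; simp only [gT, mul_comm]
  have iq : ∀ p, Integrable (fun x => qf p x ^ 2 * Real.exp (H x)) ν := by
    intro p
    have := measurable_qf p
    refine iI _ (by fun_prop) (r ^ 2) fun x hx => ?_
    rw [abs_pow]
    have := (abs_qf_le p x).trans hx
    gcongr
  have e1 : ∑ p, (nv p : ℝ) * gav ν H (fun x => qf p x ^ 2)
      = 1 / 2 * gav ν H (fun x => (x ⬝ᵥ x) ^ 2) := by
    rw [← gav_const_mul]
    have : (fun x : Fin n → ℝ => 1 / 2 * (x ⬝ᵥ x) ^ 2) = fun x => ∑ p, (nv p : ℝ) * qf p x ^ 2 := by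
      funext x; rw [← qf_inner]; simp only [sq]
    rw [this, gav_finset_sum]
    · simp only [gav_const_mul]
    · intro p _
      simp only [mul_assoc]
      exact (iq p).const_mul _
  have e1' : ∑ i, gav ν H (fun x => x i * x i) = gav ν H (fun x => x ⬝ᵥ x) := by
    unfold dotProduct
    rw [gav_finset_sum]
    intro i _
    exact ixx i i
  have iu : Integrable (fun x => (x ⬝ᵥ x) * Real.exp (H x)) ν := by
    refine iI _ (by fun_prop) r fun x hx => ?_
    rw [abs_of_nonneg (dot_self_nonneg x)]; exact hx
  have iu2 : Integrable (fun x => (x ⬝ᵥ x) ^ 2 * Real.exp (H x)) ν := by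
    refine iI _ (by fun_prop) (r ^ 2) fun x hx => ?_
    rw [abs_pow, abs_of_nonneg (dot_self_nonneg x)]
    have := dot_self_nonneg x
    gcongr
  have e2 : gav ν H (fun x => Real.sin t * Real.cos t * (-(lam / (2 * n) * (x ⬝ᵥ x) ^ 2) +
      lam * q * (x ⬝ᵥ x))) = Real.sin t * Real.cos t * (-(lam / (2 * n)) *
        gav ν H (fun x => (x ⬝ᵥ x) ^ 2) + lam * q * gav ν H (fun x => x ⬝ᵥ x)) := by
    rw [gav_const_mul]
    congr 1
    rw [← gav_const_mul ν H (fun x : Fin n → ℝ => (x ⬝ᵥ x) ^ 2) (-(lam / (2 * n))),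
      ← gav_const_mul ν H (fun x : Fin n → ℝ => (x ⬝ᵥ x)) (lam * q), ← gav_add]
    · simp only [neg_mul]
    · simp only [mul_assoc]
      exact iu2.const_mul _
    · simp only [mul_assoc]
      exact (iu.const_mul _).const_mul _
  rw [e1, e1', e2]
  have e3 : ∑ i, gm ν H i * gm ν H i = gm ν H ⬝ᵥ gm ν H := rfl
  rw [e3]
  simp only [sq]
  field_simp
  ring

/-- Guerra upper bound. -/
lemma dG_guerra :
    ∫ g, Real.log (∫ x, Real.exp ((dG n v s lam q r).H (Real.pi / 2) g x) ∂(tP n v r))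
        ∂(Measure.pi fun i => gaussianReal 0 (vG n i)) ≤
    ∫ g, Real.log (∫ x, Real.exp ((dG n v s lam q r).H 0 g x) ∂(tP n v r))
        ∂(Measure.pi fun i => gaussianReal 0 (vG n i)) + n * lam * q ^ 2 / 4 := by
  have hn' : (0:ℝ) < n := by exact_mod_cast hn
  set G := fun t => ∫ g, Real.log (∫ x, Real.exp ((dG n v s lam q r).H t g x) ∂(tP n v r))
        ∂(Measure.pi fun i => gaussianReal 0 (vG n i)) with hG
  have hd := fun t => dG_deriv hn v s hl hq hr hne t
  have hle : ∀ t ∈ Set.Icc 0 (Real.pi / 2), (∫ g, lam * Real.sin t * Real.cos t *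
        (q * (gm (tP n v r) ((dG n v s lam q r).H t g) ⬝ᵥ
        gm (tP n v r) ((dG n v s lam q r).H t g)) -
        (∑ i, ∑ j, gT (tP n v r) ((dG n v s lam q r).H t g) i j ^ 2) / (2 * n))
        ∂(Measure.pi fun i => gaussianReal 0 (vG n i))) ≤
        lam * Real.sin t * Real.cos t * (n * q ^ 2 / 2) := by
    intro t ht
    have hs0 : 0 ≤ Real.sin t := Real.sin_nonneg_of_nonneg_of_le_pi ht.1 (by linarith [ht.2, Real.pi_pos])
    have hc0 : 0 ≤ Real.cos t := Real.cos_nonneg_of_neg_pi_div_two_le_of_le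
      (by linarith [ht.1, Real.pi_pos]) ht.2
    by_cases hi : Integrable (fun g => lam * Real.sin t * Real.cos t *
        (q * (gm (tP n v r) ((dG n v s lam q r).H t g) ⬝ᵥ
        gm (tP n v r) ((dG n v s lam q r).H t g)) -
        (∑ i, ∑ j, gT (tP n v r) ((dG n v s lam q r).H t g) i j ^ 2) / (2 * n)))
        (Measure.pi fun i => gaussianReal 0 (vG n i))
    · calc _ ≤ ∫ g, lam * Real.sin t * Real.cos t * (n * q ^ 2 / 2)
          ∂(Measure.pi fun i => gaussianReal 0 (vG n i)) := by
            refine integral_mono hi (integrable_const _) fun g => ?_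
            refine mul_le_mul_of_nonneg_left ?_ (by positivity)
            have := frob_ge (tP n v r) ((dG n v s lam q r).H t g)
              (dG_intZ hn v s hl hq hr hne t g) (dG_Zpos hn v s hl hq hr hne t g)
              (dG_intx hn v s hl hq hr hne t g) (dG_intxx hn v s hl hq hr hne t g)
            set m := gm (tP n v r) ((dG n v s lam q r).H t g) ⬝ᵥ
              gm (tP n v r) ((dG n v s lam q r).H t g)
            have h2 : q * m - m ^ 2 / (2 * n) ≤ n * q ^ 2 / 2 := by
              have : n * q ^ 2 / 2 - (q * m - m ^ 2 / (2 * n)) = (n * q - m) ^ 2 / (2 * n) := by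
                field_simp; ring
              have : 0 ≤ (n * q - m) ^ 2 / (2 * n) := by positivity
              linarith
            have h3 : m ^ 2 / (2 * n) ≤
              (∑ i, ∑ j, gT (tP n v r) ((dG n v s lam q r).H t g) i j ^ 2) / (2 * n) := by gcongr
            linarith
        _ = _ := by simp
    · rw [integral_undef hi]; positivity
  have hanti : AntitoneOn (fun t => G t - lam * n * q ^ 2 / 4 * Real.sin t ^ 2)
      (Set.Icc 0 (Real.pi / 2)) := by
    have hder : ∀ t, HasDerivAt (fun t => G t - lam * n * q ^ 2 / 4 * Real.sin t ^ 2) _ t :=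
      fun t => (hd t).fun_sub (((Real.hasDerivAt_sin t).fun_pow 2).const_mul (lam * n * q ^ 2 / 4))
    refine antitoneOn_of_deriv_nonpos (convex_Icc _ _)
      (fun t _ => (hder t).continuousAt.continuousWithinAt)
      (fun t _ => (hder t).differentiableAt.differentiableWithinAt) fun t ht => ?_
    rw [(hder t).deriv]
    have := hle t (interior_subset ht)
    simp only [Nat.cast_ofNat, Nat.add_one_sub_one, pow_one]
    linarith
  have := hanti (Set.left_mem_Icc.2 (by positivity)) (Set.right_mem_Icc.2 (by positivity))
    (by positivity : (0:ℝ) ≤ Real.pi / 2)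
  simp only [Real.sin_pi_div_two, Real.sin_zero] at this
  linarith

end

lemma integral_lin3 {X : Type*} [MeasurableSpace X] (μ : Measure X) [IsProbabilityMeasure μ]
    (f h : X → ℝ) (hf : Integrable f μ) (hh : Integrable h μ) (c0 c1 c2 : ℝ) :
    ∫ x, (c0 + c1 * f x + c2 * h x) ∂μ = c0 + c1 * ∫ x, f x ∂μ + c2 * ∫ x, h x ∂μ := by
  have i0 : Integrable (fun _ : X => c0) μ := integrable_const _
  have i1 : Integrable (fun x => c1 * f x) μ := hf.const_mul _
  have i2 : Integrable (fun x => c2 * h x) μ := hh.const_mul _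
  have i3 : Integrable (fun x => c0 + c1 * f x) μ := i0.add i1
  rw [integral_add i3 i2, integral_add i0 i1, integral_const_mul, integral_const_mul]
  simp

lemma vG_fst (n : ℕ) : MeasurePreserving (fun (g : (Fin n × Fin n) ⊕ Fin n → ℝ) p => g (Sum.inl p))
    (Measure.pi fun i => gaussianReal 0 (vG n i)) (gpi n) := by
  have h := measurePreserving_sumPiEquivProdPi (fun i => gaussianReal 0 (vG n i))
  exact measurePreserving_fst.comp h

lemma vG_snd (n : ℕ) : MeasurePreserving (fun (g : (Fin n × Fin n) ⊕ Fin n → ℝ) p => g (Sum.inr p))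
    (Measure.pi fun i => gaussianReal 0 (vG n i)) (gaussPrior n 1) := by
  have h := measurePreserving_sumPiEquivProdPi (fun i => gaussianReal 0 (vG n i))
  have e : gaussPrior n 1 = Measure.pi (fun i : Fin n => gaussianReal 0 (vG n (Sum.inr i))) := by
    simp [gaussPrior, vG]
  rw [e]
  exact measurePreserving_snd.comp h

lemma tP_ne (n : ℕ) (v r : ℝ) (hv : 0 < v) (hr : n * v < r) : tP n v r ≠ 0 := by
  intro h0
  have h1 : ∀ᵐ x ∂gaussPrior n v, r ≤ x ⬝ᵥ x := by
    have : (gaussPrior n v) (ballu n r) = 0 := by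
      rwa [tP, Measure.restrict_eq_zero] at h0
    filter_upwards [measure_eq_zero_iff_ae_notMem.1 this] with x hx
    exact (not_le.1 hx).le
  have h2 := integral_mono_ae (integrable_const r) (int_dot n v) h1
  rw [mom_dot n v hv] at h2
  simp at h2
  linarith

lemma mom_lin (n : ℕ) (v : ℝ) (hv : 0 < v) (s : Fin n → ℝ) :
    ∫ g, (s ⬝ᵥ g) ^ 2 ∂gaussPrior n v = v * (s ⬝ᵥ s) := by
  have hc : ((Real.toNNReal v : NNReal) : ℝ) = v := Real.coe_toNNReal v hv.le
  have hG : ExpGr (fun g : Fin n → ℝ => s ⬝ᵥ g) := by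
    unfold dotProduct
    exact ExpGr.sum _ fun i _ => (ExpGr.coord i).const_mul _
  have h1 : ∀ k : Fin n, ∫ g, g k * (s ⬝ᵥ g) ∂gaussPrior n v = v * s k := by
    intro k
    have := stein_gr (fun _ : Fin n => Real.toNNReal v) (fun _ => toNNReal_ne hv) k
      (fun g => s ⬝ᵥ g) (fun _ => s k) ?_ (by fun_prop) (by fun_prop) hG (ExpGr.const _)
    · rw [gaussPrior, this, hc]; simp
    · intro g
      have : (fun y => s ⬝ᵥ Function.update g k y) = fun y => s k * y + ∑ i ∈ Finset.univ.erase k, s i * g i := by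
        funext y
        rw [dotProduct, ← Finset.add_sum_erase _ _ (Finset.mem_univ k)]
        simp only [Function.update_self]
        congr 1
        apply Finset.sum_congr rfl
        intro i hi
        rw [Function.update_of_ne (Finset.ne_of_mem_erase hi)]
      rw [this]
      simpa using ((hasDerivAt_id (g k)).const_mul (s k)).add_const (∑ i ∈ Finset.univ.erase k, s i * g i)
  have e : (fun g : Fin n → ℝ => (s ⬝ᵥ g) ^ 2) = fun g => ∑ k, s k * (g k * (s ⬝ᵥ g)) := by
    funext g
    rw [sq]
    conv_lhs => enter [1]; unfold dotProduct
    rw [Finset.sum_mul]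
    simp only [mul_assoc]
  rw [e, integral_finsetSum]
  · simp only [integral_const_mul, h1]
    unfold dotProduct
    rw [Finset.mul_sum]
    apply Finset.sum_congr rfl; intro i _; ring
  · intro k _
    refine Integrable.const_mul ?_ _
    exact ((ExpGr.coord k).mul hG).integrable _ (by
      have : Measurable (fun g : Fin n → ℝ => g k * (s ⬝ᵥ g)) := by fun_prop
      exact this.aestronglyMeasurable)

lemma int_lin2 (n : ℕ) (v : ℝ) (s : Fin n → ℝ) :
    Integrable (fun g => (s ⬝ᵥ g) ^ 2) (gaussPrior n v) := by
  have hG : ExpGr (fun g : Fin n → ℝ => s ⬝ᵥ g) := by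
    unfold dotProduct
    exact ExpGr.sum _ fun i _ => (ExpGr.coord i).const_mul _
  exact (hG.pow 2).integrable _ (by
      have : Measurable (fun g : Fin n → ℝ => (s ⬝ᵥ g) ^ 2) := by fun_prop
      exact this.aestronglyMeasurable)

lemma dG_H_half (n : ℕ) (v : ℝ) (s : Fin n → ℝ) (lam q r : ℝ) (g x) :
    (dG n v s lam q r).H (Real.pi / 2) g x = Hs n s lam (fun p => g (Sum.inl p)) x := by
  simp [GD.H, dG, Hs, Fintype.sum_sum_type]
  ring

lemma dG_H_zero (n : ℕ) (v : ℝ) (s : Fin n → ℝ) (lam q r : ℝ) (g x) :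
    (dG n v s lam q r).H 0 g x = (Real.sqrt (lam * q) • (fun p => g (Sum.inr p))) ⬝ᵥ x
      - lam * q * (x ⬝ᵥ x) / 2 + lam / n * (s ⬝ᵥ x) ^ 2 / 2 := by
  simp [GD.H, dG, Fintype.sum_sum_type, dotProduct]
  ring

lemma dG_intlog {n : ℕ} (hn : 1 ≤ n) (v : ℝ) (s : Fin n → ℝ) {lam q r : ℝ} (hl : 0 < lam)
    (hq : 0 ≤ q) (hr : 0 ≤ r) (hne : tP n v r ≠ 0) (t : ℝ) :
    Integrable (fun g => Real.log (∫ x, Real.exp ((dG n v s lam q r).H t g x) ∂(tP n v r)))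
      (Measure.pi fun i => gaussianReal 0 (vG n i)) := by
  obtain ⟨C, hC⟩ := dG_good n hn v s lam q r hl hq hr hne t
  exact hC.H3.integrable _ (hC.mZ t).log.aestronglyMeasurable

lemma mlZr (n : ℕ) (v r : ℝ) (s : Fin n → ℝ) (lam : ℝ) :
    Measurable fun g => Real.log (∫ x, Real.exp (Hs n s lam g x) ∂(tP n v r)) := by
  have : StronglyMeasurable (fun g => ∫ x, Real.exp (Hs n s lam g x) ∂(tP n v r)) := by
    refine StronglyMeasurable.integral_prod_right (f := fun (g : Fin n × Fin n → ℝ) (x : Fin n → ℝ) => Real.exp (Hs n s lam g x)) ?_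
    have := (measurable_Hs n lam).comp (f := fun p : (Fin n × Fin n → ℝ) × (Fin n → ℝ) => ((s, p.1), p.2)) (by fun_prop)
    exact this.exp.stronglyMeasurable
  exact this.measurable.log

lemma int_lZr {n : ℕ} (hn : 1 ≤ n) (v : ℝ) (s : Fin n → ℝ) {lam r : ℝ} (hl : 0 < lam)
    (hr : 0 ≤ r) (hne : tP n v r ≠ 0) :
    Integrable (fun g => Real.log (∫ x, Real.exp (Hs n s lam g x) ∂(tP n v r))) (gpi n) := by
  have h := dG_intlog hn v s hl le_rfl hr hne (Real.pi / 2)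
  simp only [dG_H_half] at h
  rw [← (vG_fst n).map_eq, integrable_map_measure (mlZr n v r s lam).aestronglyMeasurable
    (vG_fst n).measurable.aemeasurable]
  exact h

/-- upper bound for the truncated system -/
lemma upper_tr (n : ℕ) (hn : 1 ≤ n) (v : ℝ) (hv : 0 < v) (s : Fin n → ℝ) (lam q r : ℝ)
    (hl : 0 < lam) (hq : 0 ≤ q) (hr : n * v < r)
    (h2 : lam / n * v * (s ⬝ᵥ s) / (1 + v * (lam * q)) < 1) :
    ∫ g, Real.log (∫ x, Real.exp (Hs n s lam g x) ∂(tP n v r)) ∂gpi n ≤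
      n * lam * q ^ 2 / 4 + (-(n / 2 * Real.log (1 + v * (lam * q))) +
        n * v * lam * q / (2 * (1 + v * (lam * q))) -
        1 / 2 * Real.log (1 - lam / n * v * (s ⬝ᵥ s) / (1 + v * (lam * q))) +
        lam / n * (v / (1 + v * (lam * q))) ^ 2 * (lam * q) * (s ⬝ᵥ s) /
          (2 * (1 - lam / n * v * (s ⬝ᵥ s) / (1 + v * (lam * q))))) := by
  have hn' : (0:ℝ) < n := by exact_mod_cast hn
  have hr0 : 0 ≤ r := le_trans (by positivity) hr.le
  have hne := tP_ne n v r hv hr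
  have hG := dG_guerra hn v s hl hq hr0 hne
  have hD : 0 < 1 + v * (lam * q) := by positivity
  set D := 1 + v * (lam * q) with hDd
  set κ := lam / n * v * (s ⬝ᵥ s) / D with hκ
  have hκ' : 0 < 1 - κ := by linarith
  -- left side
  have hm : Measurable fun g => Real.log (∫ x, Real.exp (Hs n s lam g x) ∂(tP n v r)) := by
    have : StronglyMeasurable (fun g => ∫ x, Real.exp (Hs n s lam g x) ∂(tP n v r)) := by
      refine StronglyMeasurable.integral_prod_right (f := fun (g : Fin n × Fin n → ℝ) (x : Fin n → ℝ) => Real.exp (Hs n s lam g x)) ?_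
      have := (measurable_Hs n lam).comp (f := fun p : (Fin n × Fin n → ℝ) × (Fin n → ℝ) => ((s, p.1), p.2)) (by fun_prop)
      exact this.exp.stronglyMeasurable
    exact this.measurable.log
  have hL : ∫ g, Real.log (∫ x, Real.exp (Hs n s lam g x) ∂(tP n v r)) ∂gpi n =
      ∫ g, Real.log (∫ x, Real.exp ((dG n v s lam q r).H (Real.pi / 2) g x) ∂(tP n v r))
        ∂(Measure.pi fun i => gaussianReal 0 (vG n i)) := by
    simp only [dG_H_half]
    rw [← (vG_fst n).map_eq, integral_map (vG_fst n).measurable.aemeasurable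
      hm.aestronglyMeasurable]
  rw [hL]
  refine hG.trans ?_
  rw [add_comm]
  refine add_le_add le_rfl ?_
  -- pointwise bound
  let Φ : (Fin n → ℝ) → ℝ := fun b => -(n / 2 * Real.log D) + v * lam * q / (2 * D) * (b ⬝ᵥ b)
    - 1 / 2 * Real.log (1 - κ) + lam / n * (v / D) ^ 2 * (lam * q) / (2 * (1 - κ)) * (s ⬝ᵥ b) ^ 2
  have hpt : ∀ g, Real.log (∫ x, Real.exp ((dG n v s lam q r).H 0 g x) ∂(tP n v r)) ≤
      Φ (fun p => g (Sum.inr p)) := by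
    intro g
    set b : Fin n → ℝ := fun p => g (Sum.inr p) with hb
    obtain ⟨i1, i2⟩ := gauss_spike n v hv (Real.sqrt (lam * q) • b) s (lam * q) (lam / n) hD
      (by positivity) h2
    have hpos := dG_Zpos hn v s hl hq hr0 hne 0 g
    have hle : ∫ x, Real.exp ((dG n v s lam q r).H 0 g x) ∂(tP n v r) ≤
        ∫ x, Real.exp ((Real.sqrt (lam * q) • b) ⬝ᵥ x
          - lam * q * (x ⬝ᵥ x) / 2 + lam / n * (s ⬝ᵥ x) ^ 2 / 2) ∂gaussPrior n v := by
      simp only [dG_H_zero]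
      exact setIntegral_le_integral i1 (Eventually.of_forall fun x => (Real.exp_pos _).le)
    refine (Real.log_le_log hpos hle).trans (le_of_eq ?_)
    rw [i2, ← hDd, ← hκ]
    have hsD : 0 < Real.sqrt D := Real.sqrt_pos.2 hD
    have hsk : 0 < Real.sqrt (1 - κ) := Real.sqrt_pos.2 hκ'
    rw [Real.log_mul (by positivity) (by positivity), Real.log_mul (by positivity) (by positivity),
      Real.log_mul (by positivity) (by positivity), Real.log_exp, Real.log_exp, Real.log_pow,
      Real.log_inv, Real.log_inv, Real.log_sqrt hD.le, Real.log_sqrt hκ'.le]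
    have hsq : Real.sqrt (lam * q) ^ 2 = lam * q := Real.sq_sqrt (by positivity)
    have e1 : (Real.sqrt (lam * q) • b) ⬝ᵥ (Real.sqrt (lam * q) • b) = lam * q * (b ⬝ᵥ b) := by
      rw [smul_dotProduct, dotProduct_smul, smul_eq_mul, smul_eq_mul, ← mul_assoc, ← sq, hsq]
    have e2 : lam / n * (v * (s ⬝ᵥ (Real.sqrt (lam * q) • b)) / D) ^ 2 = lam / n * (v / D) ^ 2 * (lam * q)
        * (s ⬝ᵥ b) ^ 2 := by
      rw [dotProduct_smul, smul_eq_mul, ← hsq]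
      simp only [Real.sqrt_sq_eq_abs, abs_of_nonneg (Real.sqrt_nonneg (lam * q))]
      ring
    rw [e1, e2]
    simp only [Φ]
    clear_value κ D
    have := hκ'.ne'
    field_simp
    ring
  have j1 := int_dot n 1
  have j2 := int_lin2 n 1 s
  have iΦ : Integrable Φ (gaussPrior n 1) :=
    (((integrable_const _).add (j1.const_mul _)).sub (integrable_const _)).add (j2.const_mul _)
  have hval : ∫ b, Φ b ∂gaussPrior n 1 = -(n / 2 * Real.log D) +
        n * v * lam * q / (2 * D) - 1 / 2 * Real.log (1 - κ) +
        lam / n * (v / D) ^ 2 * (lam * q) * (s ⬝ᵥ s) / (2 * (1 - κ)) := by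
    have e : Φ = fun b => (-(n / 2 * Real.log D) - 1 / 2 * Real.log (1 - κ)) +
        v * lam * q / (2 * D) * (b ⬝ᵥ b) +
        lam / n * (v / D) ^ 2 * (lam * q) / (2 * (1 - κ)) * (s ⬝ᵥ b) ^ 2 := by
      funext b; simp only [Φ]; ring
    rw [e, integral_lin3 _ _ _ j1 j2, mom_dot n 1 one_pos, mom_lin n 1 one_pos]
    ring
  rw [← hval, ← (vG_snd n).map_eq, integral_map (vG_snd n).measurable.aemeasurable
      (by rw [(vG_snd n).map_eq]; exact iΦ.aestronglyMeasurable)]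
  have iΦ' : Integrable (fun g : (Fin n × Fin n) ⊕ Fin n → ℝ => Φ (fun p => g (Sum.inr p)))
      (Measure.pi fun i => gaussianReal 0 (vG n i)) := (vG_snd n).integrable_comp_of_integrable iΦ
  exact integral_mono (dG_intlog hn v s hl hq hr0 hne 0) iΦ' hpt

lemma upper_full (n : ℕ) (hn : 1 ≤ n) (v : ℝ) (hv : 0 < v) (s : Fin n → ℝ) (lam q : ℝ)
    (hl : 0 < lam) (hq : 0 ≤ q)
    (h2 : lam / n * v * (s ⬝ᵥ s) / (1 + v * (lam * q)) < 1)
    (hintg : Integrable (fun g => lZ n v s lam g) (gpi n)) :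
    ∫ g, lZ n v s lam g ∂gpi n ≤
      n * lam * q ^ 2 / 4 + (-(n / 2 * Real.log (1 + v * (lam * q))) +
        n * v * lam * q / (2 * (1 + v * (lam * q))) -
        1 / 2 * Real.log (1 - lam / n * v * (s ⬝ᵥ s) / (1 + v * (lam * q))) +
        lam / n * (v / (1 + v * (lam * q))) ^ 2 * (lam * q) * (s ⬝ᵥ s) /
          (2 * (1 - lam / n * v * (s ⬝ᵥ s) / (1 + v * (lam * q))))) := by
  have hn' : (0:ℝ) < n := by exact_mod_cast hn
  set r0 : ℝ := n * v + 1 with hr0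
  have hr0p : 0 ≤ r0 := by positivity
  have hrk : ∀ k : ℕ, n * v < r0 + k := fun k => by
    have : (0:ℝ) ≤ k := by positivity
    linarith
  have hne := fun k => tP_ne n v _ hv (hrk k)
  have hposr : ∀ g (k : ℕ), 0 < ∫ x, Real.exp (Hs n s lam g x) ∂(tP n v (r0 + k)) := by
    intro g k
    have := dG_Zpos hn v s hl le_rfl (by positivity) (hne k) (Real.pi / 2) (Sum.elim g 0)
    simpa only [dG_H_half, Sum.elim_inl] using this
  have hmono : ∀ g (k : ℕ), ∫ x, Real.exp (Hs n s lam g x) ∂(tP n v (r0 + k)) ≤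
      ∫ x, Real.exp (Hs n s lam g x) ∂gaussPrior n v := fun g k =>
    setIntegral_le_integral (int_e hn v s hl g) (Eventually.of_forall fun x => (Real.exp_pos _).le)
  have hmono0 : ∀ g (k : ℕ), ∫ x, Real.exp (Hs n s lam g x) ∂(tP n v (r0 + (0:ℕ))) ≤
      ∫ x, Real.exp (Hs n s lam g x) ∂(tP n v (r0 + k)) := fun g k =>
    setIntegral_mono_set (int_e hn v s hl g).integrableOn
      (Eventually.of_forall fun x => (Real.exp_pos _).le)
      (LE.le.eventuallyLE fun x (hx : x ⬝ᵥ x ≤ _) => by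
        have : (0:ℝ) ≤ k := by positivity
        change x ⬝ᵥ x ≤ _
        push_cast at hx; linarith)
  have hlim : Tendsto (fun k : ℕ => ∫ g, Real.log (∫ x, Real.exp (Hs n s lam g x) ∂(tP n v (r0 + k))) ∂gpi n)
      atTop (nhds (∫ g, lZ n v s lam g ∂gpi n)) := by
    refine tendsto_integral_of_dominated_convergence (fun g => |lZ n v s lam g| +
      |Real.log (∫ x, Real.exp (Hs n s lam g x) ∂(tP n v (r0 + (0:ℕ))))|)
      (fun k => (mlZr n v _ s lam).aestronglyMeasurable)
      (hintg.abs.add (int_lZr hn v s hl (by positivity) (hne 0)).abs) ?_ ?_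
    · intro k
      refine Eventually.of_forall fun g => ?_
      have a1 := Real.log_le_log (hposr g k) (hmono g k)
      have a2 := Real.log_le_log (hposr g 0) (hmono0 g k)
      change _ ≤ lZ n v s lam g at a1
      rw [Real.norm_eq_abs, abs_le]
      constructor
      · linarith [neg_abs_le (Real.log (∫ x, Real.exp (Hs n s lam g x) ∂(tP n v (r0 + (0:ℕ))))),
          abs_nonneg (lZ n v s lam g)]
      · linarith [abs_nonneg (Real.log (∫ x, Real.exp (Hs n s lam g x) ∂(tP n v (r0 + (0:ℕ))))),
          le_abs_self (lZ n v s lam g)]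
    · refine Eventually.of_forall fun g => ?_
      refine (Real.continuousAt_log (Z_pos hn v s hl g).ne').tendsto.comp ?_
      have hU : (⋃ k : ℕ, ballu n (r0 + k)) = Set.univ := by
        ext x
        simp only [Set.mem_iUnion, Set.mem_univ, iff_true]
        obtain ⟨k, hk⟩ := exists_nat_ge (x ⬝ᵥ x)
        exact ⟨k, by change x ⬝ᵥ x ≤ _; linarith⟩
      have := tendsto_setIntegral_of_monotone (μ := gaussPrior n v) (s := fun k : ℕ => ballu n (r0 + k))
        (f := fun x => Real.exp (Hs n s lam g x)) (fun k => measurableSet_ballu n _)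
        (fun i j hij x (hx : x ⬝ᵥ x ≤ _) => by
          have : (i:ℝ) ≤ j := by exact_mod_cast hij
          change x ⬝ᵥ x ≤ _; linarith) (int_e hn v s hl g).integrableOn
      rw [hU, setIntegral_univ] at this
      exact this
  exact le_of_tendsto' hlim fun k => upper_tr n hn v hv s lam q _ hl hq (hrk k) h2

/-- replica symmetric potential -/
def fU (lam v q : ℝ) : ℝ := lam * q ^ 2 / 4 + v * (lam * q) / (2 * (1 + v * (lam * q))) -
  1 / 2 * Real.log (1 + v * (lam * q))

lemma aux_t4 (a b D D0 w : ℝ) (hD : D = 1 + a) (hD0 : D0 = 1 + b) (hw : D - D0 = w) (h1 : 1 ≤ D0)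
    (h2 : 1 ≤ D) (h3 : 0 ≤ w) : a / D ≤ b / D0 + w := by
  have e1 : a / D = 1 - 1 / D := by field_simp; linarith
  have e2 : b / D0 = 1 - 1 / D0 := by field_simp; linarith
  rw [e1, e2]
  have : 1 / D0 - 1 / D ≤ w := by
    rw [div_sub_div _ _ (by positivity) (by positivity), div_le_iff₀ (by positivity)]
    have : 1 ≤ D0 * D := by nlinarith
    nlinarith
  linarith

set_option maxHeartbeats 1000000 in
lemma upper_s (n : ℕ) (hn : 1 ≤ n) (v vs : ℝ) (hv : 0 < v) (s : Fin n → ℝ) (lam q0 δ : ℝ)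
    (hl : 0 < lam) (hq : 0 ≤ q0) (hδ : 0 < δ) (hδ' : δ = 1 + v * (lam * q0) - v * lam * vs)
    (hintg : Integrable (fun g => lZ n v s lam g) (gpi n)) :
    1 / n * ∫ g, lZ n v s lam g ∂gpi n ≤
      fU lam v q0 + (lam * q0 / 2 + v * lam / 2 + v * lam / δ) / 2 * (Real.sqrt n)⁻¹ +
      (1 + v * (lam * q0)) / δ * (1 / n) + (lam / 4 +
        (lam * q0 / 2 + v * lam / 2 + v * lam / δ) / 2 * Real.sqrt n) *
        ((s ⬝ᵥ s) / n - vs) ^ 2 := by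
  have hn' : (0:ℝ) < n := by exact_mod_cast hn
  have hn1 : (1:ℝ) ≤ n := by exact_mod_cast hn
  set S := (s ⬝ᵥ s) / n with hS
  have hss : s ⬝ᵥ s = n * S := by rw [hS]; field_simp
  have hS0 : 0 ≤ S := div_nonneg (dot_self_nonneg s) hn'.le
  set r := max (S - vs) 0 with hr
  have hr0 : 0 ≤ r := le_max_right _ _
  have hr1 : S - vs ≤ r := le_max_left _ _
  have hr2 : r ^ 2 ≤ (S - vs) ^ 2 := by
    rcases le_total (S - vs) 0 with h | h
    · rw [hr, max_eq_right h]; nlinarith [sq_nonneg (S - vs)]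
    · rw [hr, max_eq_left h]
  set q := q0 + r with hqq
  have hq' : 0 ≤ q := by positivity
  set D := 1 + v * (lam * q) with hD
  set D0 := 1 + v * (lam * q0) with hD0
  have hvl : 0 < v * lam := by positivity
  have hDD : D = D0 + v * lam * r := by rw [hD, hD0, hqq]; ring
  have hD01 : 1 ≤ D0 := by have : 0 ≤ v * (lam * q0) := by positivity
                           linarith
  have hD1 : 1 ≤ D := by rw [hDD]; nlinarith
  have hDS : δ ≤ D - v * lam * S := by
    rw [hδ', hDD]; nlinarith
  have hκe : lam / n * v * (s ⬝ᵥ s) / D = v * lam * S / D := by rw [hss]; field_simp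
  have h1κ : 1 - v * lam * S / D = (D - v * lam * S) / D := by field_simp
  have hDp : 0 < D := by linarith
  have hκ : δ / D ≤ 1 - v * lam * S / D := by rw [h1κ]; gcongr
  have hκ0 : 0 < δ / D := by positivity
  have hu := upper_full n hn v hv s lam q hl hq' (by rw [← hD, hκe]; linarith) hintg
  rw [← hD, hκe] at hu
  have t1 : -(1 / 2 * Real.log (1 - v * lam * S / D)) ≤ D / (2 * δ) := by
    have a := Real.log_le_log hκ0 hκ
    have b : Real.log (δ / D) = - Real.log (D / δ) := by rw [← Real.log_inv, inv_div]
    have c := Real.log_le_sub_one_of_pos (show 0 < D / δ by positivity)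
    have : D / (2 * δ) = 1 / 2 * (D / δ) := by field_simp
    linarith
  have t2 : lam / n * (v / D) ^ 2 * (lam * q) * (s ⬝ᵥ s) / (2 * (1 - v * lam * S / D)) ≤ D / (2 * δ) := by
    rw [div_le_iff₀ (by linarith)]
    have e : lam / n * (v / D) ^ 2 * (lam * q) * (s ⬝ᵥ s) = (v * lam * S / D) * (v * (lam * q) / D) := by
      rw [hss]; field_simp
    rw [e]
    have x1 : v * lam * S / D ≤ 1 := by linarith
    have x2 : v * (lam * q) / D ≤ 1 := by rw [div_le_one hDp]; linarith
    have x3 : 0 ≤ v * (lam * q) / D := by positivity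
    have x4 : 1 ≤ D / (2 * δ) * (2 * (1 - v * lam * S / D)) := by
      calc 1 = D / (2 * δ) * (2 * (δ / D)) := by field_simp
        _ ≤ _ := by gcongr
    nlinarith
  have t3 : Real.log D0 ≤ Real.log D := Real.log_le_log (by linarith) (by rw [hDD]; nlinarith)
  have t4 : v * (lam * q) / D ≤ v * (lam * q0) / D0 + v * lam * r :=
    aux_t4 _ _ _ _ _ hD hD0 (by rw [hDD]; ring) hD01 hD1 (by positivity)
  have key : 1 / n * ∫ g, lZ n v s lam g ∂gpi n ≤ lam * q ^ 2 / 4 - 1 / 2 * Real.log D +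
      v * (lam * q) / D / 2 + D / δ * (1 / n) := by
    rw [one_div, inv_mul_le_iff₀ hn']
    refine hu.trans ?_
    have : n * (lam * q ^ 2 / 4 - 1 / 2 * Real.log D +
      v * (lam * q) / D / 2 + D / δ * (1 / n)) = n * lam * q ^ 2 / 4 + (-(n / 2 * Real.log D) +
        n * v * lam * q / (2 * D)) + (D / (2 * δ) + D / (2 * δ)) := by field_simp; ring
    rw [← one_div, this]
    linarith
  have rr : r ≤ 1 / 2 * (Real.sqrt n)⁻¹ + 1 / 2 * Real.sqrt n * (S - vs) ^ 2 := by
    have hs : 0 < Real.sqrt n := Real.sqrt_pos.2 hn'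
    have : r ≤ 1 / 2 * (Real.sqrt n)⁻¹ + 1 / 2 * Real.sqrt n * r ^ 2 := by
      have : 1 / 2 * (Real.sqrt n)⁻¹ + 1 / 2 * Real.sqrt n * r ^ 2 - r =
        1 / 2 * (Real.sqrt n)⁻¹ * (1 - Real.sqrt n * r) ^ 2 := by field_simp; ring
      have : 0 ≤ 1 / 2 * (Real.sqrt n)⁻¹ * (1 - Real.sqrt n * r) ^ 2 := by positivity
      linarith
    refine this.trans ?_
    gcongr
  have fin : D / δ * (1 / n) ≤ D0 / δ * (1 / n) + v * lam / δ * r := by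
    have : D / δ * (1 / n) = D0 / δ * (1 / n) + v * lam / δ * r * (1 / n) := by rw [hDD]; ring
    rw [this]
    have h1 : (1:ℝ) / n ≤ 1 := by rw [div_le_one hn']; exact hn1
    have : 0 ≤ v * lam / δ * r := by positivity
    nlinarith
  have hfU : fU lam v q0 = lam * q0 ^ 2 / 4 + v * (lam * q0) / D0 / 2 - 1 / 2 * Real.log D0 := by
    unfold fU; rw [← hD0]; field_simp
  set Cs := lam * q0 / 2 + v * lam / 2 + v * lam / δ with hCs
  have hCs0 : 0 ≤ Cs := by positivity
  have rr' := mul_le_mul_of_nonneg_left rr hCs0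
  have r2' := mul_le_mul_of_nonneg_left hr2 (show 0 ≤ lam / 4 by positivity)
  have e5 : lam * q ^ 2 / 4 = lam * q0 ^ 2 / 4 + lam * q0 / 2 * r + lam / 4 * r ^ 2 := by
    rw [hqq]; ring
  have e6 : Cs * r = lam * q0 / 2 * r + v * lam / 2 * r + v * lam / δ * r := by rw [hCs]; ring
  rw [hfU]
  linarith

lemma upper_n (n : ℕ) (hn : 1 ≤ n) (v vs : ℝ) (hv : 0 < v) (hvs : 0 < vs) (lam q0 δ : ℝ)
    (hl : 0 < lam) (hq : 0 ≤ q0) (hδ : 0 < δ) (hδ' : δ = 1 + v * (lam * q0) - v * lam * vs) :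
    Fn n vs v lam ≤
      fU lam v q0 + (lam * q0 / 2 + v * lam / 2 + v * lam / δ) / 2 * (Real.sqrt n)⁻¹ +
      (1 + v * (lam * q0)) / δ * (1 / n) + (lam / 4 +
        (lam * q0 / 2 + v * lam / 2 + v * lam / δ) / 2 * Real.sqrt n) * (2 * vs ^ 2 / n) := by
  have hi := int_lZ n hn vs v lam hl
  have ae := hi.prod_right_ae
  have hii := hi.integral_prod_left
  have iv : Integrable (fun s : Fin n → ℝ => ((s ⬝ᵥ s) / n - vs) ^ 2) (gaussPrior n vs) := by
    have a := int_dot n vs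
    have b := int_dot_pow n vs 2
    have e : (fun s : Fin n → ℝ => ((s ⬝ᵥ s) / n - vs) ^ 2) = fun s =>
      1 / (n:ℝ) ^ 2 * (s ⬝ᵥ s) ^ 2 - 2 * vs / n * (s ⬝ᵥ s) + vs ^ 2 := by
      funext s
      have hn' : (0:ℝ) < n := by exact_mod_cast hn
      field_simp; ring
    rw [e]
    exact ((b.const_mul _).sub (a.const_mul _)).add (integrable_const _)
  unfold Fn
  rw [← integral_const_mul]
  set c0 := fU lam v q0 + (lam * q0 / 2 + v * lam / 2 + v * lam / δ) / 2 * (Real.sqrt n)⁻¹ +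
      (1 + v * (lam * q0)) / δ * (1 / n)
  set c1 := (lam / 4 + (lam * q0 / 2 + v * lam / 2 + v * lam / δ) / 2 * Real.sqrt n)
  have iv' : Integrable (fun s : Fin n → ℝ => c0 + c1 * ((s ⬝ᵥ s) / n - vs) ^ 2) (gaussPrior n vs) :=
    (integrable_const _).add (iv.const_mul _)
  refine (integral_mono_ae (hii.const_mul _) iv' ?_).trans ?_
  · filter_upwards [ae] with s hs
    exact upper_s n hn v vs hv s lam q0 δ hl hq hδ hδ' hs
  · apply le_of_eq
    rw [integral_add (integrable_const _) (iv.const_mul _), integral_const_mul, mom_var n hn vs hvs]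
    simp

lemma upper_lim (v vs : ℝ) (hv : 0 < v) (hvs : 0 < vs) (lam q0 : ℝ)
    (hl : 0 < lam) (hq : 0 ≤ q0) (hδ : 0 < 1 + v * (lam * q0) - v * lam * vs) (ε : ℝ) (hε : 0 < ε) :
    ∀ᶠ n : ℕ in atTop, Fn n vs v lam ≤ fU lam v q0 + ε := by
  set δ := 1 + v * (lam * q0) - v * lam * vs with hδ'
  set Cs := (lam * q0 / 2 + v * lam / 2 + v * lam / δ) / 2 with hCs
  have hw : Tendsto (fun n : ℕ => (Real.sqrt n)⁻¹) atTop (nhds 0) :=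
    (Real.tendsto_sqrt_atTop.comp tendsto_natCast_atTop_atTop).inv_tendsto_atTop
  have ht : Tendsto (fun n : ℕ => fU lam v q0 + Cs * (Real.sqrt n)⁻¹ + (1 + v * (lam * q0)) / δ *
      ((Real.sqrt n)⁻¹) ^ 2 + (lam / 4 * (2 * vs ^ 2) * ((Real.sqrt n)⁻¹) ^ 2 +
        Cs * (2 * vs ^ 2) * (Real.sqrt n)⁻¹)) atTop (nhds (fU lam v q0)) := by
    have c : Continuous (fun w : ℝ => fU lam v q0 + Cs * w + (1 + v * (lam * q0)) / δ *
      w ^ 2 + (lam / 4 * (2 * vs ^ 2) * w ^ 2 +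
        Cs * (2 * vs ^ 2) * w)) := by fun_prop
    have := (c.tendsto 0).comp hw
    have e0 : fU lam v q0 + Cs * 0 + (1 + v * (lam * q0)) / δ *
      0 ^ 2 + (lam / 4 * (2 * vs ^ 2) * 0 ^ 2 + Cs * (2 * vs ^ 2) * 0) = fU lam v q0 := by ring
    rw [e0] at this
    exact this
  filter_upwards [ht.eventually (gt_mem_nhds (show fU lam v q0 < fU lam v q0 + ε by linarith)),
    eventually_ge_atTop 1] with n h1 h2
  refine (upper_n n h2 v vs hv hvs lam q0 δ hl hq hδ hδ').trans (le_trans (le_of_eq ?_) h1.le)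
  have hn' : (0:ℝ) < n := by exact_mod_cast h2
  have hs : 0 < Real.sqrt n := Real.sqrt_pos.2 hn'
  have e : ((Real.sqrt n)⁻¹) ^ 2 = 1 / n := by rw [inv_pow, Real.sq_sqrt hn'.le, one_div]
  have e2 : Real.sqrt n * (1 / n) = (Real.sqrt n)⁻¹ := by rw [← e]; field_simp
  rw [← hCs, e, ← e2]
  ring

lemma two_jensen {n : ℕ} (ν : Measure (Fin n → ℝ)) [IsFiniteMeasure ν] (H : (Fin n → ℝ) → ℝ) (θ : ℝ)
    (hZ : Integrable (fun x => Real.exp (H x)) ν) (hp : 0 < ∫ x, Real.exp (H x) ∂ν)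
    (hI : ∀ i j, Integrable (fun x => (x i * x j) * Real.exp (H x)) ν)
    (hA : Integrable (fun p : (Fin n → ℝ) × (Fin n → ℝ) =>
      Real.exp (H p.1 + H p.2 + θ * (p.1 ⬝ᵥ p.2) ^ 2)) (ν.prod ν)) :
    2 * Real.log (∫ x, Real.exp (H x) ∂ν) + θ * ∑ i, ∑ j, gT ν H i j ^ 2 ≤
      Real.log (∫ p, Real.exp (H p.1 + H p.2 + θ * (p.1 ⬝ᵥ p.2) ^ 2) ∂ν.prod ν) := by
  set Z := ∫ x, Real.exp (H x) ∂ν with hZd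
  set m := θ * ∑ i, ∑ j, gT ν H i j ^ 2 with hm
  have i1 : Integrable (fun p : (Fin n → ℝ) × (Fin n → ℝ) => Real.exp (H p.1) * Real.exp (H p.2))
    (ν.prod ν) := hZ.mul_prod hZ
  have i2 : ∀ i j, Integrable (fun p : (Fin n → ℝ) × (Fin n → ℝ) =>
      ((p.1 i * p.1 j) * Real.exp (H p.1)) * ((p.2 i * p.2 j) * Real.exp (H p.2)))
    (ν.prod ν) := fun i j => (hI i j).mul_prod (hI i j)
  have i3 : Integrable (fun p : (Fin n → ℝ) × (Fin n → ℝ) => ∑ i, ∑ j,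
      ((p.1 i * p.1 j) * Real.exp (H p.1)) * ((p.2 i * p.2 j) * Real.exp (H p.2)))
    (ν.prod ν) := integrable_finsetSum _ fun i _ => integrable_finsetSum _ fun j _ => i2 i j
  have v1 : ∫ p : (Fin n → ℝ) × (Fin n → ℝ), Real.exp (H p.1) * Real.exp (H p.2) ∂(ν.prod ν) = Z ^ 2 := by
    rw [integral_prod_mul (fun x => Real.exp (H x)) (fun x => Real.exp (H x)), sq]
  have v3 : ∫ p : (Fin n → ℝ) × (Fin n → ℝ), ∑ i, ∑ j,
      ((p.1 i * p.1 j) * Real.exp (H p.1)) * ((p.2 i * p.2 j) * Real.exp (H p.2)) ∂(ν.prod ν) =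
      Z ^ 2 * ∑ i, ∑ j, gT ν H i j ^ 2 := by
    rw [integral_finsetSum _ fun i _ => integrable_finsetSum _ fun j _ => i2 i j, Finset.mul_sum]
    apply Finset.sum_congr rfl; intro i _
    rw [integral_finsetSum _ fun j _ => i2 i j, Finset.mul_sum]
    apply Finset.sum_congr rfl; intro j _
    rw [integral_prod_mul (fun x : Fin n → ℝ => (x i * x j) * Real.exp (H x))
      (fun x : Fin n → ℝ => (x i * x j) * Real.exp (H x))]
    unfold gT gav
    rw [← hZd]
    field_simp
  have key : Real.exp m * Z ^ 2 ≤ ∫ p, Real.exp (H p.1 + H p.2 + θ * (p.1 ⬝ᵥ p.2) ^ 2) ∂ν.prod ν := by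
    have : Real.exp m * Z ^ 2 = ∫ p : (Fin n → ℝ) × (Fin n → ℝ), (Real.exp m * (1 - m) * (Real.exp (H p.1) * Real.exp (H p.2)) +
      Real.exp m * θ * ∑ i, ∑ j,
      ((p.1 i * p.1 j) * Real.exp (H p.1)) * ((p.2 i * p.2 j) * Real.exp (H p.2))) ∂ν.prod ν := by
      rw [integral_add (i1.const_mul _) (i3.const_mul _), integral_const_mul, integral_const_mul, v1, v3]
      rw [hm]; ring
    rw [this]
    refine integral_mono ((i1.const_mul _).add (i3.const_mul _)) hA fun p => ?_
    have e : ∑ i, ∑ j, ((p.1 i * p.1 j) * Real.exp (H p.1)) * ((p.2 i * p.2 j) * Real.exp (H p.2)) =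
        (p.1 ⬝ᵥ p.2) ^ 2 * (Real.exp (H p.1) * Real.exp (H p.2)) := by
      rw [← sum_mul_dot, Finset.sum_mul]
      apply Finset.sum_congr rfl; intro i _
      rw [Finset.sum_mul]
      apply Finset.sum_congr rfl; intro j _
      ring
    simp only [e]
    rw [Real.exp_add, Real.exp_add]
    have h1 := Real.add_one_le_exp (θ * (p.1 ⬝ᵥ p.2) ^ 2 - m)
    have h2 : Real.exp (θ * (p.1 ⬝ᵥ p.2) ^ 2) = Real.exp m * Real.exp (θ * (p.1 ⬝ᵥ p.2) ^ 2 - m) := by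
      rw [← Real.exp_add]; congr 1; ring
    rw [h2]
    have h3 : 0 < Real.exp (H p.1) * Real.exp (H p.2) * Real.exp m := by positivity
    have := mul_le_mul_of_nonneg_left h1 h3.le
    linarith
  have := Real.log_le_log (by positivity) key
  rw [Real.log_mul (by positivity) (by positivity), Real.log_exp, Real.log_pow] at this
  push_cast at this
  linarith

lemma gpi_mgf (n : ℕ) (b : Fin n × Fin n → ℝ) :
    Integrable (fun g => Real.exp (∑ p, b p * g p)) (gpi n) ∧
    ∫ g, Real.exp (∑ p, b p * g p) ∂gpi n = Real.exp (1 / 2 * ∑ p, nv p * (b p * b p)) := by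
  have hq := fun p => gauss_quad (nv p) (nv_ne p) (b p) 0 (by simp)
  simp only [zero_mul, zero_div, sub_zero, mul_zero, add_zero, Real.sqrt_one, inv_one, one_mul,
    mul_one] at hq
  simp only [Real.exp_sum]
  constructor
  · exact Integrable.fintype_prod fun p => (hq p).1
  · rw [gpi, integral_fintype_prod_eq_prod (fun p y => Real.exp (b p * y))]
    simp only [(hq _).2, ← Real.exp_sum]
    congr 1
    rw [Finset.mul_sum]
    apply Finset.sum_congr rfl; intro p _; ring

lemma vG_mgf (n : ℕ) (b : Fin n × Fin n → ℝ) :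
    Integrable (fun g => Real.exp (∑ p, b p * g (Sum.inl p))) (Measure.pi fun i => gaussianReal 0 (vG n i)) ∧
    ∫ g, Real.exp (∑ p, b p * g (Sum.inl p)) ∂(Measure.pi fun i => gaussianReal 0 (vG n i))
      = Real.exp (1 / 2 * ∑ p, nv p * (b p * b p)) := by
  obtain ⟨h1, h2⟩ := gpi_mgf n b
  refine ⟨(vG_fst n).integrable_comp_of_integrable h1, ?_⟩
  rw [← h2, ← (vG_fst n).map_eq, integral_map (vG_fst n).measurable.aemeasurable]
  rw [(vG_fst n).map_eq]; exact h1.aestronglyMeasurable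

lemma dG0_H (n : ℕ) (v lam r t : ℝ) (g x) :
    (dG n v 0 lam 0 r).H t g x = ∑ p, (Real.sqrt (lam / n) * Real.sin t * qf p x) * g (Sum.inl p) -
      Real.sin t ^ 2 * (lam / (4 * n) * (x ⬝ᵥ x) ^ 2) := by
  simp [GD.H, dG, Fintype.sum_sum_type, sub_eq_add_neg, mul_right_comm]

section
variable {n : ℕ} (hn : 1 ≤ n) {v lam ρ η : ℝ} (hv : 0 < v) (hl : 0 < lam) (hρ : v < ρ) (hη : 0 < η)
  (h1 : (lam + η) * v * ρ < 1) (t : ℝ)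
include hn hv hl hρ hη h1

lemma dG0_annealed :
    Integrable (fun z : ((Fin n × Fin n) ⊕ Fin n → ℝ) × ((Fin n → ℝ) × (Fin n → ℝ)) =>
      Real.exp ((dG n v 0 lam 0 (n * ρ)).H t z.1 z.2.1 + (dG n v 0 lam 0 (n * ρ)).H t z.1 z.2.2 +
        η / (2 * n) * (z.2.1 ⬝ᵥ z.2.2) ^ 2))
      ((Measure.pi fun i => gaussianReal 0 (vG n i)).prod ((tP n v (n * ρ)).prod (tP n v (n * ρ)))) ∧
    ∫ z : ((Fin n × Fin n) ⊕ Fin n → ℝ) × ((Fin n → ℝ) × (Fin n → ℝ)),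
      Real.exp ((dG n v 0 lam 0 (n * ρ)).H t z.1 z.2.1 + (dG n v 0 lam 0 (n * ρ)).H t z.1 z.2.2 +
        η / (2 * n) * (z.2.1 ⬝ᵥ z.2.2) ^ 2)
      ∂((Measure.pi fun i => gaussianReal 0 (vG n i)).prod ((tP n v (n * ρ)).prod (tP n v (n * ρ)))) ≤
      (Real.sqrt (1 - (lam + η) * v * ρ))⁻¹ := by
  have hn' : (0:ℝ) < n := by exact_mod_cast hn
  have hρ0 : 0 < ρ := hv.trans hρ
  have hr : n * v < n * ρ := by gcongr
  have hne := tP_ne n v _ hv hr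
  have hr0 : 0 ≤ n * ρ := by positivity
  obtain ⟨C, hC⟩ := dG_good n hn v 0 lam 0 (n * ρ) hl le_rfl hr0 hne t
  have mH := hC.mH t
  have mF : Measurable (fun z : ((Fin n × Fin n) ⊕ Fin n → ℝ) × ((Fin n → ℝ) × (Fin n → ℝ)) =>
      Real.exp ((dG n v 0 lam 0 (n * ρ)).H t z.1 z.2.1 + (dG n v 0 lam 0 (n * ρ)).H t z.1 z.2.2 +
        η / (2 * n) * (z.2.1 ⬝ᵥ z.2.2) ^ 2)) := by
    have a := mH.comp (f := fun z : ((Fin n × Fin n) ⊕ Fin n → ℝ) × ((Fin n → ℝ) × (Fin n → ℝ)) =>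
      (z.1, z.2.1)) (by fun_prop)
    have b := mH.comp (f := fun z : ((Fin n × Fin n) ⊕ Fin n → ℝ) × ((Fin n → ℝ) × (Fin n → ℝ)) =>
      (z.1, z.2.2)) (by fun_prop)
    exact ((a.add b).add (by fun_prop)).exp
  have hg : ∀ y : (Fin n → ℝ) × (Fin n → ℝ), Integrable (fun g =>
      Real.exp ((dG n v 0 lam 0 (n * ρ)).H t g y.1 + (dG n v 0 lam 0 (n * ρ)).H t g y.2 +
        η / (2 * n) * (y.1 ⬝ᵥ y.2) ^ 2)) (Measure.pi fun i => gaussianReal 0 (vG n i)) ∧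
      ∫ g, Real.exp ((dG n v 0 lam 0 (n * ρ)).H t g y.1 + (dG n v 0 lam 0 (n * ρ)).H t g y.2 +
        η / (2 * n) * (y.1 ⬝ᵥ y.2) ^ 2) ∂(Measure.pi fun i => gaussianReal 0 (vG n i)) =
      Real.exp ((lam * Real.sin t ^ 2 + η) / (2 * n) * (y.1 ⬝ᵥ y.2) ^ 2) := by
    intro y
    set c := Real.sqrt (lam / n) * Real.sin t with hc
    have hc2 : c ^ 2 = lam / n * Real.sin t ^ 2 := by
      rw [hc, mul_pow, Real.sq_sqrt (by positivity)]
    obtain ⟨a, b⟩ := vG_mgf n (fun p => c * (qf p y.1 + qf p y.2))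
    have e : ∀ g : (Fin n × Fin n) ⊕ Fin n → ℝ, Real.exp ((dG n v 0 lam 0 (n * ρ)).H t g y.1 + (dG n v 0 lam 0 (n * ρ)).H t g y.2 +
        η / (2 * n) * (y.1 ⬝ᵥ y.2) ^ 2) = Real.exp (η / (2 * n) * (y.1 ⬝ᵥ y.2) ^ 2 -
          Real.sin t ^ 2 * (lam / (4 * n) * (y.1 ⬝ᵥ y.1) ^ 2) -
          Real.sin t ^ 2 * (lam / (4 * n) * (y.2 ⬝ᵥ y.2) ^ 2)) *
          Real.exp (∑ p, c * (qf p y.1 + qf p y.2) * g (Sum.inl p)) := by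
      intro g
      rw [← Real.exp_add, dG0_H, dG0_H]
      congr 1
      simp only [mul_add, add_mul, Finset.sum_add_distrib]
      ring
    simp only [e]
    refine ⟨a.const_mul _, ?_⟩
    rw [integral_const_mul, b, ← Real.exp_add]
    congr 1
    have q1 := qf_inner y.1 y.1
    have q2 := qf_inner y.1 y.2
    have q3 := qf_inner y.2 y.2
    have : ∑ p, (nv p : ℝ) * (c * (qf p y.1 + qf p y.2) * (c * (qf p y.1 + qf p y.2))) =
        c ^ 2 * (∑ p, (nv p : ℝ) * (qf p y.1 * qf p y.1) + 2 * ∑ p, (nv p : ℝ) * (qf p y.1 * qf p y.2) +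
          ∑ p, (nv p : ℝ) * (qf p y.2 * qf p y.2)) := by
      simp only [Finset.mul_sum, ← Finset.sum_add_distrib]
      apply Finset.sum_congr rfl; intro p _; ring
    rw [this, q1, q2, q3, hc2]
    field_simp
    ring
  have h2D : ∀ y : Fin n → ℝ, y ⬝ᵥ y ≤ n * ρ →
      Integrable (fun x => Real.exp ((lam * Real.sin t ^ 2 + η) / (2 * n) * (x ⬝ᵥ y) ^ 2)) (gaussPrior n v) ∧
      ∫ x, Real.exp ((lam * Real.sin t ^ 2 + η) / (2 * n) * (x ⬝ᵥ y) ^ 2) ∂gaussPrior n v ≤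
        (Real.sqrt (1 - (lam + η) * v * ρ))⁻¹ := by
    intro y hy
    have hs2 := Real.sin_sq_le_one t
    have hle : (lam * Real.sin t ^ 2 + η) / n * v * (y ⬝ᵥ y) / (1 + v * 0) ≤ (lam + η) * v * ρ := by
      have : (lam + η) * v * ρ = (lam + η) / n * v * (n * ρ) := by field_simp
      rw [this, mul_zero, add_zero, div_one]
      have := dot_self_nonneg y
      gcongr
      nlinarith
    obtain ⟨a, b⟩ := gauss_spike n v hv 0 y 0 ((lam * Real.sin t ^ 2 + η) / n) (by simp)
      (by positivity) (by linarith)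
    have e : ∀ x : Fin n → ℝ, (0 : Fin n → ℝ) ⬝ᵥ x - 0 * (x ⬝ᵥ x) / 2 + (lam * Real.sin t ^ 2 + η) / n * (y ⬝ᵥ x) ^ 2 / 2 =
        (lam * Real.sin t ^ 2 + η) / (2 * n) * (x ⬝ᵥ y) ^ 2 := by
      intro x; rw [dotProduct_comm y x, zero_dotProduct]; field_simp; ring
    simp only [e] at a b
    refine ⟨a, ?_⟩
    rw [b]
    have hS : 0 < Real.sqrt (1 - (lam + η) * v * ρ) := Real.sqrt_pos.2 (by linarith)
    have : Real.sqrt (1 - (lam + η) * v * ρ) ≤ Real.sqrt (1 - (lam * Real.sin t ^ 2 + η) / n * v * (y ⬝ᵥ y) / (1 + v * 0)) :=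
      Real.sqrt_le_sqrt (by linarith)
    simp only [dotProduct_zero, mul_zero, zero_div, Real.exp_zero, add_zero, Real.sqrt_one, inv_one,
      one_pow, mul_one, one_mul, div_one, ne_eq, OfNat.ofNat_ne_zero, not_false_eq_true, zero_pow] at this ⊢
    gcongr
  have m2 : Measurable (fun p : (Fin n → ℝ) × (Fin n → ℝ) => Real.exp ((lam * Real.sin t ^ 2 + η) / (2 * n) * (p.1 ⬝ᵥ p.2) ^ 2)) := by
    fun_prop
  have hI2 : Integrable (fun p : (Fin n → ℝ) × (Fin n → ℝ) => Real.exp ((lam * Real.sin t ^ 2 + η) / (2 * n) * (p.1 ⬝ᵥ p.2) ^ 2))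
      ((tP n v (n * ρ)).prod (tP n v (n * ρ))) := by
    rw [integrable_prod_iff' m2.aestronglyMeasurable]
    constructor
    · filter_upwards [tP_ae n v (n * ρ)] with y hy
      exact (h2D y hy).1.restrict
    · refine Integrable.mono' (integrable_const ((Real.sqrt (1 - (lam + η) * v * ρ))⁻¹)) ?_ ?_
      · exact (m2.norm.stronglyMeasurable.integral_prod_left' (μ := tP n v (n * ρ))).aestronglyMeasurable
      · filter_upwards [tP_ae n v (n * ρ)] with y hy
        simp only [Real.norm_eq_abs, Real.abs_exp]
        rw [abs_of_nonneg (integral_nonneg fun x => (Real.exp_pos _).le)]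
        exact (setIntegral_le_integral (h2D y hy).1 (Eventually.of_forall fun x => (Real.exp_pos _).le)).trans (h2D y hy).2
  have hI : Integrable (fun z : ((Fin n × Fin n) ⊕ Fin n → ℝ) × ((Fin n → ℝ) × (Fin n → ℝ)) =>
      Real.exp ((dG n v 0 lam 0 (n * ρ)).H t z.1 z.2.1 + (dG n v 0 lam 0 (n * ρ)).H t z.1 z.2.2 +
        η / (2 * n) * (z.2.1 ⬝ᵥ z.2.2) ^ 2))
      ((Measure.pi fun i => gaussianReal 0 (vG n i)).prod ((tP n v (n * ρ)).prod (tP n v (n * ρ)))) := by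
    rw [integrable_prod_iff' mF.aestronglyMeasurable]
    refine ⟨Eventually.of_forall fun y => (hg y).1, ?_⟩
    simp only [Real.norm_eq_abs, Real.abs_exp, (hg _).2]
    exact hI2
  refine ⟨hI, ?_⟩
  rw [integral_prod_symm _ hI]
  simp only [(hg _).2]
  rw [integral_prod_symm _ hI2]
  have hub : ∀ᵐ y ∂tP n v (n * ρ), ∫ x, Real.exp ((lam * Real.sin t ^ 2 + η) / (2 * n) * (x ⬝ᵥ y) ^ 2) ∂tP n v (n * ρ) ≤
        (Real.sqrt (1 - (lam + η) * v * ρ))⁻¹ := by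
    filter_upwards [tP_ae n v (n * ρ)] with y hy
    exact (setIntegral_le_integral (h2D y hy).1 (Eventually.of_forall fun x => (Real.exp_pos _).le)).trans (h2D y hy).2
  refine (integral_mono_ae hI2.integral_prod_right (integrable_const _) hub).trans ?_
  rw [integral_const, smul_eq_mul]
  have : (tP n v (n * ρ)).real Set.univ ≤ 1 := by
    rw [tP, measureReal_restrict_apply_univ]
    exact measureReal_le_one
  have h0 : 0 ≤ (Real.sqrt (1 - (lam + η) * v * ρ))⁻¹ := by positivity
  nlinarith

end

lemma gav_abs_le {X : Type*} [MeasurableSpace X] (ν : Measure X) (H f : X → ℝ) (K : ℝ)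
    (hf : ∀ᵐ x ∂ν, |f x| ≤ K)
    (hZ : Integrable (fun x => Real.exp (H x)) ν) (hp : 0 < ∫ x, Real.exp (H x) ∂ν) :
    |gav ν H f| ≤ K := by
  unfold gav
  rw [abs_div, abs_of_pos hp, div_le_iff₀ hp, ← integral_const_mul]
  refine (abs_integral_le_integral_abs).trans ?_
  refine integral_mono_of_nonneg (ae_of_all _ fun x => abs_nonneg _) (hZ.const_mul K) ?_
  filter_upwards [hf] with x hx
  rw [abs_mul, abs_of_pos (Real.exp_pos _)]
  exact mul_le_mul_of_nonneg_right hx (Real.exp_pos _).le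

section
variable {n : ℕ} (hn : 1 ≤ n) (v : ℝ) (s : Fin n → ℝ) {lam q r : ℝ} (hl : 0 < lam)
    (hq : 0 ≤ q) (hr : 0 ≤ r) (hne : tP n v r ≠ 0) (t : ℝ)
include hn hl hq hr hne

lemma dG_gT_le (g) (i j : Fin n) : |gT (tP n v r) ((dG n v s lam q r).H t g) i j| ≤ r := by
  refine gav_abs_le _ _ _ _ ?_ (dG_intZ hn v s hl hq hr hne t g) (dG_Zpos hn v s hl hq hr hne t g)
  filter_upwards [tP_ae n v r] with x hx
  exact (coord_mul_le x i j).trans hx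

lemma dG_mgT (i j : Fin n) : Measurable fun g => gT (tP n v r) ((dG n v s lam q r).H t g) i j := by
  obtain ⟨C, hC⟩ := dG_good n hn v s lam q r hl hq hr hne t
  exact hC.mgav t (fun x => x i * x j) (by fun_prop)

lemma dG_intT : Integrable (fun g => ∑ i, ∑ j, gT (tP n v r) ((dG n v s lam q r).H t g) i j ^ 2)
    (Measure.pi fun i => gaussianReal 0 (vG n i)) := by
  refine integrable_finsetSum _ fun i _ => integrable_finsetSum _ fun j _ => ?_
  refine Integrable.mono' (integrable_const (r ^ 2))
    ((dG_mgT hn v s hl hq hr hne t i j).pow_const 2).aestronglyMeasurable (ae_of_all _ fun g => ?_)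
  rw [Real.norm_eq_abs, abs_pow]
  exact pow_le_pow_left₀ (abs_nonneg _) (dG_gT_le hn v s hl hq hr hne t g i j) 2
end

section
variable {n : ℕ} (hn : 1 ≤ n) {v lam ρ η : ℝ} (hv : 0 < v) (hl : 0 < lam) (hρ : v < ρ) (hη : 0 < η)
  (h1 : (lam + η) * v * ρ < 1)
include hn hv hl hρ hη h1

lemma dG0_two (t : ℝ) :
    2 * (∫ g, Real.log (∫ x, Real.exp ((dG n v 0 lam 0 (n * ρ)).H t g x) ∂(tP n v (n * ρ)))
        ∂(Measure.pi fun i => gaussianReal 0 (vG n i))) +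
      η / (2 * n) * (∫ g, (∑ i, ∑ j, gT (tP n v (n * ρ)) ((dG n v 0 lam 0 (n * ρ)).H t g) i j ^ 2)
        ∂(Measure.pi fun i => gaussianReal 0 (vG n i))) ≤
    Real.log ((Real.sqrt (1 - (lam + η) * v * ρ))⁻¹) := by
  have hn' : (0:ℝ) < n := by exact_mod_cast hn
  have hρ0 : 0 < ρ := hv.trans hρ
  have hr : n * v < n * ρ := by gcongr
  have hne := tP_ne n v _ hv hr
  have hr0 : 0 ≤ n * ρ := by positivity
  obtain ⟨hI, hle⟩ := dG0_annealed hn hv hl hρ hη h1 t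
  set M := (Real.sqrt (1 - (lam + η) * v * ρ))⁻¹ with hM
  have hM0 : 0 < M := by rw [hM]; have : 0 < 1 - (lam + η) * v * ρ := by linarith
                         positivity
  have i1 := dG_intlog hn v 0 hl le_rfl hr0 hne t
  have i2 := dG_intT hn v 0 hl le_rfl hr0 hne t
  have hA := hI.prod_right_ae
  have iA := hI.integral_prod_left
  rw [integral_prod _ hI] at hle
  rw [← integral_const_mul, ← integral_const_mul, ← integral_add (i1.const_mul 2) (i2.const_mul _)]
  have hb : Integrable (fun g : ((Fin n × Fin n) ⊕ Fin n → ℝ) => Real.log M - 1 + M⁻¹ * ∫ z, Real.exp ((dG n v 0 lam 0 (n * ρ)).H t g z.1 + (dG n v 0 lam 0 (n * ρ)).H t g z.2 +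
        η / (2 * n) * (z.1 ⬝ᵥ z.2) ^ 2) ∂((tP n v (n * ρ)).prod (tP n v (n * ρ)))) (Measure.pi fun i => gaussianReal 0 (vG n i)) :=
    (integrable_const _).add (iA.const_mul _)
  refine (integral_mono_ae ((i1.const_mul 2).add (i2.const_mul _)) hb ?_).trans ?_
  · filter_upwards [hA] with g hg
    have := two_jensen (tP n v (n * ρ)) ((dG n v 0 lam 0 (n * ρ)).H t g) (η / (2 * n))
      (dG_intZ hn v 0 hl le_rfl hr0 hne t g) (dG_Zpos hn v 0 hl le_rfl hr0 hne t g)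
      (dG_intxx hn v 0 hl le_rfl hr0 hne t g) hg
    refine this.trans ?_
    set A := ∫ z, Real.exp ((dG n v 0 lam 0 (n * ρ)).H t g z.1 + (dG n v 0 lam 0 (n * ρ)).H t g z.2 +
        η / (2 * n) * (z.1 ⬝ᵥ z.2) ^ 2) ∂((tP n v (n * ρ)).prod (tP n v (n * ρ))) with hAd
    have hA0 : 0 < A := by
      refine integral_exp_pos (μ := (tP n v (n * ρ)).prod (tP n v (n * ρ))) (f := fun z : (Fin n → ℝ) × (Fin n → ℝ) => (dG n v 0 lam 0 (n * ρ)).H t g z.1 + (dG n v 0 lam 0 (n * ρ)).H t g z.2 +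
        η / (2 * n) * (z.1 ⬝ᵥ z.2) ^ 2) (hμ := ⟨?_⟩) hg
      rw [Ne, ← Measure.measure_univ_eq_zero, Measure.prod_apply MeasurableSet.univ]
      simpa using hne
    have h2 := Real.log_le_sub_one_of_pos (div_pos hA0 hM0)
    rw [Real.log_div hA0.ne' hM0.ne'] at h2
    have : M⁻¹ * A = A / M := by ring
    linarith
  · rw [integral_add (integrable_const _) (iA.const_mul _), integral_const_mul]
    have : M⁻¹ * (∫ g, ∫ z, Real.exp ((dG n v 0 lam 0 (n * ρ)).H t g z.1 + (dG n v 0 lam 0 (n * ρ)).H t g z.2 +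
        η / (2 * n) * (z.1 ⬝ᵥ z.2) ^ 2) ∂((tP n v (n * ρ)).prod (tP n v (n * ρ))) ∂(Measure.pi fun i => gaussianReal 0 (vG n i))) ≤ M⁻¹ * M :=
      mul_le_mul_of_nonneg_left hle (by positivity)
    rw [inv_mul_cancel₀ hM0.ne'] at this
    simp only [integral_const, probReal_univ, one_smul]
    linarith

lemma dG0_gron :
    Real.log ((Real.sqrt (1 - (lam + η) * v * ρ))⁻¹) -
    2 * (∫ g, Real.log (∫ x, Real.exp ((dG n v 0 lam 0 (n * ρ)).H (Real.pi / 2) g x) ∂(tP n v (n * ρ)))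
        ∂(Measure.pi fun i => gaussianReal 0 (vG n i))) ≤
    Real.exp (lam / η) * (Real.log ((Real.sqrt (1 - (lam + η) * v * ρ))⁻¹) -
      2 * Real.log ((tP n v (n * ρ)).real Set.univ)) := by
  have hn' : (0:ℝ) < n := by exact_mod_cast hn
  have hρ0 : 0 < ρ := hv.trans hρ
  have hr : n * v < n * ρ := by gcongr
  have hne := tP_ne n v _ hv hr
  have hr0 : 0 ≤ n * ρ := by positivity
  set C := Real.log ((Real.sqrt (1 - (lam + η) * v * ρ))⁻¹)
  have htwo := dG0_two hn hv hl hρ hη h1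
  set G := fun t => ∫ g, Real.log (∫ x, Real.exp ((dG n v 0 lam 0 (n * ρ)).H t g x) ∂(tP n v (n * ρ)))
        ∂(Measure.pi fun i => gaussianReal 0 (vG n i)) with hG
  set E := fun t => ∫ g, (∑ i, ∑ j, gT (tP n v (n * ρ)) ((dG n v 0 lam 0 (n * ρ)).H t g) i j ^ 2)
        ∂(Measure.pi fun i => gaussianReal 0 (vG n i)) with hE
  have hd : ∀ t, HasDerivAt G (-(lam * Real.sin t * Real.cos t / (2 * n) * E t)) t := by
    intro t
    refine (dG_deriv hn v 0 hl le_rfl hr0 hne t).congr_deriv ?_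
    rw [hE, ← integral_const_mul, ← integral_neg]
    refine integral_congr_ae (ae_of_all _ fun g => ?_)
    simp only; ring
  have hd2 : ∀ t, HasDerivAt (fun t => (C - 2 * G t) * Real.exp (-(lam / η * Real.sin t ^ 2)))
      (Real.exp (-(lam / η * Real.sin t ^ 2)) * (2 * lam / η * Real.sin t * Real.cos t) *
        (η / (2 * n) * E t - (C - 2 * G t))) t := by
    intro t
    have a := ((hd t).const_mul 2).const_sub C
    have b := ((((Real.hasDerivAt_sin t).fun_pow 2).const_mul (lam / η)).fun_neg).exp
    refine (a.mul b).congr_deriv ?_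
    field_simp
    ring
  have hanti : AntitoneOn (fun t => (C - 2 * G t) * Real.exp (-(lam / η * Real.sin t ^ 2)))
      (Set.Icc 0 (Real.pi / 2)) := by
    refine antitoneOn_of_deriv_nonpos (convex_Icc _ _) (fun t _ => (hd2 t).continuousAt.continuousWithinAt)
      (fun t _ => (hd2 t).differentiableAt.differentiableWithinAt) fun t ht => ?_
    rw [interior_Icc] at ht
    rw [(hd2 t).deriv]
    have hs0 : 0 ≤ Real.sin t := Real.sin_nonneg_of_nonneg_of_le_pi ht.1.le (by linarith [ht.2, Real.pi_pos])
    have hc0 : 0 ≤ Real.cos t := Real.cos_nonneg_of_neg_pi_div_two_le_of_le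
      (by linarith [ht.1, Real.pi_pos]) ht.2.le
    refine mul_nonpos_of_nonneg_of_nonpos (by positivity) ?_
    have := htwo t
    simp only [hG, hE]
    linarith
  have hp := Real.pi_pos
  have := hanti (Set.left_mem_Icc.2 (by positivity)) (Set.right_mem_Icc.2 (by positivity)) (by positivity)
  simp only [Real.sin_pi_div_two, Real.sin_zero] at this
  have hG0 : G 0 = Real.log ((tP n v (n * ρ)).real Set.univ) := by
    simp [hG, dG_H_zero]
  rw [hG0] at this
  norm_num at this
  rw [Real.exp_neg, ← div_eq_mul_inv, div_le_iff₀ (Real.exp_pos _)] at this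
  linarith
end

/-- consequences at the endpoint -/
lemma null_bounds {n : ℕ} (hn : 1 ≤ n) {v lam ρ η : ℝ} (hv : 0 < v) (hl : 0 < lam) (hρ : v < ρ) (hη : 0 < η)
    (h1 : (lam + η) * v * ρ < 1) (hm : 1 / 2 ≤ (tP n v (n * ρ)).real Set.univ) (K : ℝ)
    (hK : Real.exp (lam / η) * (|Real.log ((Real.sqrt (1 - (lam + η) * v * ρ))⁻¹)| + 2 * Real.log 2) +
      |Real.log ((Real.sqrt (1 - (lam + η) * v * ρ))⁻¹)| ≤ K) :
    -K ≤ ∫ g, Real.log (∫ x, Real.exp (Hs n 0 lam g x) ∂(tP n v (n * ρ))) ∂gpi n ∧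
    (∫ g, (∑ i, ∑ j, gT (tP n v (n * ρ)) (Hs n 0 lam g) i j ^ 2) ∂gpi n) ≤ n * (2 * K / η) := by
  have hn' : (0:ℝ) < n := by exact_mod_cast hn
  have hρ0 : 0 < ρ := hv.trans hρ
  have hr : n * v < n * ρ := by gcongr
  have hne := tP_ne n v _ hv hr
  have hr0 : 0 ≤ n * ρ := by positivity
  have a := dG0_two hn hv hl hρ hη h1 (Real.pi / 2)
  have b := dG0_gron hn hv hl hρ hη h1
  simp only [dG_H_half] at a b
  have e1 : ∫ g, Real.log (∫ x, Real.exp (Hs n 0 lam (fun p => g (Sum.inl p)) x) ∂(tP n v (n * ρ)))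
        ∂(Measure.pi fun i => gaussianReal 0 (vG n i)) = ∫ g, Real.log (∫ x, Real.exp (Hs n 0 lam g x) ∂(tP n v (n * ρ))) ∂gpi n := by
    rw [← (vG_fst n).map_eq, integral_map (vG_fst n).measurable.aemeasurable (mlZr n v _ 0 lam).aestronglyMeasurable]
  have mT : Measurable fun g => ∑ i, ∑ j, gT (tP n v (n * ρ)) (Hs n 0 lam g) i j ^ 2 := by
    refine Finset.measurable_fun_sum _ fun i _ => Finset.measurable_fun_sum _ fun j _ => ?_
    refine Measurable.pow_const ?_ 2
    unfold gT gav
    have mm := (measurable_Hs n lam).comp (f := fun p : (Fin n × Fin n → ℝ) × (Fin n → ℝ) => (((0 : Fin n → ℝ), p.1), p.2)) (by fun_prop)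
    refine Measurable.div (StronglyMeasurable.measurable ?_) (StronglyMeasurable.measurable ?_)
    · refine StronglyMeasurable.integral_prod_right (f := fun (g : Fin n × Fin n → ℝ) (x : Fin n → ℝ) => (x i * x j) * Real.exp (Hs n 0 lam g x)) ?_
      exact ((by fun_prop : Measurable fun p : (Fin n × Fin n → ℝ) × (Fin n → ℝ) => p.2 i * p.2 j).mul mm.exp).stronglyMeasurable
    · refine StronglyMeasurable.integral_prod_right (f := fun (g : Fin n × Fin n → ℝ) (x : Fin n → ℝ) => Real.exp (Hs n 0 lam g x)) ?_
      exact mm.exp.stronglyMeasurable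
  have e2 : ∫ g, (∑ i, ∑ j, gT (tP n v (n * ρ)) (Hs n 0 lam (fun p => g (Sum.inl p))) i j ^ 2)
        ∂(Measure.pi fun i => gaussianReal 0 (vG n i)) = ∫ g, (∑ i, ∑ j, gT (tP n v (n * ρ)) (Hs n 0 lam g) i j ^ 2) ∂gpi n := by
    rw [← (vG_fst n).map_eq, integral_map (vG_fst n).measurable.aemeasurable mT.aestronglyMeasurable]
  have e3 : ∀ g : (Fin n × Fin n) ⊕ Fin n → ℝ, (dG n v 0 lam 0 (n * ρ)).H (Real.pi / 2) g = Hs n 0 lam (fun p => g (Sum.inl p)) :=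
    fun g => funext fun x => dG_H_half n v 0 lam 0 _ g x
  simp only [e3] at a
  rw [e1] at a b
  rw [e2] at a
  set C := Real.log ((Real.sqrt (1 - (lam + η) * v * ρ))⁻¹)
  set G := ∫ g, Real.log (∫ x, Real.exp (Hs n 0 lam g x) ∂(tP n v (n * ρ))) ∂gpi n
  set E := ∫ g, (∑ i, ∑ j, gT (tP n v (n * ρ)) (Hs n 0 lam g) i j ^ 2) ∂gpi n
  have l1 : -Real.log 2 ≤ Real.log ((tP n v (n * ρ)).real Set.univ) := by
    rw [← Real.log_inv]; exact Real.log_le_log (by norm_num) (by linarith)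
  have l2 : 0 ≤ Real.log 2 := Real.log_nonneg (by norm_num)
  have hC := abs_nonneg C
  have hC2 := le_abs_self C
  have b' : C - 2 * G ≤ Real.exp (lam / η) * (|C| + 2 * Real.log 2) :=
    b.trans (mul_le_mul_of_nonneg_left (by linarith) (Real.exp_pos _).le)
  have hex : 0 ≤ Real.exp (lam / η) * (|C| + 2 * Real.log 2) := by positivity
  have hC3 := neg_abs_le C
  constructor
  · linarith
  · have : η / (2 * n) * E ≤ K := by linarith
    have h5 : E = (η / (2 * n) * E) * (2 * n / η) := by field_simp
    rw [h5]
    calc _ ≤ K * (2 * n / η) := by gcongr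
      _ = _ := by ring

lemma tP_mass (v ρ : ℝ) (hv : 0 < v) (hρ : v < ρ) :
    ∀ᶠ n : ℕ in atTop, 1 / 2 ≤ (tP n v (n * ρ)).real Set.univ := by
  have h0 : Tendsto (fun n : ℕ => 2 * v ^ 2 / (n:ℝ)) atTop (nhds 0) :=
    tendsto_const_div_atTop_nhds_zero_nat _
  have hpos : 0 < (ρ - v) ^ 2 / 2 := by have : 0 < ρ - v := by linarith
                                        positivity
  filter_upwards [h0.eventually (gt_mem_nhds hpos), eventually_ge_atTop 1] with n h2 hn
  have hn' : (0:ℝ) < n := by exact_mod_cast hn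
  have hvar := mom_var n hn v hv
  have hi : Integrable (fun s : Fin n → ℝ => ((s ⬝ᵥ s) / n - v) ^ 2) (gaussPrior n v) := by
    by_contra h
    rw [integral_undef h] at hvar
    have : 0 < 2 * v ^ 2 / n := by positivity
    linarith
  have ch := mul_meas_ge_le_integral_of_nonneg (ae_of_all _ fun s => sq_nonneg ((s ⬝ᵥ s) / n - v)) hi ((ρ - v) ^ 2)
  rw [hvar] at ch
  have e : (tP n v (n * ρ)).real Set.univ = 1 - (gaussPrior n v).real (ballu n (n * ρ))ᶜ := by
    rw [tP, measureReal_restrict_apply MeasurableSet.univ, Set.univ_inter,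
      probReal_compl_eq_one_sub (measurableSet_ballu n _)]
    ring
  have sub : (ballu n (n * ρ))ᶜ ⊆ {s : Fin n → ℝ | (ρ - v) ^ 2 ≤ ((s ⬝ᵥ s) / n - v) ^ 2} := by
    intro s hs
    simp only [ballu, Set.mem_compl_iff, Set.mem_setOf_eq, not_le] at hs ⊢
    have : ρ < (s ⬝ᵥ s) / n := by rw [lt_div_iff₀ hn']; linarith
    exact pow_le_pow_left₀ (by linarith) (by linarith) 2
  have m := measureReal_mono (μ := gaussPrior n v) sub
  rw [e]
  have : (ρ - v) ^ 2 * (gaussPrior n v).real (ballu n (n * ρ))ᶜ ≤ (ρ - v) ^ 2 * (1 / 2) := by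
    have := mul_le_mul_of_nonneg_left m (sq_nonneg (ρ - v))
    linarith
  have := le_of_mul_le_mul_left this (by linarith)
  linarith

/-- null model bounds (L1) -/
lemma null_lim (v lam : ℝ) (hv : 0 < v) (hl : 0 < lam) (h : lam * v ^ 2 < 1) :
    ∃ ρ K : ℝ, v < ρ ∧ 0 ≤ K ∧ ∀ᶠ n : ℕ in atTop,
    -K ≤ ∫ g, Real.log (∫ x, Real.exp (Hs n 0 lam g x) ∂(tP n v (n * ρ))) ∂gpi n ∧
    (∫ g, (∑ i, ∑ j, gT (tP n v (n * ρ)) (Hs n 0 lam g) i j ^ 2) ∂gpi n) ≤ n * K := by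
  have hc : ∀ᶠ e : ℝ in nhdsWithin 0 (Set.Ioi 0), (lam + e) * v * (v + e) < 1 := by
    have : ContinuousAt (fun e : ℝ => (lam + e) * v * (v + e)) 0 := by fun_prop
    refine (this.tendsto.mono_left nhdsWithin_le_nhds).eventually (gt_mem_nhds ?_)
    simp; nlinarith
  obtain ⟨e, he, he0⟩ := (hc.and self_mem_nhdsWithin).exists
  have he0 : 0 < e := he0
  set K0 := Real.exp (lam / e) * (|Real.log ((Real.sqrt (1 - (lam + e) * v * (v + e)))⁻¹)| + 2 * Real.log 2) +
      |Real.log ((Real.sqrt (1 - (lam + e) * v * (v + e)))⁻¹)| with hK0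
  have l2 : 0 ≤ Real.log 2 := Real.log_nonneg (by norm_num)
  have hK00 : 0 ≤ K0 := by positivity
  refine ⟨v + e, max K0 (2 * K0 / e), by linarith, le_max_of_le_left hK00, ?_⟩
  filter_upwards [tP_mass v (v + e) hv (by linarith), eventually_ge_atTop 1] with n hm hn
  obtain ⟨a, b⟩ := null_bounds hn hv hl (by linarith : v < v + e) he0 he hm K0 le_rfl
  refine ⟨?_, b.trans ?_⟩
  · linarith [le_max_left K0 (2 * K0 / e)]
  · gcongr; exact le_max_right _ _

/-- one-dimensional change of variance and shift -/
lemma gauss_cov1 (v v' z : ℝ) (hv : 0 < v) (hv' : 0 < v') (A : Set ℝ) (hA : MeasurableSet A) :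
    ∫⁻ y, A.indicator (fun _ => 1) (z + y) * ENNReal.ofReal (Real.exp (1 / 2 * Real.log (v' / v) - (z + y) ^ 2 / (2 * v) +
      y ^ 2 / (2 * v'))) ∂gaussianReal 0 (Real.toNNReal v') = gaussianReal 0 (Real.toNNReal v) A := by
  rw [gaussianReal_apply _ (toNNReal_ne hv), gaussianReal_of_var_ne_zero _ (toNNReal_ne hv'),
    lintegral_withDensity_eq_lintegral_mul _ (measurable_gaussianPDF _ _), ← lintegral_indicator hA,
    ← lintegral_add_left_eq_self (A.indicator (gaussianPDF 0 (Real.toNNReal v))) z]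
  · refine lintegral_congr fun y => ?_
    simp only [Pi.mul_apply, gaussianPDF, gaussianPDFReal_def]
    by_cases h : z + y ∈ A
    · rw [Set.indicator_of_mem h, Set.indicator_of_mem h, one_mul, ← ENNReal.ofReal_mul (by positivity)]
      congr 1
      simp only [gaussianPDFReal_def]
      rw [Real.coe_toNNReal v hv.le, Real.coe_toNNReal v' hv'.le, mul_assoc, ← Real.exp_add, sub_zero, sub_zero]
      have : -y ^ 2 / (2 * v') + (1 / 2 * Real.log (v' / v) - (z + y) ^ 2 / (2 * v) + y ^ 2 / (2 * v')) =
        Real.log (v' / v) / 2 + -(z + y) ^ 2 / (2 * v) := by ring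
      rw [this, Real.exp_add, ← mul_assoc]
      congr 1
      rw [Real.exp_half, Real.exp_log (by positivity), ← Real.sqrt_inv, ← Real.sqrt_inv,
        ← Real.sqrt_mul (by positivity)]
      congr 1
      field_simp
    · rw [Set.indicator_of_notMem h, Set.indicator_of_notMem h]; simp
  · exact ((measurable_const.indicator hA).comp (by fun_prop)).mul (by fun_prop)

def Rw (n : ℕ) (v v' : ℝ) (z y : Fin n → ℝ) : ℝ :=
  n / 2 * Real.log (v' / v) - (z + y) ⬝ᵥ (z + y) / (2 * v) + (y ⬝ᵥ y) / (2 * v')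

lemma gauss_cov (n : ℕ) (v v' : ℝ) (z : Fin n → ℝ) (hv : 0 < v) (hv' : 0 < v') :
    gaussPrior n v = ((gaussPrior n v').withDensity fun y => ENNReal.ofReal (Real.exp (Rw n v v' z y))).map
      (fun y => z + y) := by
  have mR : Measurable (fun y => ENNReal.ofReal (Real.exp (Rw n v v' z y))) := by
    unfold Rw; fun_prop
  refine Measure.pi_eq fun A hA => ?_
  have hAm := MeasurableSet.univ_pi hA
  rw [Measure.map_apply (by fun_prop) hAm, withDensity_apply _ ((by fun_prop : Measurable fun y => z + y) hAm),
    ← lintegral_indicator ((by fun_prop : Measurable fun y => z + y) hAm)]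
  have e : ∀ y : Fin n → ℝ, ((fun y => z + y) ⁻¹' Set.univ.pi A).indicator (fun y => ENNReal.ofReal (Real.exp (Rw n v v' z y))) y =
      ∏ i, ((A i).indicator (fun _ => 1) (z i + y i) * ENNReal.ofReal (Real.exp (1 / 2 * Real.log (v' / v) - (z i + y i) ^ 2 / (2 * v) +
      y i ^ 2 / (2 * v')))) := by
    intro y
    by_cases h : ∀ i, z i + y i ∈ A i
    · rw [Set.indicator_of_mem (by intro i _; exact h i)]
      simp only [Set.indicator_of_mem (h _), one_mul]
      rw [← ENNReal.ofReal_prod_of_nonneg fun i _ => (Real.exp_pos _).le, ← Real.exp_sum]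
      congr 2
      rw [Finset.sum_add_distrib, Finset.sum_sub_distrib, ← Finset.sum_div, ← Finset.sum_div]
      simp [Rw, dotProduct, sq]
      ring
    · rw [Set.indicator_of_notMem (by intro h'; exact h fun i => h' i trivial)]
      push Not at h
      obtain ⟨i, hi⟩ := h
      symm
      refine Finset.prod_eq_zero (Finset.mem_univ i) ?_
      rw [Set.indicator_of_notMem hi, zero_mul]
  have mi : ∀ i, Measurable fun y : ℝ => ((A i).indicator (fun _ => (1 : ENNReal)) (z i + y) * ENNReal.ofReal (Real.exp (1 / 2 * Real.log (v' / v) - (z i + y) ^ 2 / (2 * v) +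
      y ^ 2 / (2 * v')))) := fun i => ((measurable_const.indicator (hA i)).comp (by fun_prop)).mul (by fun_prop)
  simp only [e]
  unfold gaussPrior
  rw [lintegral_prod_eq_prod_lintegral_of_indepFun Finset.univ
    (fun i (y : Fin n → ℝ) => ((A i).indicator (fun _ => (1 : ENNReal)) (z i + y i) * ENNReal.ofReal (Real.exp (1 / 2 * Real.log (v' / v) - (z i + y i) ^ 2 / (2 * v) +
      y i ^ 2 / (2 * v')))))
    (iIndepFun_pi (X := fun i y => ((A i).indicator (fun _ => (1 : ENNReal)) (z i + y) * ENNReal.ofReal (Real.exp (1 / 2 * Real.log (v' / v) - (z i + y) ^ 2 / (2 * v) +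
      y ^ 2 / (2 * v'))))) fun i => (mi i).aemeasurable) (fun i => (mi i).comp (measurable_pi_apply i))]
  refine Finset.prod_congr rfl fun i _ => ?_
  rw [← gauss_cov1 v v' (z i) hv hv' (A i) (hA i)]
  exact (measurePreserving_eval (fun _ : Fin n => gaussianReal 0 (Real.toNNReal v')) i).lintegral_comp (mi i)

lemma gauss_cov_int (n : ℕ) (v v' : ℝ) (z : Fin n → ℝ) (hv : 0 < v) (hv' : 0 < v') (f : (Fin n → ℝ) → ℝ)
    (mf : Measurable f) (hf : Integrable f (gaussPrior n v)) :
    Integrable (fun y => Real.exp (Rw n v v' z y) * f (z + y)) (gaussPrior n v') ∧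
    ∫ x, f x ∂gaussPrior n v = ∫ y, Real.exp (Rw n v v' z y) * f (z + y) ∂gaussPrior n v' := by
  have mR : Measurable (fun y => ENNReal.ofReal (Real.exp (Rw n v v' z y))) := by
    unfold Rw; fun_prop
  have e := gauss_cov n v v' z hv hv'
  rw [e, integrable_map_measure mf.aestronglyMeasurable (by fun_prop),
    integrable_withDensity_iff_integrable_smul' mR (by simp)] at hf
  rw [e, integral_map (by fun_prop) mf.aestronglyMeasurable,
    integral_withDensity_eq_integral_toReal_smul mR (by simp)]
  simp only [ENNReal.toReal_ofReal (Real.exp_pos _).le, smul_eq_mul, Function.comp_def] at hf ⊢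
  exact ⟨hf, trivial⟩

lemma gibbs_jensen {X : Type*} [MeasurableSpace X] (ν : Measure X) (H D : X → ℝ)
    (hZ : Integrable (fun x => Real.exp (H x)) ν) (hp : 0 < ∫ x, Real.exp (H x) ∂ν)
    (hD : Integrable (fun x => D x * Real.exp (H x)) ν)
    (hHD : Integrable (fun x => Real.exp (H x + D x)) ν) :
    Real.log (∫ x, Real.exp (H x) ∂ν) + gav ν H D ≤ Real.log (∫ x, Real.exp (H x + D x) ∂ν) := by
  set m := gav ν H D with hm
  have h1 : Real.exp m * ∫ x, Real.exp (H x) ∂ν ≤ ∫ x, Real.exp (H x + D x) ∂ν := by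
    have e : Real.exp m * ∫ x, Real.exp (H x) ∂ν = ∫ x, ((Real.exp m * (1 - m)) * Real.exp (H x) + Real.exp m * (D x * Real.exp (H x))) ∂ν := by
      rw [integral_add (hZ.const_mul _) (hD.const_mul _), integral_const_mul, integral_const_mul]
      have : ∫ x, D x * Real.exp (H x) ∂ν = m * ∫ x, Real.exp (H x) ∂ν := by
        rw [hm, gav]; field_simp
      rw [this]; ring
    rw [e]
    refine integral_mono ((hZ.const_mul _).add (hD.const_mul _)) hHD fun x => ?_
    have := Real.add_one_le_exp (D x - m)
    have h2 : Real.exp (H x + D x) = Real.exp (H x) * Real.exp m * Real.exp (D x - m) := by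
      rw [← Real.exp_add, ← Real.exp_add]; congr 1; ring
    simp only
    rw [h2]
    have := mul_le_mul_of_nonneg_left this (by positivity : 0 ≤ Real.exp (H x) * Real.exp m)
    linarith
  have := Real.log_le_log (by positivity) h1
  rw [Real.log_mul (Real.exp_pos _).ne' hp.ne', Real.log_exp] at this
  linarith

lemma map_neg_tP (n : ℕ) (v r : ℝ) : (tP n v r).map (fun x => -x) = tP n v r := by
  have h0 : (gaussPrior n v).map (fun x => -x) = gaussPrior n v := by
    have := Measure.pi_map_pi (μ := fun _ : Fin n => gaussianReal 0 (Real.toNNReal v)) (f := fun _ y => -y)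
      (fun _ => by fun_prop)
    simp only [gaussianReal_map_neg, neg_zero] at this
    exact this
  have hb : (fun x : Fin n → ℝ => -x) ⁻¹' ballu n r = ballu n r := by
    ext x; simp [ballu]
  unfold tP
  conv_lhs => rw [← hb]
  rw [← Measure.restrict_map (by fun_prop) (measurableSet_ballu n r), h0]

lemma gav_odd (n : ℕ) (v r : ℝ) (H f : (Fin n → ℝ) → ℝ) (hH : ∀ x, H (-x) = H x) (hf : ∀ x, f (-x) = - f x) :
    gav (tP n v r) H f = 0 := by
  have : ∫ x, f x * Real.exp (H x) ∂tP n v r = 0 := by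
    have h1 : ∫ x, f x * Real.exp (H x) ∂tP n v r = ∫ x, f (-x) * Real.exp (H (-x)) ∂tP n v r := by
      conv_lhs => rw [← map_neg_tP]
      exact integral_map_equiv (MeasurableEquiv.neg (Fin n → ℝ)) _
    simp only [hH, hf, neg_mul, integral_neg] at h1
    linarith
  rw [gav, this, zero_div]

lemma continuous_qf {n : ℕ} (p : Fin n × Fin n) : Continuous (qf p) := by
  unfold qf ft; split_ifs <;> fun_prop

lemma continuous_dotself (n : ℕ) : Continuous (fun y : Fin n → ℝ => y ⬝ᵥ y) := by
  unfold dotProduct; fun_prop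

lemma continuous_dotl {n : ℕ} (z : Fin n → ℝ) : Continuous (fun y : Fin n → ℝ => z ⬝ᵥ y) := by
  unfold dotProduct; fun_prop

lemma continuous_Hs (n : ℕ) (s : Fin n → ℝ) (lam : ℝ) (g) : Continuous (Hs n s lam g) := by
  unfold Hs
  have := continuous_qf (n := n)
  have h2 := continuous_dotself n
  have h3 := continuous_dotl s
  fun_prop

lemma ballu_bdd {n : ℕ} (r : ℝ) (f : (Fin n → ℝ) → ℝ) (hf : Continuous f) : ∃ K, ∀ x, x ⬝ᵥ x ≤ r → |f x| ≤ K := by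
  have hc : IsCompact (Metric.closedBall (0 : Fin n → ℝ) (1 + |r|)) := isCompact_closedBall _ _
  obtain ⟨K, hK⟩ := hc.exists_bound_of_continuousOn hf.continuousOn
  refine ⟨K, fun x hx => hK x ?_⟩
  rw [mem_closedBall_zero_iff, pi_norm_le_iff_of_nonneg (by positivity)]
  intro i
  have := coord_mul_le x i i
  rw [abs_mul] at this
  rw [Real.norm_eq_abs]
  nlinarith [abs_nonneg (x i), le_abs_self r, sq_nonneg (|x i| - 1)]

lemma symZ_symm {n : ℕ} (g : Fin n × Fin n → ℝ) : (symZ g)ᵀ = symZ g := by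
  ext i j
  simp only [symZ, transpose_apply, of_apply]
  rcases lt_trichotomy i j with h | h | h
  · rw [if_neg (not_le.2 h), if_pos h.le]
  · subst h; rfl
  · rw [if_pos h.le, if_neg (not_le.2 h)]

lemma Hs_eq (n : ℕ) (s : Fin n → ℝ) (lam : ℝ) (g x) : Hs n s lam g x =
    Real.sqrt (lam / n) * (1 / 2 * (x ⬝ᵥ (symZ g *ᵥ x))) +
      (lam / (2 * n) * (s ⬝ᵥ x) ^ 2 - lam / (4 * n) * (x ⬝ᵥ x) ^ 2) := by
  rw [Hs, ← qf_noise, Finset.mul_sum]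
  congr 1
  exact Finset.sum_congr rfl fun p _ => by ring

lemma Hs_shift (n : ℕ) (hn : 1 ≤ n) (v v' beta lam : ℝ) (hv : 0 < v) (hv' : 0 < v')
    (hb : 1 / v' = 1 / v + lam * beta) (s z : Fin n → ℝ) (g) (y : Fin n → ℝ) :
    Rw n v v' z y + Hs n s lam g (z + y) = Hs n 0 lam g y + ((n / 2 * Real.log (v' / v) + Hs n s lam g z - (z ⬝ᵥ z) / (2 * v)) +
      ((Real.sqrt (lam / n) * (z ⬝ᵥ (symZ g *ᵥ y)) + lam / n * (s ⬝ᵥ z) * (s ⬝ᵥ y) - lam / n * (z ⬝ᵥ y) * (z ⬝ᵥ z + y ⬝ᵥ y)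
        - (z ⬝ᵥ y) / v) +
      (lam / (2 * n) * (s ⬝ᵥ y) ^ 2 - lam / (2 * n) * (z ⬝ᵥ z - n * beta) * (y ⬝ᵥ y) - lam / n * (z ⬝ᵥ y) ^ 2))) := by
  have hn' : (0:ℝ) < n := by exact_mod_cast hn
  have e1 : y ⬝ᵥ (symZ g *ᵥ z) = z ⬝ᵥ (symZ g *ᵥ y) := by
    rw [dotProduct_mulVec, ← mulVec_transpose, symZ_symm, dotProduct_comm]
  have e2 : y ⬝ᵥ z = z ⬝ᵥ y := dotProduct_comm _ _
  simp only [Hs_eq, Rw, mulVec_add, dotProduct_add, add_dotProduct, e1, e2, zero_dotProduct]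
  have e3 : (y ⬝ᵥ y) / (2 * v') = (y ⬝ᵥ y) / (2 * v) + lam * beta * (y ⬝ᵥ y) / 2 := by
    have : (y ⬝ᵥ y) / (2 * v') = (y ⬝ᵥ y) / 2 * (1 / v') := by field_simp
    rw [this, hb]; field_simp
  rw [e3]
  field_simp
  ring

lemma gav_const {X : Type*} [MeasurableSpace X] (ν : Measure X) (H : X → ℝ) (c : ℝ) (hp : 0 < ∫ x, Real.exp (H x) ∂ν) :
    gav ν H (fun _ => c) = c := by
  rw [gav, integral_const_mul]; field_simp

lemma quad_frob {n : ℕ} (z : Fin n → ℝ) (T : Fin n → Fin n → ℝ) :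
    ∑ i, ∑ j, (z i * z j) * T i j ≤ (z ⬝ᵥ z) * Real.sqrt (∑ i, ∑ j, T i j ^ 2) := by
  simp only [← Fintype.sum_prod_type' (f := fun i j => (z i * z j) * T i j), ← Fintype.sum_prod_type' (f := fun i j => T i j ^ 2)]
  refine (Real.sum_mul_le_sqrt_mul_sqrt _ _ _).trans (le_of_eq ?_)
  congr 1
  have : ∑ p : Fin n × Fin n, (z p.1 * z p.2) ^ 2 = (z ⬝ᵥ z) ^ 2 := by
    rw [← sum_mul_dot, Fintype.sum_prod_type]
    exact Finset.sum_congr rfl fun i _ => Finset.sum_congr rfl fun j _ => by ring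
  rw [this, Real.sqrt_sq (dot_self_nonneg z)]

set_option maxHeartbeats 1000000 in
lemma trial (n : ℕ) (hn : 1 ≤ n) (v v' beta lam rho : ℝ) (hv : 0 < v) (hv' : 0 < v') (hl : 0 < lam) (hrho : v' < rho)
    (hb : 1 / v' = 1 / v + lam * beta) (s z : Fin n → ℝ) (g) :
    n / 2 * Real.log (v' / v) + Real.log (∫ y, Real.exp (Hs n 0 lam g y) ∂tP n v' (n * rho)) +
      (Hs n s lam g z - (z ⬝ᵥ z) / (2 * v)) - lam * rho / 2 * |z ⬝ᵥ z - n * beta| -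
      lam / n * ((z ⬝ᵥ z) * Real.sqrt (∑ i, ∑ j, gT (tP n v' (n * rho)) (Hs n 0 lam g) i j ^ 2)) ≤ lZ n v s lam g := by
  have hn' : (0:ℝ) < n := by exact_mod_cast hn
  have hr : n * v' < n * rho := by gcongr
  have hne := tP_ne n v' _ hv' hr
  have hr0 : 0 ≤ n * rho := by nlinarith
  set ν := tP n v' (n * rho) with hν
  have hH : Hs n 0 lam g = (dG n v' 0 lam 0 (n * rho)).H (Real.pi / 2) (Sum.elim g 0) := by
    funext x; rw [dG_H_half]; rfl
  have hI : ∀ f : (Fin n → ℝ) → ℝ, Continuous f → Integrable (fun x => f x * Real.exp (Hs n 0 lam g x)) ν := by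
    intro f hf
    obtain ⟨K, hK⟩ := ballu_bdd (n * rho) f hf
    rw [hH]
    exact dG_int hn v' 0 hl le_rfl hr0 hne _ _ f hf.measurable K hK
  have hZ : Integrable (fun x => Real.exp (Hs n 0 lam g x)) ν := by
    rw [hH]; exact dG_intZ hn v' 0 hl le_rfl hr0 hne _ _
  have hp : 0 < ∫ x, Real.exp (Hs n 0 lam g x) ∂ν := by
    rw [hH]; exact dG_Zpos hn v' 0 hl le_rfl hr0 hne _ _
  set c := n / 2 * Real.log (v' / v) + Hs n s lam g z - (z ⬝ᵥ z) / (2 * v) with hc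
  set od := fun y : Fin n → ℝ => Real.sqrt (lam / n) * (z ⬝ᵥ (symZ g *ᵥ y)) + lam / n * (s ⬝ᵥ z) * (s ⬝ᵥ y) - lam / n * (z ⬝ᵥ y) * (z ⬝ᵥ z + y ⬝ᵥ y)
        - (z ⬝ᵥ y) / v with hod
  set ev := fun y : Fin n → ℝ => lam / (2 * n) * (s ⬝ᵥ y) ^ 2 - lam / (2 * n) * (z ⬝ᵥ z - n * beta) * (y ⬝ᵥ y) - lam / n * (z ⬝ᵥ y) ^ 2 with hev
  have hsh := Hs_shift n hn v v' beta lam hv hv' hb s z g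
  have co : Continuous od := by
    have h1 := continuous_dotself n
    have h2 := continuous_dotl (n := n)
    have h3 : Continuous (fun y : Fin n → ℝ => symZ g *ᵥ y) := by
      unfold mulVec dotProduct; fun_prop
    have h4 := (h2 z).comp h3
    simp only [Function.comp_def] at h4
    have := h2 s
    have := h2 z
    fun_prop
  have ce : Continuous ev := by
    have h1 := continuous_dotself n
    have h2 := continuous_dotl (n := n)
    have := h2 s
    have := h2 z
    fun_prop
  have iz := int_e hn v s hl g
  obtain ⟨j1, j2⟩ := gauss_cov_int n v v' z hv hv' (fun x => Real.exp (Hs n s lam g x)) (measurable_Hsx n lam s g).exp iz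
  have e1 : ∀ y, Real.exp (Rw n v v' z y) * Real.exp (Hs n s lam g (z + y)) = Real.exp (Hs n 0 lam g y + (c + (od y + ev y))) := by
    intro y; rw [← Real.exp_add, hsh]
  simp only [e1] at j1 j2
  have j3 : Integrable (fun y => Real.exp (Hs n 0 lam g y + (c + (od y + ev y)))) ν := j1.restrict
  have hJ := gibbs_jensen ν (Hs n 0 lam g) (fun y => c + (od y + ev y)) hZ hp (hI _ (by fun_prop)) j3
  have hle : ∫ y, Real.exp (Hs n 0 lam g y + (c + (od y + ev y))) ∂ν ≤ ∫ y, Real.exp (Hs n 0 lam g y + (c + (od y + ev y))) ∂gaussPrior n v' :=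
    setIntegral_le_integral j1 (ae_of_all _ fun y => (Real.exp_pos _).le)
  have hpos : 0 < ∫ y, Real.exp (Hs n 0 lam g y + (c + (od y + ev y))) ∂ν := by
    have : NeZero ν := ⟨hne⟩
    exact integral_exp_pos j3
  have hlog := Real.log_le_log hpos hle
  rw [← j2] at hlog
  change _ ≤ lZ n v s lam g at hlog
  have g0 : gav ν (Hs n 0 lam g) od = 0 := by
    refine gav_odd n v' _ _ _ (fun x => ?_) (fun x => ?_)
    · simp [Hs_eq, mulVec_neg]
    · simp only [hod, mulVec_neg, dotProduct_neg, neg_dotProduct, neg_neg]; ring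
  have g1 : gav ν (Hs n 0 lam g) (fun y => c + (od y + ev y)) = c + gav ν (Hs n 0 lam g) ev := by
    rw [gav_add ν _ (fun _ => c) (fun y => od y + ev y) (hI _ (by fun_prop)) (hI _ (by fun_prop)),
      gav_add ν _ od ev (hI _ co) (hI _ ce), g0, gav_const _ _ _ hp, zero_add]
  have cz : Continuous (fun y => (z ⬝ᵥ y) ^ 2) := (continuous_dotl z).pow 2
  have g2 : -(lam * rho / 2 * |z ⬝ᵥ z - n * beta|) + -(lam / n) * gav ν (Hs n 0 lam g) (fun y => (z ⬝ᵥ y) ^ 2) ≤ gav ν (Hs n 0 lam g) ev := by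
    rw [← gav_const_mul]
    have hcc := gav_const ν (Hs n 0 lam g) (-(lam * rho / 2 * |z ⬝ᵥ z - n * beta|)) hp
    rw [← hcc, ← gav_add ν _ _ _ (hI _ (by fun_prop)) (hI _ (by fun_prop))]
    refine gav_mono _ _ _ _ (hI _ (by fun_prop)) (hI _ ce) ?_
    filter_upwards [tP_ae n v' (n * rho)] with y hy
    simp only [hev]
    have a1 : 0 ≤ lam / (2 * n) * (s ⬝ᵥ y) ^ 2 := by positivity
    have a2 : lam / (2 * n) * (z ⬝ᵥ z - n * beta) * (y ⬝ᵥ y) ≤ lam * rho / 2 * |z ⬝ᵥ z - n * beta| := by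
      have hy0 := dot_self_nonneg y
      calc lam / (2 * n) * (z ⬝ᵥ z - n * beta) * (y ⬝ᵥ y) ≤ lam / (2 * n) * |z ⬝ᵥ z - n * beta| * (y ⬝ᵥ y) := by
            gcongr; exact le_abs_self _
        _ ≤ lam / (2 * n) * |z ⬝ᵥ z - n * beta| * (n * rho) := by gcongr
        _ = _ := by field_simp
    linarith
  have g3 : gav ν (Hs n 0 lam g) (fun y => (z ⬝ᵥ y) ^ 2) ≤ (z ⬝ᵥ z) * Real.sqrt (∑ i, ∑ j, gT ν (Hs n 0 lam g) i j ^ 2) := by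
    rw [gav_quad ν _ (fun i j => hI (fun x => x i * x j) (by fun_prop))]
    exact quad_frob z _
  have g4 := mul_le_mul_of_nonneg_left g3 (by positivity : 0 ≤ lam / n)
  simp only [hc] at *
  linarith

def Eb {n : ℕ} (p : Fin n × Fin n) : Matrix (Fin n) (Fin n) ℝ := symZ (Pi.single p 1)

def Wn {n : ℕ} (g : Fin n × Fin n → ℝ) : Matrix (Fin n) (Fin n) ℝ := (Real.sqrt n)⁻¹ • symZ g

def Dn {n : ℕ} (A : Matrix (Fin n) (Fin n) ℝ) : ℝ := A.trace / n

lemma Eb_apply {n : ℕ} (p : Fin n × Fin n) (a b : Fin n) :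
    Eb p a b = if p = (if a ≤ b then (a, b) else (b, a)) then 1 else 0 := by
  simp only [Eb, symZ, of_apply, Pi.single_apply]
  split_ifs <;> simp_all

lemma symZ_sum {n : ℕ} (g : Fin n × Fin n → ℝ) (a b) : symZ g a b = ∑ p, Eb p a b * g p := by
  simp only [Eb_apply, ite_mul, one_mul, zero_mul, Finset.sum_ite_eq', Finset.mem_univ, if_true]
  simp only [symZ, of_apply]
  split_ifs <;> rfl

lemma nv_real {n : ℕ} (p : Fin n × Fin n) : (nv p : ℝ) = if p.1 = p.2 then 2 else 1 := by
  unfold nv; split_ifs <;> norm_num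

lemma Eb_contr {n : ℕ} (a b c d : Fin n) : ∑ p, (nv p : ℝ) * (Eb p a b * Eb p c d) =
    (if a = c then (if b = d then 1 else 0) else 0) + (if a = d then (if b = c then 1 else 0) else 0) := by
  simp only [Eb_apply, mul_ite, mul_one, mul_zero]
  rw [Finset.sum_ite_eq' Finset.univ _ (fun p : Fin n × Fin n => if p = (if a ≤ b then (a, b) else (b, a)) then (nv p : ℝ) else 0)]
  simp only [Finset.mem_univ, if_true, nv_real]
  rcases lt_trichotomy a b with h | h | h <;> rcases lt_trichotomy c d with h' | h' | h'
  all_goals simp only [h.le, h'.le, not_le.2, h, h', if_true, if_false, Prod.mk.injEq, le_refl]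
  all_goals grind

lemma Eb_contr4 {n : ℕ} (F : Fin n → Fin n → Fin n → Fin n → ℝ) :
    ∑ p : Fin n × Fin n, (nv p : ℝ) * ∑ a, ∑ b, ∑ c, ∑ d, F a b c d * (Eb p a b * Eb p c d) =
      ∑ a, ∑ b, (F a b a b + F a b b a) := by
  simp only [Finset.mul_sum]
  rw [Finset.sum_comm]; refine Finset.sum_congr rfl fun a _ => ?_
  rw [Finset.sum_comm]; refine Finset.sum_congr rfl fun b _ => ?_
  have : ∀ c d, ∑ p : Fin n × Fin n, (nv p : ℝ) * (F a b c d * (Eb p a b * Eb p c d)) =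
      F a b c d * ((if a = c then (if b = d then 1 else 0) else 0) + (if a = d then (if b = c then 1 else 0) else 0)) := by
    intro c d
    rw [← Eb_contr, Finset.mul_sum]
    exact Finset.sum_congr rfl fun p _ => by ring
  rw [Finset.sum_comm]
  have h2 : ∀ c, ∑ p : Fin n × Fin n, ∑ d, (nv p : ℝ) * (F a b c d * (Eb p a b * Eb p c d)) =
      ∑ d, F a b c d * ((if a = c then (if b = d then 1 else 0) else 0) + (if a = d then (if b = c then 1 else 0) else 0)) := by
    intro c
    rw [Finset.sum_comm]
    exact Finset.sum_congr rfl fun d _ => this c d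
  simp only [h2, mul_add, Finset.sum_add_distrib]
  congr 1
  · simp [Finset.sum_ite_eq]
  · simp [Finset.sum_ite_eq]

lemma trace_Eb {n : ℕ} (E A : Matrix (Fin n) (Fin n) ℝ) : (E * A).trace = ∑ a, ∑ b, E a b * A b a := by
  simp only [Matrix.trace, Matrix.diag, Matrix.mul_apply]

lemma Eb_tr1 {n : ℕ} (A B : Matrix (Fin n) (Fin n) ℝ) :
    ∑ p, (nv p : ℝ) * ((Eb p * A).trace * (Eb p * B).trace) = (A * Bᵀ).trace + (A * B).trace := by
  have e : ∀ p : Fin n × Fin n, ((Eb p * A).trace * (Eb p * B).trace) =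
      ∑ a, ∑ b, ∑ c, ∑ d, (A b a * B d c) * (Eb p a b * Eb p c d) := by
    intro p
    rw [trace_Eb, trace_Eb, Finset.sum_mul]; refine Finset.sum_congr rfl fun a _ => ?_
    rw [Finset.sum_mul]; refine Finset.sum_congr rfl fun b _ => ?_
    rw [Finset.mul_sum]; refine Finset.sum_congr rfl fun c _ => ?_
    rw [Finset.mul_sum]; refine Finset.sum_congr rfl fun d _ => ?_
    ring
  simp only [e]
  rw [Eb_contr4 (fun a b c d => A b a * B d c), trace_Eb, trace_Eb]
  simp only [Finset.sum_add_distrib, transpose_apply]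
  congr 1
  · exact Finset.sum_comm
  · exact Finset.sum_comm

lemma Eb_tr2 {n : ℕ} (A B : Matrix (Fin n) (Fin n) ℝ) :
    ∑ p, (nv p : ℝ) * (Eb p * (A * Eb p * B)).trace = A.trace * B.trace + (A * Bᵀ).trace := by
  have e : ∀ p : Fin n × Fin n, (Eb p * (A * Eb p * B)).trace =
      ∑ a, ∑ b, ∑ c, ∑ d, (A b c * B d a) * (Eb p a b * Eb p c d) := by
    intro p
    rw [trace_Eb]; refine Finset.sum_congr rfl fun a _ => ?_
    refine Finset.sum_congr rfl fun b _ => ?_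
    rw [Matrix.mul_assoc, Matrix.mul_apply, Finset.mul_sum]; refine Finset.sum_congr rfl fun c _ => ?_
    rw [Matrix.mul_apply, Finset.mul_sum, Finset.mul_sum]; refine Finset.sum_congr rfl fun d _ => ?_
    ring
  simp only [e]
  rw [Eb_contr4 (fun a b c d => A b c * B d a), trace_Eb]
  simp only [Finset.sum_add_distrib, transpose_apply]
  rw [add_comm]
  congr 1
  · simp only [Matrix.trace, Matrix.diag, Finset.sum_mul_sum]
    exact Finset.sum_comm
  · exact Finset.sum_comm

lemma symZ_update {n : ℕ} (g : Fin n × Fin n → ℝ) (p) (y : ℝ) :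
    symZ (Function.update g p y) = symZ g + (y - g p) • Eb p := by
  ext a b
  simp only [Eb, symZ, of_apply, Matrix.add_apply, Matrix.smul_apply, Pi.single_apply, Function.update_apply, smul_eq_mul]
  split_ifs <;> simp_all

lemma Wn_symm {n : ℕ} (g : Fin n × Fin n → ℝ) : (Wn g)ᵀ = Wn g := by
  rw [Wn, transpose_smul, symZ_symm]

/-- directional derivative of `W^k` -/
def dW {n : ℕ} (p : Fin n × Fin n) (k : ℕ) (g : Fin n × Fin n → ℝ) : Matrix (Fin n) (Fin n) ℝ :=
  ∑ m ∈ Finset.range k, Wn g ^ m * ((Real.sqrt n)⁻¹ • Eb p) * Wn g ^ (k - 1 - m)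

lemma dW_succ {n : ℕ} (p : Fin n × Fin n) (k : ℕ) (g) :
    dW p (k + 1) g = dW p k g * Wn g + Wn g ^ k * ((Real.sqrt n)⁻¹ • Eb p) := by
  rw [dW, Finset.sum_range_succ, dW, Finset.sum_mul]
  congr 1
  · refine Finset.sum_congr rfl fun m hm => ?_
    rw [Finset.mem_range] at hm
    rw [Matrix.mul_assoc _ _ (Wn g), ← pow_succ]
    congr 2; omega
  · simp

lemma hasDeriv_Wn {n : ℕ} (g : Fin n × Fin n → ℝ) (p) (a b : Fin n) :
    HasDerivAt (fun y => Wn (Function.update g p y) a b) (((Real.sqrt n)⁻¹ • Eb p) a b) (g p) := by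
  simp only [Wn, symZ_update, Matrix.smul_apply, Matrix.add_apply, smul_eq_mul]
  have := (((((hasDerivAt_id (g p)).sub_const (g p)).mul_const (Eb p a b)).const_add (symZ g a b))).const_mul ((Real.sqrt n)⁻¹)
  simpa using this

lemma hasDeriv_Wpow {n : ℕ} (g : Fin n × Fin n → ℝ) (p) (k : ℕ) : ∀ (a b : Fin n),
    HasDerivAt (fun y => (Wn (Function.update g p y) ^ k) a b) (dW p k g a b) (g p) := by
  induction k with
  | zero => intro a b; simpa [dW] using hasDerivAt_const (g p) _
  | succ k ih =>
    intro a b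
    simp only [pow_succ, Matrix.mul_apply, dW_succ, Matrix.add_apply]
    rw [← Finset.sum_add_distrib]
    refine HasDerivAt.fun_sum fun c _ => ?_
    refine ((ih a c).mul (hasDeriv_Wn g p c b)).congr_deriv ?_
    simp

/-- polynomial growth and measurability -/
def Nice {n : ℕ} (f : (Fin n × Fin n → ℝ) → ℝ) : Prop := Measurable f ∧ ExpGr f

namespace Nice
variable {n : ℕ} {f h : (Fin n × Fin n → ℝ) → ℝ}
lemma const (a : ℝ) : Nice (fun _ : Fin n × Fin n → ℝ => a) := ⟨measurable_const, ExpGr.const a⟩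
lemma coord (p : Fin n × Fin n) : Nice (fun g => g p) := ⟨measurable_pi_apply p, ExpGr.coord p⟩
lemma add (hf : Nice f) (hh : Nice h) : Nice (fun g => f g + h g) := ⟨hf.1.add hh.1, hf.2.add hh.2⟩
lemma mul (hf : Nice f) (hh : Nice h) : Nice (fun g => f g * h g) := ⟨hf.1.mul hh.1, hf.2.mul hh.2⟩
lemma const_mul (a : ℝ) (hf : Nice f) : Nice (fun g => a * f g) := (const a).mul hf
lemma sum {κ : Type*} (s : Finset κ) {F : κ → (Fin n × Fin n → ℝ) → ℝ} (hF : ∀ a ∈ s, Nice (F a)) :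
    Nice (fun g => ∑ a ∈ s, F a g) :=
  ⟨Finset.measurable_fun_sum s fun a ha => (hF a ha).1, ExpGr.sum s fun a ha => (hF a ha).2⟩
lemma int (hf : Nice f) : Integrable f (gpi n) := hf.2.integrable _ hf.1.aestronglyMeasurable
end Nice

/-- matrices with nice entries -/
def NiceM {n : ℕ} (A : (Fin n × Fin n → ℝ) → Matrix (Fin n) (Fin n) ℝ) : Prop := ∀ a b, Nice fun g => A g a b

namespace NiceM
variable {n : ℕ} {A B : (Fin n × Fin n → ℝ) → Matrix (Fin n) (Fin n) ℝ}
lemma const (M : Matrix (Fin n) (Fin n) ℝ) : NiceM (fun _ => M) := fun a b => Nice.const _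
lemma add (hA : NiceM A) (hB : NiceM B) : NiceM (fun g => A g + B g) := fun a b => (hA a b).add (hB a b)
lemma smul (c : ℝ) (hA : NiceM A) : NiceM (fun g => c • A g) := fun a b => (hA a b).const_mul c
lemma mul (hA : NiceM A) (hB : NiceM B) : NiceM (fun g => A g * B g) := fun a b => by
  simp only [Matrix.mul_apply]
  exact Nice.sum _ fun c _ => (hA a c).mul (hB c b)
lemma symZ : NiceM (fun g : Fin n × Fin n → ℝ => symZ g) := fun a b => by
  simp only [_root_.symZ, of_apply]
  split_ifs <;> exact Nice.coord _
lemma Wn : NiceM (fun g : Fin n × Fin n → ℝ => Wn g) := smul _ symZ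
lemma pow (hA : NiceM A) (k : ℕ) : NiceM (fun g => A g ^ k) := by
  induction k with
  | zero => simpa using const 1
  | succ k ih => simp only [pow_succ]; exact ih.mul hA
lemma sum {κ : Type*} (s : Finset κ) {F : κ → (Fin n × Fin n → ℝ) → Matrix (Fin n) (Fin n) ℝ}
    (hF : ∀ a ∈ s, NiceM (F a)) : NiceM (fun g => ∑ a ∈ s, F a g) := fun a b => by
  simp only [Matrix.sum_apply]
  exact Nice.sum _ fun c hc => hF c hc a b
lemma dW (p) (k : ℕ) : NiceM (dW (n := n) p k) := by
  unfold _root_.dW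
  exact sum _ fun m _ => ((Wn.pow m).mul (const _)).mul (Wn.pow _)
lemma trace (hA : NiceM A) : Nice (fun g => (A g).trace) := Nice.sum _ fun a _ => hA a a
lemma Dn (hA : NiceM A) : Nice (fun g => Dn (A g)) := by
  unfold _root_.Dn
  simp only [div_eq_inv_mul]
  exact hA.trace.const_mul _
end NiceM

lemma hasDeriv_Dn {n : ℕ} (g : Fin n × Fin n → ℝ) (p) (k : ℕ) :
    HasDerivAt (fun y => Dn (Wn (Function.update g p y) ^ k)) (Dn (dW p k g)) (g p) := by
  unfold Dn Matrix.trace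
  exact (HasDerivAt.fun_sum fun a _ => hasDeriv_Wpow g p k a a).div_const _

/-- product of normalised trace moments -/
def Pl {n : ℕ} (l : List ℕ) (g : Fin n × Fin n → ℝ) : ℝ := (l.map fun k => Dn (Wn g ^ k)).prod

def dPl {n : ℕ} (p : Fin n × Fin n) : List ℕ → (Fin n × Fin n → ℝ) → ℝ
  | [], _ => 0
  | k :: l, g => Dn (dW p k g) * Pl l g + Dn (Wn g ^ k) * dPl p l g

lemma Pl_cons {n : ℕ} (k l) (g : Fin n × Fin n → ℝ) : Pl (k :: l) g = Dn (Wn g ^ k) * Pl l g := by simp [Pl]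

lemma nice_Pl {n : ℕ} (l : List ℕ) : Nice (Pl (n := n) l) := by
  induction l with
  | nil =>
    have : Pl (n := n) [] = fun _ => 1 := funext fun g => by simp [Pl]
    rw [this]; exact Nice.const 1
  | cons k l ih =>
    have : Pl (n := n) (k :: l) = fun g => Dn (Wn g ^ k) * Pl l g := funext fun g => Pl_cons k l g
    rw [this]; exact (NiceM.Wn.pow k).Dn.mul ih

lemma nice_dPl {n : ℕ} (p) (l : List ℕ) : Nice (dPl (n := n) p l) := by
  induction l with
  | nil => exact Nice.const (n := n) 0
  | cons k l ih => exact ((NiceM.dW p k).Dn.mul (nice_Pl l)).add ((NiceM.Wn.pow k).Dn.mul ih)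

lemma hasDeriv_Pl {n : ℕ} (g : Fin n × Fin n → ℝ) (p) (l : List ℕ) :
    HasDerivAt (fun y => Pl l (Function.update g p y)) (dPl p l g) (g p) := by
  induction l with
  | nil => simpa [Pl, dPl] using hasDerivAt_const (g p) (1:ℝ)
  | cons k l ih =>
    simp only [Pl_cons, dPl]
    refine ((hasDeriv_Dn g p k).mul ih).congr_deriv ?_
    simp

lemma transpose_Wpow {n : ℕ} (g : Fin n × Fin n → ℝ) (k : ℕ) : (Wn g ^ k)ᵀ = Wn g ^ k := by
  rw [transpose_pow, Wn_symm]

lemma tr_symZ {n : ℕ} (g : Fin n × Fin n → ℝ) (A : Matrix (Fin n) (Fin n) ℝ) :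
    (symZ g * A).trace = ∑ p, g p * (Eb p * A).trace := by
  have : symZ g = ∑ p, g p • Eb p := by
    ext a b
    rw [symZ_sum, Matrix.sum_apply]
    exact Finset.sum_congr rfl fun p _ => by simp [mul_comm]
  rw [this, Finset.sum_mul, Matrix.trace_sum]
  exact Finset.sum_congr rfl fun p _ => by simp

lemma rec_id1 {n : ℕ} (g : Fin n × Fin n → ℝ) (k : ℕ) :
    ∑ p, (nv p : ℝ) * (Eb p * dW p k g).trace =
      (Real.sqrt n)⁻¹ * (∑ m ∈ Finset.range k, (Wn g ^ m).trace * (Wn g ^ (k - 1 - m)).trace +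
        k * (Wn g ^ (k - 1)).trace) := by
  have e : ∀ p : Fin n × Fin n, (nv p : ℝ) * (Eb p * dW p k g).trace =
      ∑ m ∈ Finset.range k, (Real.sqrt n)⁻¹ * ((nv p : ℝ) * (Eb p * (Wn g ^ m * Eb p * Wn g ^ (k - 1 - m))).trace) := by
    intro p
    rw [dW, Finset.mul_sum, Matrix.trace_sum, Finset.mul_sum]
    refine Finset.sum_congr rfl fun m _ => ?_
    simp only [Matrix.mul_smul, Matrix.smul_mul, Matrix.trace_smul, smul_eq_mul]
    ring
  simp only [e]
  rw [Finset.sum_comm]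
  have e2 : ∀ m ∈ Finset.range k, ∑ p : Fin n × Fin n, (Real.sqrt n)⁻¹ * ((nv p : ℝ) * (Eb p * (Wn g ^ m * Eb p * Wn g ^ (k - 1 - m))).trace)
      = (Real.sqrt n)⁻¹ * ((Wn g ^ m).trace * (Wn g ^ (k - 1 - m)).trace + (Wn g ^ (k-1)).trace) := by
    intro m hm
    rw [Finset.mem_range] at hm
    rw [← Finset.mul_sum, Eb_tr2, transpose_Wpow, ← pow_add]
    congr 5; omega
  rw [Finset.sum_congr rfl e2, ← Finset.mul_sum, Finset.sum_add_distrib]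
  simp

lemma Dn_dW {n : ℕ} (g : Fin n × Fin n → ℝ) (p) (m : ℕ) :
    Dn (dW p m g) = (Real.sqrt n)⁻¹ * m * (Eb p * Wn g ^ (m - 1)).trace / n := by
  rw [Dn, dW, Matrix.trace_sum]
  have : ∀ j ∈ Finset.range m, (Wn g ^ j * ((Real.sqrt n)⁻¹ • Eb p) * Wn g ^ (m - 1 - j)).trace =
      (Real.sqrt n)⁻¹ * (Eb p * Wn g ^ (m - 1)).trace := by
    intro j hj
    rw [Finset.mem_range] at hj
    rw [Matrix.mul_assoc, Matrix.trace_mul_comm, Matrix.mul_assoc, ← pow_add]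
    simp only [Matrix.smul_mul, Matrix.trace_smul, smul_eq_mul]
    congr 5; omega
  rw [Finset.sum_congr rfl this]
  simp; ring

def Rl (k : ℕ) : List ℕ → List (ℕ × List ℕ)
  | [] => []
  | m :: l => (m, (k + (m - 1)) :: l) :: (Rl k l).map fun q => (q.1, m :: q.2)

lemma Rl_sum (k : ℕ) (l : List ℕ) : ∀ q ∈ Rl k l, q.2.sum ≤ k + l.sum := by
  induction l with
  | nil => simp [Rl]
  | cons m l ih =>
    intro q hq
    rw [Rl, List.mem_cons, List.mem_map] at hq
    rcases hq with rfl | ⟨q', h, rfl⟩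
    · simp only [List.sum_cons]; omega
    · have := ih q' h
      simp only [List.sum_cons]; omega

lemma rec_id2 {n : ℕ} (hn : 0 < n) (g : Fin n × Fin n → ℝ) (k : ℕ) (l : List ℕ) :
    ∑ p, (nv p : ℝ) * ((Eb p * Wn g ^ k).trace * dPl p l g) =
      2 * (Real.sqrt n)⁻¹ * ((Rl k l).map fun q => (q.1 : ℝ) * Pl q.2 g).sum := by
  have hn' : (n:ℝ) ≠ 0 := by positivity
  induction l with
  | nil => simp [dPl, Rl]
  | cons m l ih =>
    have e : ∀ p : Fin n × Fin n, (nv p : ℝ) * ((Eb p * Wn g ^ k).trace * dPl p (m :: l) g) =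
       ((Real.sqrt n)⁻¹ * m / n * Pl l g) * ((nv p : ℝ) * ((Eb p * Wn g ^ k).trace * (Eb p * Wn g ^ (m-1)).trace))
        + Dn (Wn g ^ m) * ((nv p : ℝ) * ((Eb p * Wn g ^ k).trace * dPl p l g)) := by
      intro p; rw [dPl, Dn_dW]; ring
    rw [Finset.sum_congr rfl fun p _ => e p, Finset.sum_add_distrib, ← Finset.mul_sum, ← Finset.mul_sum, ih, Eb_tr1,
      transpose_Wpow, ← pow_add, Rl, List.map_cons, List.sum_cons, List.map_map]
    have : ((Rl k l).map ((fun q : ℕ × List ℕ => (q.1 : ℝ) * Pl q.2 g) ∘ fun q => (q.1, m :: q.2))) =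
        (Rl k l).map (fun q => Dn (Wn g ^ m) * ((q.1 : ℝ) * Pl q.2 g)) := by
      refine List.map_congr_left fun q _ => ?_
      simp only [Function.comp, Pl_cons]; ring
    rw [this, List.sum_map_mul_left, Pl_cons]
    simp only [Dn]
    field_simp
    ring

lemma int_list_sum {n : ℕ} (L : List (ℕ × List ℕ)) :
    Integrable (fun g : Fin n × Fin n → ℝ => (L.map fun q => (q.1 : ℝ) * Pl q.2 g).sum) (gpi n) ∧
    ∫ g : Fin n × Fin n → ℝ, (L.map fun q => (q.1 : ℝ) * Pl q.2 g).sum ∂gpi n =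
      (L.map fun q => (q.1 : ℝ) * ∫ g, Pl q.2 g ∂gpi n).sum := by
  induction L with
  | nil => simp
  | cons q L ih =>
    have h1 : Integrable (fun g : Fin n × Fin n → ℝ => (q.1 : ℝ) * Pl q.2 g) (gpi n) := (nice_Pl q.2).int.const_mul _
    simp only [List.map_cons, List.sum_cons]
    refine ⟨h1.add ih.1, ?_⟩
    rw [integral_add h1 ih.1, ih.2, integral_const_mul]

lemma Pl_rec (n : ℕ) (hn : 0 < n) (k : ℕ) (l : List ℕ) :
    ∫ g, Pl ((k + 1) :: l) g ∂gpi n =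
      ∑ m ∈ Finset.range k, ∫ g, Pl (m :: (k - 1 - m) :: l) g ∂gpi n
      + (k / n) * ∫ g, Pl ((k - 1) :: l) g ∂gpi n
      + (2 / n ^ 2) * ((Rl k l).map fun q => (q.1 : ℝ) * ∫ g, Pl q.2 g ∂gpi n).sum := by
  have hn' : (n:ℝ) ≠ 0 := by positivity
  have hnn : (0:ℝ) ≤ n := by positivity
  have hs : (Real.sqrt n)⁻¹ * (Real.sqrt n)⁻¹ = 1 / n := by
    rw [← mul_inv, Real.mul_self_sqrt hnn, one_div]
  set r := (Real.sqrt n)⁻¹ with hr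
  have e0 : ∀ g : Fin n × Fin n → ℝ, Pl ((k+1) :: l) g =
      ∑ p, (r / n) * (g p * ((Eb p * Wn g ^ k).trace * Pl l g)) := by
    intro g
    rw [Pl_cons, Dn, pow_succ']
    nth_rewrite 1 [Wn]
    rw [Matrix.smul_mul, Matrix.trace_smul, tr_symZ, ← Finset.mul_sum, smul_eq_mul, ← hr]
    have : ∀ p, g p * ((Eb p * Wn g ^ k).trace * Pl l g) = (g p * (Eb p * Wn g ^ k).trace) * Pl l g := fun p => by ring
    simp only [this]
    rw [← Finset.sum_mul]; ring
  have nf : ∀ p, Nice (fun g : Fin n × Fin n → ℝ => (Eb p * Wn g ^ k).trace * Pl l g) := fun p =>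
    ((NiceM.const _).mul (NiceM.Wn.pow k)).trace.mul (nice_Pl l)
  have nf1 : ∀ p, Nice (fun g : Fin n × Fin n → ℝ => (Eb p * dW p k g).trace * Pl l g) := fun p =>
    ((NiceM.const _).mul (NiceM.dW p k)).trace.mul (nice_Pl l)
  have nf2 : ∀ p, Nice (fun g : Fin n × Fin n → ℝ => (Eb p * Wn g ^ k).trace * dPl p l g) := fun p =>
    ((NiceM.const _).mul (NiceM.Wn.pow k)).trace.mul (nice_dPl p l)
  have st : ∀ p, ∫ g, g p * ((Eb p * Wn g ^ k).trace * Pl l g) ∂gpi n =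
      nv p * ∫ g, ((Eb p * dW p k g).trace * Pl l g + (Eb p * Wn g ^ k).trace * dPl p l g) ∂gpi n := by
    intro p
    refine stein_gr (fun p => nv p) (fun p => nv_ne p) p (fun g => (Eb p * Wn g ^ k).trace * Pl l g)
      (fun g => (Eb p * dW p k g).trace * Pl l g + (Eb p * Wn g ^ k).trace * dPl p l g) ?_ (nf p).1
      ((nf1 p).add (nf2 p)).1 (nf p).2 ((nf1 p).add (nf2 p)).2
    intro g
    have h1 : HasDerivAt (fun y => (Eb p * Wn (Function.update g p y) ^ k).trace) ((Eb p * dW p k g).trace) (g p) := by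
      simp only [trace_Eb]
      exact HasDerivAt.fun_sum fun a _ => HasDerivAt.fun_sum fun b _ => (hasDeriv_Wpow g p k b a).const_mul _
    refine (h1.mul (hasDeriv_Pl g p l)).congr_deriv ?_
    simp
  simp only [e0]
  rw [integral_finsetSum _ fun p _ => (((Nice.coord p).mul (nf p)).int.const_mul _)]
  simp only [integral_const_mul, st]
  have e1 : ∀ g : Fin n × Fin n → ℝ, ∑ p, (r/n) * ((nv p : ℝ) * ((Eb p * dW p k g).trace * Pl l g + (Eb p * Wn g ^ k).trace * dPl p l g))
     = (∑ m ∈ Finset.range k, Pl (m :: (k - 1 - m) :: l) g + (k/n) * Pl ((k-1) :: l) g)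
       + (2/n^2) * ((Rl k l).map fun q => (q.1 : ℝ) * Pl q.2 g).sum := by
    intro g
    have : ∀ p : Fin n × Fin n, (r/n) * ((nv p : ℝ) * ((Eb p * dW p k g).trace * Pl l g + (Eb p * Wn g ^ k).trace * dPl p l g))
        = (r/n * Pl l g) * ((nv p : ℝ) * (Eb p * dW p k g).trace) + (r/n) * ((nv p : ℝ) * ((Eb p * Wn g ^ k).trace * dPl p l g)) := fun p => by ring
    rw [Finset.sum_congr rfl fun p _ => this p, Finset.sum_add_distrib, ← Finset.mul_sum, ← Finset.mul_sum, rec_id1, rec_id2 hn]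
    rw [← hr]
    congr 1
    · have e3 : ∀ m, Pl (m :: (k - 1 - m) :: l) g = (1/n^2 * Pl l g) * ((Wn g ^ m).trace * (Wn g ^ (k - 1 - m)).trace) := by
        intro m; rw [Pl_cons, Pl_cons, Dn, Dn]; field_simp
      simp only [e3]
      rw [← Finset.mul_sum, Pl_cons, Dn]
      have : r / n * Pl l g * (r * (∑ m ∈ Finset.range k, (Wn g ^ m).trace * (Wn g ^ (k - 1 - m)).trace + k * (Wn g ^ (k-1)).trace))
         = (r * r) / n * Pl l g * (∑ m ∈ Finset.range k, (Wn g ^ m).trace * (Wn g ^ (k - 1 - m)).trace + k * (Wn g ^ (k-1)).trace) := by ring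
      rw [this, hs]
      field_simp
    · have : r / n * (2 * r * ((Rl k l).map fun q => (q.1 : ℝ) * Pl q.2 g).sum) = (r * r) * 2 / n * ((Rl k l).map fun q => (q.1 : ℝ) * Pl q.2 g).sum := by ring
      rw [this, hs]
      field_simp
  have e2 : ∑ p, (r/n) * ((nv p : ℝ) * ∫ g, ((Eb p * dW p k g).trace * Pl l g + (Eb p * Wn g ^ k).trace * dPl p l g) ∂gpi n)
     = ∫ g, ∑ p, (r/n) * ((nv p : ℝ) * ((Eb p * dW p k g).trace * Pl l g + (Eb p * Wn g ^ k).trace * dPl p l g)) ∂gpi n := by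
    rw [integral_finsetSum _ fun p _ => ((((nf1 p).add (nf2 p)).int.const_mul _).const_mul _)]
    simp only [integral_const_mul]
  rw [e2]
  simp only [e1]
  have i1 : Integrable (fun g : Fin n × Fin n → ℝ => ∑ m ∈ Finset.range k, Pl (m :: (k - 1 - m) :: l) g) (gpi n) :=
    integrable_finsetSum _ fun m _ => (nice_Pl _).int
  have i2 : Integrable (fun g : Fin n × Fin n → ℝ => ((k:ℝ)/n) * Pl ((k-1) :: l) g) (gpi n) := (nice_Pl _).int.const_mul _
  have i3 := int_list_sum (n := n) (Rl k l)
  have i12 : Integrable (fun g : Fin n × Fin n → ℝ => ∑ m ∈ Finset.range k, Pl (m :: (k - 1 - m) :: l) g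
      + ((k:ℝ)/n) * Pl ((k-1) :: l) g) (gpi n) := i1.add i2
  rw [integral_add i12 (i3.1.const_mul _), integral_add i1 i2, integral_const_mul, integral_const_mul, i3.2,
    integral_finsetSum _ fun m _ => (nice_Pl _).int]

def cc : ℕ → ℝ
  | 0 => 1
  | k + 1 => ∑ m : Fin k, cc m * cc (k - 1 - m)
decreasing_by all_goals omega

lemma cc_zero : cc 0 = 1 := by rw [cc]
lemma cc_succ (k : ℕ) : cc (k + 1) = ∑ m ∈ Finset.range k, cc m * cc (k - 1 - m) := by
  rw [cc, Finset.sum_range]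

lemma Pl_perm {n : ℕ} {l l' : List ℕ} (h : l.Perm l') (g : Fin n × Fin n → ℝ) : Pl l g = Pl l' g := by
  unfold Pl; exact (h.map _).prod_eq

lemma Pl_zero {n : ℕ} (hn : 0 < n) {l : List ℕ} (h : ∀ k ∈ l, k = 0) (g : Fin n × Fin n → ℝ) : Pl l g = 1 := by
  have hn' : (n:ℝ) ≠ 0 := by positivity
  unfold Pl
  refine List.prod_eq_one fun x hx => ?_
  rw [List.mem_map] at hx
  obtain ⟨k, hk, rfl⟩ := hx
  rw [h k hk]
  simp [Dn, hn']

lemma Rl_lim (L : List (ℕ × List ℕ)) (h : ∀ q ∈ L, ∃ c : ℝ, Tendsto (fun n : ℕ => ∫ g, Pl q.2 g ∂gpi n) atTop (nhds c)) :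
    ∃ c : ℝ, Tendsto (fun n : ℕ => (L.map fun q => (q.1 : ℝ) * ∫ g, Pl q.2 g ∂gpi n).sum) atTop (nhds c) := by
  induction L with
  | nil => exact ⟨0, by simp⟩
  | cons q L ih =>
    obtain ⟨c, hc⟩ := ih fun q' h' => h q' (List.mem_cons_of_mem _ h')
    obtain ⟨d, hd⟩ := h q List.mem_cons_self
    simp only [List.map_cons, List.sum_cons]
    exact ⟨_, (hd.const_mul _).add hc⟩

lemma Pl_lim (N : ℕ) : ∀ l : List ℕ, l.sum < N →
    Tendsto (fun n : ℕ => ∫ g, Pl l g ∂gpi n) atTop (nhds (l.map cc).prod) := by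
  induction N with
  | zero => intro l h; omega
  | succ N ih =>
    intro l hl
    by_cases h0 : ∀ k ∈ l, k = 0
    · have : (l.map cc).prod = 1 := by
        refine List.prod_eq_one fun x hx => ?_
        rw [List.mem_map] at hx
        obtain ⟨k, hk, rfl⟩ := hx
        rw [h0 k hk, cc_zero]
      rw [this]
      refine tendsto_const_nhds.congr' ?_
      filter_upwards [eventually_gt_atTop 0] with n hn
      simp only [Pl_zero hn h0]
      simp [gpi]
    · push Not at h0
      obtain ⟨k', hk, hk0⟩ := h0
      obtain ⟨k, rfl⟩ := Nat.exists_eq_succ_of_ne_zero hk0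
      have hp := List.perm_cons_erase hk
      set l' := l.erase (k+1)
      have hs : l.sum = k + 1 + l'.sum := by rw [hp.sum_eq, List.sum_cons]
      have e : (l.map cc).prod = ∑ m ∈ Finset.range k, ((m :: (k-1-m) :: l').map cc).prod + 0 + 0 := by
        rw [(hp.map _).prod_eq, List.map_cons, List.prod_cons, cc_succ, Finset.sum_mul]
        simp [mul_assoc]
      rw [e]
      have hn0 : Tendsto (fun n : ℕ => (1:ℝ)/n) atTop (nhds 0) := tendsto_one_div_atTop_nhds_zero_nat
      obtain ⟨c, hc⟩ := Rl_lim (Rl k l') fun q hq => ⟨_, ih q.2 (by have := Rl_sum k l' q hq; omega)⟩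
      have t3 : Tendsto (fun n : ℕ => (2 / (n:ℝ)^2) * ((Rl k l').map fun q => (q.1 : ℝ) * ∫ g, Pl q.2 g ∂gpi n).sum) atTop (nhds 0) := by
        have := ((hn0.mul hn0).const_mul 2).mul hc
        simp only [mul_zero, zero_mul] at this
        refine this.congr fun n => ?_
        congr 1; ring
      have t2 : Tendsto (fun n : ℕ => ((k:ℝ) / (n:ℝ)) * ∫ g, Pl ((k-1) :: l') g ∂gpi n) atTop (nhds 0) := by
        by_cases hk0 : k = 0
        · subst hk0; simp
        have := (hn0.const_mul (k:ℝ)).mul (ih ((k-1) :: l') (by simp only [List.sum_cons]; omega))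
        simp only [mul_zero, zero_mul] at this
        refine this.congr fun n => ?_
        congr 1; ring
      have t1 : Tendsto (fun n : ℕ => ∑ m ∈ Finset.range k, ∫ g, Pl (m :: (k - 1 - m) :: l') g ∂gpi n) atTop
          (nhds (∑ m ∈ Finset.range k, ((m :: (k-1-m) :: l').map cc).prod)) := by
        refine tendsto_finset_sum _ fun m hm => ih _ ?_
        rw [Finset.mem_range] at hm
        simp only [List.sum_cons]; omega
      refine ((t1.add t2).add t3).congr' ?_
      filter_upwards [eventually_gt_atTop 0] with n hn
      rw [← Pl_rec n hn]
      exact integral_congr_ae (Eventually.of_forall fun g => (Pl_perm hp g).symm)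

/-- semicircle functional on polynomials -/
def Lf : Polynomial ℝ →ₗ[ℝ] ℝ := Polynomial.lsum fun k => cc k • LinearMap.id

lemma Lf_mono (k : ℕ) (a : ℝ) : Lf (Polynomial.monomial k a) = a * cc k := by
  simp [Lf, Polynomial.lsum_apply, mul_comm]

lemma Lf_pow (k : ℕ) : Lf (Polynomial.X ^ k) = cc k := by
  rw [Polynomial.X_pow_eq_monomial, Lf_mono, one_mul]

def pW {n : ℕ} (P : Polynomial ℝ) (g : Fin n × Fin n → ℝ) : Matrix (Fin n) (Fin n) ℝ := Polynomial.aeval (Wn g) P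

lemma pW_add {n : ℕ} (P Q : Polynomial ℝ) (g : Fin n × Fin n → ℝ) : pW (P + Q) g = pW P g + pW Q g := by simp [pW]
lemma pW_mul {n : ℕ} (P Q : Polynomial ℝ) (g : Fin n × Fin n → ℝ) : pW (P * Q) g = pW P g * pW Q g := by simp [pW]
lemma pW_mono {n : ℕ} (k a) (g : Fin n × Fin n → ℝ) : pW (Polynomial.monomial k a) g = a • Wn g ^ k := by
  simp [pW, Polynomial.aeval_monomial, Algebra.algebraMap_eq_smul_one]

lemma nice_pW {n : ℕ} (P : Polynomial ℝ) : NiceM (pW (n := n) P) := by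
  induction P using Polynomial.induction_on' with
  | add p q hp hq =>
    have : pW (n := n) (p + q) = fun g => pW p g + pW q g := funext fun g => pW_add p q g
    rw [this]; exact hp.add hq
  | monomial k a =>
    have : pW (n := n) (Polynomial.monomial k a) = fun g => a • Wn g ^ k := funext fun g => pW_mono k a g
    rw [this]; exact (NiceM.Wn.pow k).smul a

lemma pW_symm {n : ℕ} (P : Polynomial ℝ) (g : Fin n × Fin n → ℝ) : (pW P g)ᵀ = pW P g := by
  induction P using Polynomial.induction_on' with
  | add p q hp hq => rw [pW_add, transpose_add, hp, hq]
  | monomial k a => rw [pW_mono, transpose_smul, transpose_Wpow]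

lemma Dn_add {n : ℕ} (A B : Matrix (Fin n) (Fin n) ℝ) : Dn (A + B) = Dn A + Dn B := by simp [Dn, add_div]
lemma Dn_smul {n : ℕ} (c : ℝ) (B : Matrix (Fin n) (Fin n) ℝ) : Dn (c • B) = c * Dn B := by simp [Dn, mul_div_assoc]

lemma Dn_lim (P : Polynomial ℝ) : Tendsto (fun n : ℕ => ∫ g, Dn (pW P g) ∂gpi n) atTop (nhds (Lf P)) := by
  induction P using Polynomial.induction_on' with
  | add p q hp hq =>
    rw [map_add]
    refine (hp.add hq).congr fun n => ?_
    simp only [pW_add, Dn_add]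
    rw [integral_add (nice_pW p).Dn.int (nice_pW q).Dn.int]
  | monomial k a =>
    rw [Lf_mono]
    have := (Pl_lim (k+1) [k] (by simp)).const_mul a
    simp only [Pl, List.map_cons, List.map_nil, List.prod_cons, List.prod_nil, mul_one] at this
    refine this.congr fun n => ?_
    simp only [pW_mono, Dn_smul, integral_const_mul]

lemma Dn2_lim (P Q : Polynomial ℝ) : Tendsto (fun n : ℕ => ∫ g, Dn (pW P g) * Dn (pW Q g) ∂gpi n) atTop (nhds (Lf P * Lf Q)) := by
  induction P using Polynomial.induction_on' with
  | add p q hp hq =>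
    rw [map_add, add_mul]
    refine (hp.add hq).congr fun n => ?_
    simp only [pW_add, Dn_add, add_mul]
    rw [integral_add ((nice_pW p).Dn.mul (nice_pW Q).Dn).int ((nice_pW q).Dn.mul (nice_pW Q).Dn).int]
  | monomial k a =>
    induction Q using Polynomial.induction_on' with
    | add p q hp hq =>
      rw [map_add, mul_add]
      refine (hp.add hq).congr fun n => ?_
      simp only [pW_add, Dn_add, mul_add]
      rw [integral_add ((nice_pW _).Dn.mul (nice_pW _).Dn).int ((nice_pW _).Dn.mul (nice_pW _).Dn).int]
    | monomial j b =>
      rw [Lf_mono, Lf_mono]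
      have := (Pl_lim (k+j+1) [k, j] (by simp)).const_mul (a * b)
      simp only [Pl, List.map_cons, List.map_nil, List.prod_cons, List.prod_nil, mul_one] at this
      rw [show a * cc k * (b * cc j) = a * b * (cc k * cc j) by ring]
      refine this.congr fun n => ?_
      rw [← integral_const_mul]
      simp only [pW_mono, Dn_smul]
      refine integral_congr_ae (Eventually.of_forall fun g => ?_)
      simp only []; ring

/-! Gaussian quadratic forms in `s` -/

lemma hasDeriv_mulVec {n : ℕ} (A : Matrix (Fin n) (Fin n) ℝ) (s : Fin n → ℝ) (i j : Fin n) :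
    HasDerivAt (fun y => (A *ᵥ Function.update s i y) j) (A j i) (s i) := by
  simp only [Matrix.mulVec, dotProduct]
  have : ∀ k ∈ Finset.univ, HasDerivAt (fun y => A j k * Function.update s i y k) (A j k * (Pi.single i (1:ℝ) : Fin n → ℝ) k) (s i) := by
    intro k _
    refine HasDerivAt.const_mul _ ?_
    by_cases h : k = i
    · subst h; simpa using hasDerivAt_id' (s k)
    · simpa [h] using hasDerivAt_const (s i) (s k)
  refine (HasDerivAt.fun_sum this).congr_deriv ?_
  simp [Pi.single_apply]

lemma hasDeriv_quad {n : ℕ} (A : Matrix (Fin n) (Fin n) ℝ) (hA : Aᵀ = A) (s : Fin n → ℝ) (i : Fin n) :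
    HasDerivAt (fun y => Function.update s i y ⬝ᵥ (A *ᵥ Function.update s i y)) (2 * (A *ᵥ s) i) (s i) := by
  have h1 : ∀ k ∈ Finset.univ, HasDerivAt (fun y => Function.update s i y k * (A *ᵥ Function.update s i y) k)
      ((Pi.single i (1:ℝ) : Fin n → ℝ) k * (A *ᵥ s) k + s k * A k i) (s i) := by
    intro k _
    have h2 : HasDerivAt (fun y => Function.update s i y k) ((Pi.single i (1:ℝ) : Fin n → ℝ) k) (s i) := by
      by_cases h : k = i
      · subst h; simpa using hasDerivAt_id' (s k)
      · simpa [h] using hasDerivAt_const (s i) (s k)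
    refine (h2.mul (hasDeriv_mulVec A s i k)).congr_deriv ?_
    simp
  refine (HasDerivAt.fun_sum h1).congr_deriv ?_
  rw [Finset.sum_add_distrib]
  have : ∑ k, s k * A k i = (A *ᵥ s) i := by
    simp only [Matrix.mulVec, dotProduct]
    refine Finset.sum_congr rfl fun k _ => ?_
    rw [← hA, transpose_apply, hA, mul_comm]
  rw [this]
  simp [Pi.single_apply]; ring

lemma expGr_mulVec {n : ℕ} (A : Matrix (Fin n) (Fin n) ℝ) (i : Fin n) : ExpGr (fun s : Fin n → ℝ => (A *ᵥ s) i) := by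
  simp only [Matrix.mulVec, dotProduct]
  exact ExpGr.sum _ fun k _ => (ExpGr.coord k).const_mul _

lemma meas_mulVec {n : ℕ} (A : Matrix (Fin n) (Fin n) ℝ) (i : Fin n) : Measurable (fun s : Fin n → ℝ => (A *ᵥ s) i) := by
  simp only [Matrix.mulVec, dotProduct]
  fun_prop

lemma expGr_quad {n : ℕ} (A : Matrix (Fin n) (Fin n) ℝ) : ExpGr (fun s : Fin n → ℝ => s ⬝ᵥ (A *ᵥ s)) := by
  simp only [dotProduct]
  exact ExpGr.sum _ fun k _ => (ExpGr.coord k).mul (expGr_mulVec A k)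

lemma meas_quad {n : ℕ} (A : Matrix (Fin n) (Fin n) ℝ) : Measurable (fun s : Fin n → ℝ => s ⬝ᵥ (A *ᵥ s)) := by
  simp only [Matrix.mulVec, dotProduct]
  fun_prop

lemma quad_mean {n : ℕ} (v : ℝ) (hv : 0 < v) (A : Matrix (Fin n) (Fin n) ℝ) :
    ∫ s, s ⬝ᵥ (A *ᵥ s) ∂gaussPrior n v = v * A.trace := by
  have st : ∀ i, ∫ s, s i * (A *ᵥ s) i ∂gaussPrior n v = v * A i i := by
    intro i
    have := stein_gr (fun _ : Fin n => v.toNNReal) (fun _ => toNNReal_ne hv) i (fun s => (A *ᵥ s) i) (fun _ => A i i)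
      (fun s => hasDeriv_mulVec A s i i) (meas_mulVec A i) measurable_const (expGr_mulVec A i) (ExpGr.const _)
    simpa [gaussPrior, Real.coe_toNNReal v hv.le] using this
  have i0 : ∀ i, Integrable (fun s : Fin n → ℝ => s i * (A *ᵥ s) i) (gaussPrior n v) := fun i =>
    ((ExpGr.coord i).mul (expGr_mulVec A i)).integrable _ ((measurable_pi_apply i).mul (meas_mulVec A i)).aestronglyMeasurable
  simp only [dotProduct]
  rw [integral_finsetSum _ fun i _ => i0 i, Finset.sum_congr rfl fun i _ => st i, ← Finset.mul_sum]
  rfl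

lemma quad_sq {n : ℕ} (v : ℝ) (hv : 0 < v) (A : Matrix (Fin n) (Fin n) ℝ) (hA : Aᵀ = A) :
    ∫ s, (s ⬝ᵥ (A *ᵥ s))^2 ∂gaussPrior n v = v^2 * (A.trace^2 + 2 * (A * A).trace) := by
  have mf : ∀ i, Measurable (fun s : Fin n → ℝ => (A *ᵥ s) i * (s ⬝ᵥ (A *ᵥ s))) := fun i => (meas_mulVec A i).mul (meas_quad A)
  have gf : ∀ i, ExpGr (fun s : Fin n → ℝ => (A *ᵥ s) i * (s ⬝ᵥ (A *ᵥ s))) := fun i => (expGr_mulVec A i).mul (expGr_quad A)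
  have mf' : ∀ i, Measurable (fun s : Fin n → ℝ => A i i * (s ⬝ᵥ (A *ᵥ s)) + 2 * ((A *ᵥ s) i * (A *ᵥ s) i)) := fun i =>
    ((meas_quad A).const_mul _).add (((meas_mulVec A i).mul (meas_mulVec A i)).const_mul _)
  have gf' : ∀ i, ExpGr (fun s : Fin n → ℝ => A i i * (s ⬝ᵥ (A *ᵥ s)) + 2 * ((A *ᵥ s) i * (A *ᵥ s) i)) := fun i =>
    ((expGr_quad A).const_mul _).add (((expGr_mulVec A i).mul (expGr_mulVec A i)).const_mul _)
  have st : ∀ i, ∫ s, s i * ((A *ᵥ s) i * (s ⬝ᵥ (A *ᵥ s))) ∂gaussPrior n v =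
      v * ∫ s, (A i i * (s ⬝ᵥ (A *ᵥ s)) + 2 * ((A *ᵥ s) i * (A *ᵥ s) i)) ∂gaussPrior n v := by
    intro i
    have := stein_gr (fun _ : Fin n => v.toNNReal) (fun _ => toNNReal_ne hv) i (fun s => (A *ᵥ s) i * (s ⬝ᵥ (A *ᵥ s)))
      (fun s => A i i * (s ⬝ᵥ (A *ᵥ s)) + 2 * ((A *ᵥ s) i * (A *ᵥ s) i)) ?_ (mf i) (mf' i) (gf i) (gf' i)
    · simpa [gaussPrior, Real.coe_toNNReal v hv.le] using this
    · intro s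
      refine ((hasDeriv_mulVec A s i i).mul (hasDeriv_quad A hA s i)).congr_deriv ?_
      simp; ring
  have i0 : ∀ i, Integrable (fun s : Fin n → ℝ => s i * ((A *ᵥ s) i * (s ⬝ᵥ (A *ᵥ s)))) (gaussPrior n v) := fun i =>
    ((ExpGr.coord i).mul (gf i)).integrable _ ((measurable_pi_apply i).mul (mf i)).aestronglyMeasurable
  have i0' : ∀ i, Integrable (fun s : Fin n → ℝ => A i i * (s ⬝ᵥ (A *ᵥ s)) + 2 * ((A *ᵥ s) i * (A *ᵥ s) i)) (gaussPrior n v) := fun i =>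
    (gf' i).integrable _ (mf' i).aestronglyMeasurable
  have e : ∀ s : Fin n → ℝ, (s ⬝ᵥ (A *ᵥ s))^2 = ∑ i, s i * ((A *ᵥ s) i * (s ⬝ᵥ (A *ᵥ s))) := by
    intro s
    rw [sq]; nth_rewrite 1 [dotProduct]
    rw [Finset.sum_mul]
    exact Finset.sum_congr rfl fun i _ => by ring
  simp only [e]
  rw [integral_finsetSum _ fun i _ => i0 i, Finset.sum_congr rfl fun i _ => st i, ← Finset.mul_sum,
    ← integral_finsetSum _ fun i _ => i0' i]
  have e2 : ∀ s : Fin n → ℝ, ∑ i, (A i i * (s ⬝ᵥ (A *ᵥ s)) + 2 * ((A *ᵥ s) i * (A *ᵥ s) i)) =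
      A.trace * (s ⬝ᵥ (A *ᵥ s)) + 2 * (s ⬝ᵥ ((A * A) *ᵥ s)) := by
    intro s
    rw [Finset.sum_add_distrib, ← Finset.sum_mul, ← Finset.mul_sum]
    congr 2
    rw [← Matrix.mulVec_mulVec, Matrix.dotProduct_mulVec s A, ← Matrix.mulVec_transpose, hA]
    rfl
  simp only [e2]
  have i1 : Integrable (fun s : Fin n → ℝ => A.trace * (s ⬝ᵥ (A *ᵥ s))) (gaussPrior n v) :=
    ((expGr_quad A).integrable _ (meas_quad A).aestronglyMeasurable).const_mul _
  have i2 : Integrable (fun s : Fin n → ℝ => 2 * (s ⬝ᵥ ((A * A) *ᵥ s))) (gaussPrior n v) :=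
    ((expGr_quad _).integrable _ (meas_quad _).aestronglyMeasurable).const_mul _
  rw [integral_add i1 i2, integral_const_mul, integral_const_mul, quad_mean v hv, quad_mean v hv]
  ring

/-! normalised quadratic forms -/
def QP {n : ℕ} (P : Polynomial ℝ) (q : (Fin n → ℝ) × (Fin n × Fin n → ℝ)) : ℝ := (q.1 ⬝ᵥ (pW P q.2 *ᵥ q.1)) / n

def mu (n : ℕ) (v : ℝ) := (gaussPrior n v).prod (gpi n)

instance (n v) : IsProbabilityMeasure (mu n v) := by unfold mu gpi; infer_instance

lemma int_QP (n : ℕ) (v : ℝ) (P : Polynomial ℝ) : Integrable (QP (n := n) P) (mu n v) := by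
  have e : QP (n := n) P = fun q => ∑ a, ∑ b, (q.1 a * q.1 b) * (pW P q.2 a b / n) := by
    ext q
    rw [QP, dotProduct, Finset.sum_div]
    refine Finset.sum_congr rfl fun a _ => ?_
    rw [Matrix.mulVec, dotProduct, Finset.mul_sum, Finset.sum_div]
    exact Finset.sum_congr rfl fun b _ => by ring
  rw [e]
  refine integrable_finsetSum _ fun a _ => integrable_finsetSum _ fun b _ => ?_
  have h1 : Integrable (fun s : Fin n → ℝ => s a * s b) (gaussPrior n v) :=
    ((ExpGr.coord a).mul (ExpGr.coord b)).integrable _ (by fun_prop)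
  have h2 : Integrable (fun g : Fin n × Fin n → ℝ => pW P g a b / n) (gpi n) := (nice_pW P a b).int.div_const _
  exact h1.mul_prod h2

lemma int_QP2 (n : ℕ) (v : ℝ) (P : Polynomial ℝ) : Integrable (fun q => QP (n := n) P q ^ 2) (mu n v) := by
  have e0 : ∀ q, QP (n := n) P q = ∑ p : Fin n × Fin n, (q.1 p.1 * q.1 p.2) * (pW P q.2 p.1 p.2 / n) := by
    intro q
    rw [Fintype.sum_prod_type, QP, dotProduct, Finset.sum_div]
    refine Finset.sum_congr rfl fun a _ => ?_
    rw [Matrix.mulVec, dotProduct, Finset.mul_sum, Finset.sum_div]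
    exact Finset.sum_congr rfl fun b _ => by ring
  have e : (fun q => QP (n := n) P q ^ 2) = fun q => ∑ a : Fin n × Fin n, ∑ b : Fin n × Fin n, ((q.1 a.1 * q.1 a.2) * (q.1 b.1 * q.1 b.2)) *
      ((pW P q.2 a.1 a.2 * pW P q.2 b.1 b.2) / (n * n)) := by
    ext q
    rw [e0, sq, Finset.sum_mul_sum]
    refine Finset.sum_congr rfl fun a _ => Finset.sum_congr rfl fun b _ => ?_
    ring
  rw [e]
  refine integrable_finsetSum _ fun a _ => integrable_finsetSum _ fun b _ => ?_
  have h1 : Integrable (fun s : Fin n → ℝ => (s a.1 * s a.2) * (s b.1 * s b.2)) (gaussPrior n v) :=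
    (((ExpGr.coord _).mul (ExpGr.coord _)).mul ((ExpGr.coord _).mul (ExpGr.coord _))).integrable _ (by fun_prop)
  have h2 : Integrable (fun g : Fin n × Fin n → ℝ => (pW P g a.1 a.2 * pW P g b.1 b.2) / (n*n)) (gpi n) :=
    ((nice_pW P _ _).mul (nice_pW P _ _)).int.div_const _
  exact h1.mul_prod h2

lemma QP_mean (n : ℕ) (v : ℝ) (hv : 0 < v) (P : Polynomial ℝ) :
    ∫ q, QP P q ∂mu n v = v * ∫ g, Dn (pW P g) ∂gpi n := by
  have := int_QP n v P
  unfold mu at *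
  rw [integral_prod_symm _ this, ← integral_const_mul]
  refine integral_congr_ae (Eventually.of_forall fun g => ?_)
  simp only [QP, Dn]
  rw [integral_div, quad_mean v hv]; ring

lemma QP_sq (n : ℕ) (v : ℝ) (hv : 0 < v) (P : Polynomial ℝ) :
    ∫ q, QP P q ^ 2 ∂mu n v = v^2 * (∫ g, Dn (pW P g) * Dn (pW P g) ∂gpi n + 2 * (1 / n) * ∫ g, Dn (pW (P * P) g) ∂gpi n) := by
  have := int_QP2 n v P
  unfold mu at *
  rw [integral_prod_symm _ this, ← integral_const_mul, ← integral_add ((nice_pW _).Dn.mul (nice_pW _).Dn).int ((nice_pW _).Dn.int.const_mul _),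
    ← integral_const_mul]
  refine integral_congr_ae (Eventually.of_forall fun g => ?_)
  simp only [QP, Dn, div_pow]
  rw [integral_div, quad_sq v hv _ (pW_symm P g), pW_mul]
  ring

lemma QP_mean_lim (v : ℝ) (hv : 0 < v) (P : Polynomial ℝ) :
    Tendsto (fun n : ℕ => ∫ q, QP P q ∂mu n v) atTop (nhds (v * Lf P)) := by
  simp only [QP_mean _ v hv]
  exact (Dn_lim P).const_mul v

lemma QP_sq_lim (v : ℝ) (hv : 0 < v) (P : Polynomial ℝ) :
    Tendsto (fun n : ℕ => ∫ q, QP P q ^ 2 ∂mu n v) atTop (nhds ((v * Lf P)^2)) := by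
  simp only [QP_sq _ v hv]
  have hn0 : Tendsto (fun n : ℕ => (1:ℝ)/n) atTop (nhds 0) := tendsto_one_div_atTop_nhds_zero_nat
  have := ((Dn2_lim P P).add ((hn0.const_mul 2).mul (Dn_lim (P * P)))).const_mul (v^2)
  refine this.trans_eq ?_
  congr 1; ring

lemma QP_abs_lim (v : ℝ) (hv : 0 < v) (P : Polynomial ℝ) :
    Tendsto (fun n : ℕ => ∫ q, |QP P q - v * Lf P| ∂mu n v) atTop (nhds 0) := by
  set c := v * Lf P with hc
  have i1 : ∀ n, Integrable (fun q => QP (n := n) P q - c) (mu n v) := fun n => (int_QP n v P).sub (integrable_const _)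
  have e2 : ∀ n, (fun q => (QP (n := n) P q - c)^2) = fun q => QP (n := n) P q^2 + ((-2 * c) * QP P q + c^2) := fun n => by
    ext q; ring
  have i3 : ∀ n, Integrable (fun q => (-2 * c) * QP (n := n) P q + c^2) (mu n v) := fun n => ((int_QP n v P).const_mul _).add (integrable_const _)
  have i2 : ∀ n, Integrable (fun q => (QP (n := n) P q - c)^2) (mu n v) := fun n => by
    rw [e2]; exact (int_QP2 n v P).add (i3 n)
  have hA : Tendsto (fun n : ℕ => ∫ q, (QP (n := n) P q - c)^2 ∂mu n v) atTop (nhds 0) := by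
    have : ∀ n, ∫ q, (QP (n := n) P q - c)^2 ∂mu n v = ∫ q, QP (n := n) P q ^2 ∂mu n v + ((-2*c) * ∫ q, QP (n := n) P q ∂mu n v + c^2) := by
      intro n
      rw [e2, integral_add (int_QP2 n v P) (i3 n), integral_add ((int_QP n v P).const_mul _) (integrable_const _), integral_const_mul]
      simp
    simp only [this]
    refine ((QP_sq_lim v hv P).add (((QP_mean_lim v hv P).const_mul (-2*c)).add_const (c^2))).trans_eq ?_
    rw [← hc]; congr 1; ring
  have hn0 : Tendsto (fun n : ℕ => (1:ℝ)/((n:ℝ)+1)) atTop (nhds 0) := tendsto_one_div_add_atTop_nhds_zero_nat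
  have hd := (hA.add hn0).sqrt
  rw [add_zero, Real.sqrt_zero] at hd
  refine squeeze_zero (fun n => integral_nonneg fun q => abs_nonneg _) (fun n => ?_) hd
  set A := ∫ q, (QP (n := n) P q - c)^2 ∂mu n v with hAd
  have hA0 : 0 ≤ A := integral_nonneg fun q => sq_nonneg _
  set d := Real.sqrt (A + 1/((n:ℝ)+1)) with hdd
  have hp : 0 < A + 1/((n:ℝ)+1) := by positivity
  have hd0 : 0 < d := Real.sqrt_pos.2 hp
  have hd2 : d * d = A + 1/((n:ℝ)+1) := Real.mul_self_sqrt hp.le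
  have key : ∫ q, |QP (n := n) P q - c| ∂mu n v ≤ ∫ q, ((1/(2*d)) * (QP (n := n) P q - c)^2 + d/2) ∂mu n v := by
    refine integral_mono (i1 n).abs (((i2 n).const_mul _).add (integrable_const _)) fun q => ?_
    simp only []
    have : |QP P q - c|^2 = (QP P q - c)^2 := sq_abs _
    rw [← this]
    have h : 0 ≤ (|QP P q - c| - d)^2 := sq_nonneg _
    rw [show 1/(2*d) * |QP P q - c|^2 + d/2 = (|QP P q - c|^2 + d*d)/(2*d) by field_simp, le_div_iff₀ (by positivity)]
    nlinarith
  rw [integral_add ((i2 n).const_mul _) (integrable_const _), integral_const_mul, ← hAd] at key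
  simp only [integral_const, probReal_univ, one_smul] at key
  refine key.trans ?_
  rw [show 1/(2*d) * A + d/2 = (A + d*d)/(2*d) by field_simp, div_le_iff₀ (by positivity)]
  have : 0 < 1/((n:ℝ)+1) := by positivity
  nlinarith

open Polynomial in
def Rf : ℝ[X] →ₗ[ℝ] ℝ[X] :=
  Polynomial.lsum fun k => LinearMap.toSpanSingleton ℝ ℝ[X] (∑ a ∈ Finset.range k, C (cc (k - 1 - a)) * X ^ a)

open Polynomial in
lemma Rf_mono (k : ℕ) (c : ℝ) : Rf (monomial k c) = C c * ∑ a ∈ Finset.range k, C (cc (k - 1 - a)) * X ^ a := by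
  simp [Rf, Polynomial.lsum_apply, smul_eq_C_mul]

open Polynomial in
lemma Lf_Cmul (c : ℝ) (P : ℝ[X]) : Lf (C c * P) = c * Lf P := by
  rw [← smul_eq_C_mul, map_smul, smul_eq_mul]

open Polynomial in
lemma Rf_X (P : ℝ[X]) : Rf (X * P) = X * Rf P + C (Lf P) := by
  induction P using Polynomial.induction_on' with
  | add p q hp hq => rw [mul_add, map_add, hp, hq, map_add, map_add, C_add]; ring
  | monomial k c =>
    rw [X_mul_monomial, Rf_mono, Rf_mono, Lf_mono, Finset.sum_range_succ', C_mul, mul_add]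
    simp only [pow_zero, mul_one, Nat.add_sub_cancel, Nat.sub_zero]
    congr 1
    rw [mul_left_comm, Finset.mul_sum, Finset.mul_sum, Finset.mul_sum]
    refine Finset.sum_congr rfl fun a ha => ?_
    rw [show k - 1 - a = k - (a + 1) by omega, pow_succ]; ring

open Polynomial in
lemma Lf_X (P : ℝ[X]) : Lf (X * P) = Lf (Rf P) := by
  induction P using Polynomial.induction_on' with
  | add p q hp hq => rw [mul_add, map_add, hp, hq, map_add, map_add]
  | monomial k c =>
    rw [X_mul_monomial, Rf_mono, Lf_mono, Lf_Cmul, map_sum, cc_succ]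
    congr 1
    refine Finset.sum_congr rfl fun a _ => ?_
    rw [Lf_Cmul, Lf_pow, mul_comm]

open Polynomial in
def Uc : ℕ → ℝ[X]
  | 0 => 1
  | 1 => X
  | k + 2 => X * Uc (k + 1) - Uc k

open Polynomial in
lemma Rf_one : Rf (1 : ℝ[X]) = 0 := by
  have := Rf_mono 0 1
  simpa using this

open Polynomial in
lemma Lf_one : Lf (1 : ℝ[X]) = 1 := by
  have := Lf_mono 0 1
  simpa [cc_zero] using this

open Polynomial in
lemma Uc_facts (k : ℕ) : (Rf (Uc (k + 1)) = Uc k ∧ Lf (Uc (k+1)) = 0) ∧ (Rf (Uc (k + 2)) = Uc (k+1) ∧ Lf (Uc (k+2)) = 0) := by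
  induction k with
  | zero =>
    have h1 : Rf (Uc 1) = Uc 0 := by
      have := Rf_X 1
      rw [mul_one] at this
      simp [Uc, this, Rf_one, Lf_one]
    have h2 : Lf (Uc 1) = 0 := by
      have := Lf_X 1
      rw [mul_one] at this
      simp [Uc, this, Rf_one]
    refine ⟨⟨h1, h2⟩, ?_, ?_⟩
    · rw [show Uc (0 + 2) = X * Uc 1 - Uc 0 from rfl, map_sub, Rf_X, h1, h2]
      simp [Uc, Rf_one]
    · rw [Uc, map_sub, Lf_X, zero_add, h1]; simp
  | succ k ih =>
    refine ⟨ih.2, ?_, ?_⟩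
    · rw [Uc, map_sub, Rf_X, ih.2.1, ih.2.2, ih.1.1]
      simp [Uc]
    · rw [Uc, map_sub, Lf_X, ih.2.1]
      simp

open Polynomial in
lemma Lf_Uc (k : ℕ) : Lf (Uc k) = if k = 0 then 1 else 0 := by
  cases k with
  | zero => simp [Uc, Lf_one]
  | succ k => simp [(Uc_facts k).1.2]

open Polynomial in
lemma X_Uc (k : ℕ) : X * Uc (k + 1) = Uc (k + 2) + Uc k := by rw [Uc]; ring

open Polynomial in
lemma Uc_orth (j : ℕ) : (∀ k, Lf (Uc j * Uc k) = if j = k then 1 else 0) ∧ (∀ k, Lf (Uc (j+1) * Uc k) = if j + 1 = k then 1 else 0) := by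
  induction j with
  | zero =>
    constructor
    · intro k; rw [Uc, one_mul, Lf_Uc]; simp only [eq_comm]
    · intro k
      cases k with
      | zero => rw [Uc, Uc, mul_one, ← show Uc 1 = X from rfl, Lf_Uc]
      | succ k =>
        rw [Uc, X_Uc, map_add, Lf_Uc, Lf_Uc]
        simp [eq_comm]
  | succ j ih =>
    refine ⟨ih.2, fun k => ?_⟩
    cases k with
    | zero => rw [show Uc 0 = 1 from rfl, mul_one, Lf_Uc]
    | succ k =>
      have e : Uc (j + 1 + 1) * Uc (k + 1) = Uc (j+1) * Uc (k+2) + Uc (j+1) * Uc k - Uc j * Uc (k+1) := by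
        rw [show Uc (j+1+1) = X * Uc (j+1) - Uc j from rfl, sub_mul, ← mul_add, ← X_Uc]; ring
      rw [e, map_sub, map_add, ih.2, ih.2, ih.1]
      grind

open Polynomial in
lemma Uc_X (j k : ℕ) : Lf (X * (Uc j * Uc k)) = (if k = j + 1 then 1 else 0) + (if j = k + 1 then 1 else 0) := by
  cases j with
  | zero =>
    cases k with
    | zero =>
      rw [show X * (Uc 0 * Uc 0) = Uc 1 by simp [Uc], Lf_Uc]; simp
    | succ k =>
      rw [show X * (Uc 0 * Uc (k+1)) = X * Uc (k+1) by simp [Uc], X_Uc, map_add, Lf_Uc, Lf_Uc]; simp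
  | succ j =>
    rw [← mul_assoc, X_Uc, add_mul, map_add, (Uc_orth _).1, (Uc_orth _).1]
    grind

open Polynomial in
def Sp (θ : ℝ) (K : ℕ) : ℝ[X] := ∑ k ∈ Finset.range (K + 1), C (θ ^ k) * Uc k

open Polynomial in
lemma Sp_L (θ : ℝ) (K : ℕ) : Lf (Sp θ K) = 1 := by
  rw [Sp, map_sum]
  simp only [Lf_Cmul, Lf_Uc]
  simp

open Polynomial in
lemma Sp_sq (θ : ℝ) (K : ℕ) : Lf (Sp θ K * Sp θ K) = ∑ k ∈ Finset.range (K+1), (θ^2)^k := by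
  rw [Sp, Finset.sum_mul_sum, map_sum]
  refine Finset.sum_congr rfl fun k hk => ?_
  rw [map_sum]
  have : ∀ j, Lf (C (θ ^ k) * Uc k * (C (θ ^ j) * Uc j)) = if k = j then θ^k * θ^j else 0 := by
    intro j
    rw [show C (θ ^ k) * Uc k * (C (θ ^ j) * Uc j) = C (θ ^ k) * (C (θ ^ j) * (Uc k * Uc j)) by ring, Lf_Cmul, Lf_Cmul, (Uc_orth _).1]
    simp
  simp only [this, Finset.sum_ite_eq, hk, if_true]
  rw [← pow_mul, two_mul, pow_add]

open Polynomial in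
lemma Sp_X (θ : ℝ) (K : ℕ) : Lf (X * (Sp θ K * Sp θ K)) = 2 * θ * ∑ k ∈ Finset.range K, (θ^2)^k := by
  have e : X * (Sp θ K * Sp θ K) = ∑ k ∈ Finset.range (K+1), ∑ j ∈ Finset.range (K+1), C (θ ^ k) * (C (θ ^ j) * (X * (Uc k * Uc j))) := by
    rw [Sp, Finset.sum_mul_sum, Finset.mul_sum]
    refine Finset.sum_congr rfl fun k hk => ?_
    rw [Finset.mul_sum]
    exact Finset.sum_congr rfl fun j hj => by ring
  rw [e, map_sum]
  have h1 : ∀ k ∈ Finset.range (K+1), Lf (∑ j ∈ Finset.range (K+1), C (θ ^ k) * (C (θ ^ j) * (X * (Uc k * Uc j)))) =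
     ∑ j ∈ Finset.range (K+1), (if j = k + 1 then θ ^ k * θ ^ j else 0) + ∑ j ∈ Finset.range (K+1), (if k = j + 1 then θ ^ k * θ ^ j else 0) := by
    intro k _
    rw [map_sum, ← Finset.sum_add_distrib]
    refine Finset.sum_congr rfl fun j _ => ?_
    rw [Lf_Cmul, Lf_Cmul, Uc_X]
    split_ifs <;> ring
  rw [Finset.sum_congr rfl h1, Finset.sum_add_distrib]
  have h2 : ∑ k ∈ Finset.range (K+1), ∑ j ∈ Finset.range (K+1), (if j = k + 1 then θ ^ k * θ ^ j else 0) = θ * ∑ k ∈ Finset.range K, (θ^2)^k := by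
    simp only [Finset.sum_ite_eq', Finset.mem_range]
    rw [Finset.sum_range_succ, if_neg (by omega), add_zero, Finset.mul_sum]
    refine Finset.sum_congr rfl fun k hk => ?_
    rw [Finset.mem_range] at hk
    rw [if_pos (by omega), ← pow_mul]; ring
  have h3 : ∑ k ∈ Finset.range (K+1), ∑ j ∈ Finset.range (K+1), (if k = j + 1 then θ ^ k * θ ^ j else 0) = θ * ∑ k ∈ Finset.range K, (θ^2)^k := by
    rw [← h2, Finset.sum_comm]
    refine Finset.sum_congr rfl fun k _ => Finset.sum_congr rfl fun j _ => ?_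
    rw [mul_comm]
  rw [h2, h3]; ring

open Polynomial in
lemma poly_exists (vs β θ lam ε : ℝ) (hvs : 0 < vs) (hβ : 0 ≤ β) (h0 : 0 < θ) (h1 : θ < 1) (hε : 0 < ε) :
    ∃ r : ℝ[X], vs * Lf (r * r) = β ∧
      β * (√lam * θ + lam * vs * (1 - θ^2) / 2) - ε ≤ 1/2 * √lam * (vs * Lf (X * (r * r))) + lam / 2 * (vs * Lf r)^2 := by
  have hθ2 : θ^2 < 1 := by nlinarith
  have hs := (hasSum_geometric_of_lt_one (sq_nonneg θ) hθ2).tendsto_sum_nat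
  have hs1 := hs.comp (tendsto_add_atTop_nat 1)
  have hne : (1 - θ^2)⁻¹ ≠ 0 := inv_ne_zero (by linarith)
  have lim : Tendsto (fun K : ℕ => 1/2 * √lam * (β * (2 * θ * (∑ k ∈ Finset.range K, (θ^2)^k) / ∑ k ∈ Finset.range (K+1), (θ^2)^k))
      + lam / 2 * (vs * β * (∑ k ∈ Finset.range (K+1), (θ^2)^k)⁻¹)) atTop
      (nhds (1/2 * √lam * (β * (2 * θ * (1-θ^2)⁻¹ / (1-θ^2)⁻¹)) + lam / 2 * (vs * β * ((1-θ^2)⁻¹)⁻¹))) :=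
    ((((hs.const_mul (2*θ)).div hs1 hne).const_mul β).const_mul _).add (((hs1.inv₀ hne).const_mul _).const_mul _)
  rw [mul_div_cancel_right₀ _ hne, inv_inv] at lim
  obtain ⟨K, hK⟩ := (lim.eventually (lt_mem_nhds (show 1/2 * √lam * (β * (2 * θ)) + lam / 2 * (vs * β * (1-θ^2)) - ε <
    1/2 * √lam * (β * (2 * θ)) + lam / 2 * (vs * β * (1-θ^2)) by linarith))).exists
  set N := ∑ k ∈ Finset.range (K+1), (θ^2)^k with hN
  have hNp : 0 < N := Finset.sum_pos (fun k _ => by positivity) ⟨0, by simp⟩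
  set c := √(β / (N * vs)) with hc
  have hc2 : c * c = β / (N * vs) := Real.mul_self_sqrt (by positivity)
  refine ⟨C c * Sp θ K, ?_, ?_⟩
  · rw [show C c * Sp θ K * (C c * Sp θ K) = C c * (C c * (Sp θ K * Sp θ K)) by ring, Lf_Cmul, Lf_Cmul, Sp_sq, ← hN, ← mul_assoc c, hc2]
    field_simp
  · rw [show X * (C c * Sp θ K * (C c * Sp θ K)) = C c * (C c * (X * (Sp θ K * Sp θ K))) by ring, Lf_Cmul, Lf_Cmul, Sp_X, ← mul_assoc c, hc2,
      Lf_Cmul, Sp_L, show (vs * (c * 1))^2 = vs^2 * (c * c) by ring, hc2]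
    refine (le_trans ?_ hK.le).trans_eq ?_
    · apply le_of_eq; ring
    · field_simp

lemma int_gT {n : ℕ} (hn : 1 ≤ n) (v : ℝ) {lam r : ℝ} (hl : 0 < lam)
    (hr : 0 ≤ r) (hne : tP n v r ≠ 0) :
    Integrable (fun g => ∑ i, ∑ j, gT (tP n v r) (Hs n 0 lam g) i j ^ 2) (gpi n) := by
  have mT : Measurable fun g => ∑ i, ∑ j, gT (tP n v r) (Hs n 0 lam g) i j ^ 2 := by
    refine Finset.measurable_fun_sum _ fun i _ => Finset.measurable_fun_sum _ fun j _ => ?_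
    refine Measurable.pow_const ?_ 2
    unfold gT gav
    have mm := (measurable_Hs n lam).comp (f := fun p : (Fin n × Fin n → ℝ) × (Fin n → ℝ) => (((0 : Fin n → ℝ), p.1), p.2)) (by fun_prop)
    refine Measurable.div (StronglyMeasurable.measurable ?_) (StronglyMeasurable.measurable ?_)
    · refine StronglyMeasurable.integral_prod_right (f := fun (g : Fin n × Fin n → ℝ) (x : Fin n → ℝ) => (x i * x j) * Real.exp (Hs n 0 lam g x)) ?_
      exact ((by fun_prop : Measurable fun p : (Fin n × Fin n → ℝ) × (Fin n → ℝ) => p.2 i * p.2 j).mul mm.exp).stronglyMeasurable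
    · refine StronglyMeasurable.integral_prod_right (f := fun (g : Fin n × Fin n → ℝ) (x : Fin n → ℝ) => Real.exp (Hs n 0 lam g x)) ?_
      exact mm.exp.stronglyMeasurable
  have h := dG_intT hn v 0 hl le_rfl hr hne (Real.pi / 2)
  have e3 : ∀ g : (Fin n × Fin n) ⊕ Fin n → ℝ, (dG n v 0 lam 0 r).H (Real.pi / 2) g = Hs n 0 lam (fun p => g (Sum.inl p)) :=
    fun g => funext fun x => dG_H_half n v 0 lam 0 _ g x
  simp only [e3] at h
  rw [← (vG_fst n).map_eq, integrable_map_measure mT.aestronglyMeasurable (vG_fst n).measurable.aemeasurable]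
  exact h

/-- integrable with given integral -/
def HI {α : Type*} [MeasurableSpace α] (μ : Measure α) (f : α → ℝ) (c : ℝ) : Prop := Integrable f μ ∧ ∫ x, f x ∂μ = c

namespace HI
variable {α : Type*} [MeasurableSpace α] {μ : Measure α} {f h : α → ℝ} {c d : ℝ}
lemma mk' (hf : Integrable f μ) : HI μ f (∫ x, f x ∂μ) := ⟨hf, rfl⟩
lemma add (hf : HI μ f c) (hh : HI μ h d) : HI μ (fun x => f x + h x) (c + d) :=
  ⟨hf.1.add hh.1, by rw [integral_add hf.1 hh.1, hf.2, hh.2]⟩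
lemma sub (hf : HI μ f c) (hh : HI μ h d) : HI μ (fun x => f x - h x) (c - d) :=
  ⟨hf.1.sub hh.1, by rw [integral_sub hf.1 hh.1, hf.2, hh.2]⟩
lemma const_mul (a : ℝ) (hf : HI μ f c) : HI μ (fun x => a * f x) (a * c) :=
  ⟨hf.1.const_mul a, by rw [integral_const_mul, hf.2]⟩
lemma const [IsProbabilityMeasure μ] (a : ℝ) : HI μ (fun _ => a) a := ⟨integrable_const _, by simp⟩
lemma mono (hf : HI μ f c) (hh : HI μ h d) (hle : ∀ x, f x ≤ h x) : c ≤ d := by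
  rw [← hf.2, ← hh.2]; exact integral_mono hf.1 hh.1 hle
end HI

lemma HI_snd {n : ℕ} {v : ℝ} {f : (Fin n × Fin n → ℝ) → ℝ} (hf : Integrable f (gpi n)) :
    HI (mu n v) (fun q => f q.2) (∫ g, f g ∂gpi n) := by
  have : IsProbabilityMeasure (gpi n) := by unfold gpi; infer_instance
  refine ⟨hf.comp_snd _, ?_⟩
  unfold mu
  rw [integral_fun_snd]; simp

lemma quad_pW {n : ℕ} (A B C : Polynomial ℝ) (s : Fin n → ℝ) (g) :
    (pW A g *ᵥ s) ⬝ᵥ (pW B g *ᵥ (pW C g *ᵥ s)) = s ⬝ᵥ (pW (A * (B * C)) g *ᵥ s) := by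
  rw [pW_mul, pW_mul, ← Matrix.mulVec_mulVec, ← Matrix.mulVec_mulVec, Matrix.dotProduct_mulVec s, ← Matrix.mulVec_transpose, pW_symm]

open Polynomial in
lemma lower_step (n : ℕ) (hn : 1 ≤ n) (v v' beta lam rho vs : ℝ) (hv : 0 < v) (hv' : 0 < v') (hl : 0 < lam) (hrho : v' < rho)
    (hb : 1 / v' = 1 / v + lam * beta) (r : ℝ[X]) :
    1/2 * Real.log (v'/v) + (1/n) * (∫ g, Real.log (∫ y, Real.exp (Hs n 0 lam g y) ∂tP n v' (n * rho)) ∂gpi n)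
     + 1/2 * √lam * (∫ q, QP (X * (r * r)) q ∂mu n vs) + lam/2 * (∫ q, QP r q ^ 2 ∂mu n vs)
     - lam / 4 * (∫ q, QP (r * r) q ^ 2 ∂mu n vs) - 1/(2*v) * (∫ q, QP (r * r) q ∂mu n vs)
     - lam * rho / 2 * (∫ q, |QP (r * r) q - beta| ∂mu n vs)
     - lam / (2 * √n) * (∫ q, QP (r * r) q ^ 2 ∂mu n vs)
     - lam / (2 * (n * √n)) * (∫ g, ∑ i, ∑ j, gT (tP n v' (n * rho)) (Hs n 0 lam g) i j ^ 2 ∂gpi n) ≤ Fn n vs v lam := by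
  have hn' : (0:ℝ) < n := by exact_mod_cast hn
  have hr : n * v' < n * rho := by gcongr
  have hne := tP_ne n v' _ hv' hr
  have hr0 : 0 ≤ n * rho := by nlinarith
  have hF : HI (mu n vs) (fun q => (1/(n:ℝ)) * lZ n v q.1 lam q.2) (Fn n vs v lam) := by
    have h := int_lZ n hn vs v lam hl
    refine ⟨h.const_mul _, ?_⟩
    unfold mu
    rw [integral_const_mul, integral_prod _ h, Fn]
  have h0 := HI_snd (v := vs) (int_lZr hn v' 0 hl hr0 hne)
  have hT := HI_snd (v := vs) (int_gT hn v' hl hr0 hne)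
  have hA : HI (mu n vs) (fun q => |QP (n := n) (r * r) q - beta|) (∫ q, |QP (r * r) q - beta| ∂mu n vs) :=
    HI.mk' ((int_QP n vs (r*r)).sub (integrable_const _)).abs
  have lhs := ((((((((HI.const (μ := mu n vs) (1/2 * Real.log (v'/v))).add (h0.const_mul (1/n))).add
    ((HI.mk' (int_QP n vs (X * (r * r)))).const_mul (1/2 * √lam))).add ((HI.mk' (int_QP2 n vs r)).const_mul (lam/2))).sub
    ((HI.mk' (int_QP2 n vs (r*r))).const_mul (lam/4))).sub ((HI.mk' (int_QP n vs (r*r))).const_mul (1/(2*v)))).sub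
    (hA.const_mul (lam*rho/2))).sub ((HI.mk' (int_QP2 n vs (r*r))).const_mul (lam/(2*√n)))).sub
    (hT.const_mul (lam / (2 * (n * √n))))
  refine lhs.mono hF fun q => ?_
  obtain ⟨s, g⟩ := q
  simp only []
  have tr := trial n hn v v' beta lam rho hv hv' hl hrho hb s (pW r g *ᵥ s) g
  set T := ∑ i, ∑ j, gT (tP n v' (n * rho)) (Hs n 0 lam g) i j ^ 2 with hTd
  have hT0 : 0 ≤ T := Finset.sum_nonneg fun i _ => Finset.sum_nonneg fun j _ => sq_nonneg _
  set Z0 := Real.log (∫ y, Real.exp (Hs n 0 lam g y) ∂tP n v' (n * rho))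
  have z1 : (pW r g *ᵥ s) ⬝ᵥ (pW r g *ᵥ s) = n * QP (r * r) (s, g) := by
    have := quad_pW r 1 r s g
    rw [one_mul] at this
    rw [QP]; simp only []
    rw [← this]
    simp [pW]; field_simp
  have z2 : s ⬝ᵥ (pW r g *ᵥ s) = n * QP r (s, g) := by rw [QP]; field_simp
  have z3 : (pW r g *ᵥ s) ⬝ᵥ (symZ g *ᵥ (pW r g *ᵥ s)) = n * √n * QP (X * (r * r)) (s, g) := by
    have hW : symZ g = √n • pW X g := by
      simp only [pW, aeval_X, Wn]
      rw [smul_smul, mul_inv_cancel₀ (by positivity), one_smul]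
    rw [hW, Matrix.smul_mulVec, dotProduct_smul, quad_pW, QP, show r * (X * r) = X * (r * r) by ring, smul_eq_mul]
    field_simp
  rw [Hs_eq, z1, z2, z3] at tr
  set a := QP (X * (r * r)) (s, g)
  set b := QP r (s, g)
  set c := QP (r * r) (s, g)
  have hs : √(lam / n) = √lam / √n := Real.sqrt_div hl.le _
  have hsn : √(n:ℝ) * √n = n := Real.mul_self_sqrt hn'.le
  have hsp : 0 < √(n:ℝ) := Real.sqrt_pos.2 hn'
  have hTs : √T * √T = T := Real.mul_self_sqrt hT0
  rw [hs, show n * c - n * beta = n * (c - beta) by ring, abs_mul, abs_of_pos hn'] at tr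
  clear_value T
  have am : lam / n * (n * c * √T) ≤ n * (lam / (2 * √n) * c^2 + lam / (2 * (n * √n)) * T) := by
    have h1 : lam / n * (n * c * √T) = lam * (c * √T) := by field_simp
    have h2 : n * (lam / (2 * √n) * c^2 + lam / (2 * (n * √n)) * T) = lam / (2 * √n) * (n * c^2 + T) := by field_simp
    rw [h1, h2]
    have h3 : 0 ≤ (√n * c - √T)^2 := sq_nonneg _
    have h4 : 2 * √n * (c * √T) ≤ n * c^2 + T := by
      have : (√n * c - √T)^2 = (√n*√n) * c^2 - 2 * √n * (c * √T) + √T * √T := by ring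
      rw [this, hsn, hTs] at h3; linarith
    calc lam * (c * √T) = lam / (2 * √n) * (2 * √n * (c * √T)) := by field_simp
      _ ≤ _ := by gcongr
  have tr2 : n * (1/2 * Real.log (v'/v) + (1/n) * Z0 + 1/2 * √lam * a + lam/2 * b^2 - lam/4*c^2 - 1/(2*v) * c - lam*rho/2*|c-beta|
      - lam / (2 * √n) * c^2 - lam / (2 * (n * √n)) * T) ≤ lZ n v s lam g := by
    refine le_trans ?_ tr
    have e1 : √lam / √n * (1/2 * (n * √n * a)) = n * (1/2 * √lam * a) := by field_simp
    have e2 : lam / (2*n) * (n*b)^2 = n * (lam/2*b^2) := by field_simp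
    have e3 : lam / (4*n) * (n*c)^2 = n * (lam/4*c^2) := by field_simp
    have e4 : n * c / (2*v) = n * (1/(2*v)*c) := by ring
    have e5 : n * ((1/n) * Z0) = Z0 := by field_simp
    rw [e1, e2, e3, e4]
    have : n * (1/2 * Real.log (v'/v) + (1/n) * Z0 + 1/2 * √lam * a + lam/2 * b^2 - lam/4*c^2 - 1/(2*v) * c - lam*rho/2*|c-beta|
      - lam / (2 * √n) * c^2 - lam / (2 * (n * √n)) * T) = n/2 * Real.log (v'/v) + n * ((1/n) * Z0) + n * (1/2 * √lam * a) + n * (lam/2 * b^2)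
      - n * (lam/4*c^2) - n * (1/(2*v) * c) - lam*rho/2*(n * |c-beta|)
      - n * (lam / (2 * √n) * c^2 + lam / (2 * (n * √n)) * T) := by ring
    rw [this, e5]
    linarith
  rw [show 1 / (n:ℝ) * lZ n v s lam g = lZ n v s lam g / n by ring, le_div_iff₀ hn']
  linarith

open Polynomial in
lemma lower_lim (v v' beta lam vs θ ε : ℝ) (hv : 0 < v) (hv' : 0 < v') (hl : 0 < lam) (hvs : 0 < vs) (hβ : 0 ≤ beta)
    (hb : 1 / v' = 1 / v + lam * beta) (h0 : 0 < θ) (h1 : θ < 1) (hc : lam * v' ^ 2 < 1) (hε : 0 < ε) :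
    ∀ᶠ n : ℕ in atTop, 1/2 * Real.log (v'/v) + beta * (√lam * θ + lam * vs * (1 - θ^2) / 2) - lam / 4 * beta^2 - 1/(2*v) * beta - ε
      ≤ Fn n vs v lam := by
  obtain ⟨r, hr1, hr2⟩ := poly_exists vs beta θ lam (ε/2) hvs hβ h0 h1 (by linarith)
  obtain ⟨ρ, K, hρ, hK, hev⟩ := null_lim v' lam hv' hl hc
  have hn0 : Tendsto (fun n : ℕ => (1:ℝ)/n) atTop (nhds 0) := tendsto_one_div_atTop_nhds_zero_nat
  have hns : Tendsto (fun n : ℕ => (1:ℝ)/√n) atTop (nhds 0) := by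
    have := hn0.sqrt
    rw [Real.sqrt_zero] at this
    refine this.congr fun n => ?_
    rw [Real.sqrt_div zero_le_one, Real.sqrt_one]
  have sqL := QP_sq_lim vs hvs (r*r)
  have abL := QP_abs_lim vs hvs (r*r)
  have mL := QP_mean_lim vs hvs (r*r)
  rw [hr1] at sqL abL mL
  have lim : Tendsto (fun n : ℕ => 1/2 * Real.log (v'/v) - (1/(n:ℝ)) * K
     + 1/2 * √lam * (∫ q, QP (X * (r * r)) q ∂mu n vs) + lam/2 * (∫ q, QP r q ^ 2 ∂mu n vs)
     - lam / 4 * (∫ q, QP (r * r) q ^ 2 ∂mu n vs) - 1/(2*v) * (∫ q, QP (r * r) q ∂mu n vs)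
     - lam * ρ / 2 * (∫ q, |QP (r * r) q - beta| ∂mu n vs)
     - lam / 2 * ((1/√n) * (∫ q, QP (r * r) q ^ 2 ∂mu n vs))
     - lam / 2 * ((1/√n) * K)) atTop (nhds (1/2 * Real.log (v'/v) - 0 * K
     + 1/2 * √lam * (vs * Lf (X * (r * r))) + lam/2 * (vs * Lf r)^2
     - lam / 4 * beta^2 - 1/(2*v) * beta
     - lam * ρ / 2 * 0 - lam / 2 * (0 * beta^2) - lam / 2 * (0 * K))) :=
    (((((((tendsto_const_nhds.sub (hn0.mul_const K)).add ((QP_mean_lim vs hvs (X * (r*r))).const_mul _)).add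
      ((QP_sq_lim vs hvs r).const_mul _)).sub (sqL.const_mul _)).sub (mL.const_mul _)).sub (abL.const_mul _)).sub
      ((hns.mul sqL).const_mul _)).sub ((hns.mul_const K).const_mul _)
  have := lim.eventually (lt_mem_nhds (show 1/2 * Real.log (v'/v) + beta * (√lam * θ + lam * vs * (1 - θ^2) / 2) - lam / 4 * beta^2 - 1/(2*v) * beta - ε < _ by
    linarith))
  filter_upwards [this, hev, eventually_ge_atTop 1] with n h1 h2 hn
  have hn' : (0:ℝ) < n := by exact_mod_cast hn
  have hsp : 0 < √(n:ℝ) := Real.sqrt_pos.2 hn'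
  refine le_trans ?_ (lower_step n hn v v' beta lam ρ vs hv hv' hl hρ hb r)
  refine h1.le.trans ?_
  have k1 : -((1/(n:ℝ)) * K) ≤ (1/(n:ℝ)) * ∫ g, Real.log (∫ x, Real.exp (Hs n 0 lam g x) ∂(tP n v' (n * ρ))) ∂gpi n := by
    have := mul_le_mul_of_nonneg_left h2.1 (show 0 ≤ 1/(n:ℝ) by positivity)
    linarith
  have k2 : lam / (2 * (n * √n)) * (∫ g, ∑ i, ∑ j, gT (tP n v' (n * ρ)) (Hs n 0 lam g) i j ^ 2 ∂gpi n) ≤ lam / 2 * ((1/√n) * K) := by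
    refine (mul_le_mul_of_nonneg_left h2.2 (by positivity)).trans_eq ?_
    field_simp
  have k3 : lam / 2 * ((1/√n) * (∫ q, QP (r * r) q ^ 2 ∂mu n vs)) = lam / (2 * √n) * (∫ q, QP (r * r) q ^ 2 ∂mu n vs) := by
    field_simp
  rw [k3]
  linarith

/-- trial lower bound -/
def LB (lam v vs b θ : ℝ) : ℝ :=
  -(1/2 * Real.log (1 + v * (lam * b))) + b * (√lam * θ + lam * vs * (1 - θ^2) / 2) - lam / 4 * b^2 - 1/(2*v) * b

lemma Fn_lim (v vs lam q θ : ℝ) (hv : 0 < v) (hvs : 0 < vs) (hl : 0 < lam) (hq : 0 ≤ q)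
    (h1 : v * lam * vs ≤ 1 + v * (lam * q)) (h2 : v * √lam ≤ 1 + v * (lam * q)) (h0 : 0 < θ) (hθ : θ ≤ 1)
    (hm : LB lam v vs q θ = fU lam v q) :
    Tendsto (fun n : ℕ => Fn n vs v lam) atTop (nhds (fU lam v q)) := by
  have hpos : ∀ b, 0 ≤ b → 0 < 1 + v * (lam * b) := fun b hb => by positivity
  rw [Metric.tendsto_atTop']
  intro ε hε
  have hcU : ContinuousAt (fun b : ℝ => fU lam v (q + b)) 0 := by
    unfold fU
    have : 1 + v * (lam * (q + 0)) ≠ 0 := by rw [add_zero]; exact (hpos q hq).ne'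
    have : 2 * (1 + v * (lam * (q + 0))) ≠ 0 := by simpa using this
    fun_prop (disch := assumption)
  have hcL : ContinuousAt (fun b : ℝ => LB lam v vs (q + b) (θ - b)) 0 := by
    unfold LB
    have : 1 + v * (lam * (q + 0)) ≠ 0 := by rw [add_zero]; exact (hpos q hq).ne'
    fun_prop (disch := assumption)
  have eU : ∀ᶠ b : ℝ in nhdsWithin 0 (Set.Ioi 0), fU lam v (q + b) < fU lam v q + ε/3 := by
    refine (hcU.tendsto.mono_left nhdsWithin_le_nhds).eventually (gt_mem_nhds ?_)
    simp; linarith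
  have eL : ∀ᶠ b : ℝ in nhdsWithin 0 (Set.Ioi 0), fU lam v q - ε/3 < LB lam v vs (q + b) (θ - b) := by
    refine (hcL.tendsto.mono_left nhdsWithin_le_nhds).eventually (lt_mem_nhds ?_)
    simp only [add_zero, sub_zero, hm]; linarith
  have eθ : ∀ᶠ b : ℝ in nhdsWithin 0 (Set.Ioi 0), b < θ :=
    nhdsWithin_le_nhds (gt_mem_nhds h0)
  obtain ⟨b, ⟨⟨hbU, hbL⟩, hbθ⟩, hb0⟩ := ((eU.and eL).and eθ |>.and self_mem_nhdsWithin).exists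
  have hb0 : 0 < b := hb0
  have hgt : 1 + v * (lam * q) < 1 + v * (lam * (q + b)) := by
    have : 0 < v * (lam * b) := by positivity
    nlinarith
  have up := upper_lim v vs hv hvs lam (q + b) hl (by positivity) (by linarith) (ε/3) (by linarith)
  have hP : 0 < 1 + v * (lam * (q + b)) := hpos _ (by positivity)
  have hvv : v / (1 + v * (lam * (q+b))) / v = (1 + v * (lam * (q+b)))⁻¹ := by field_simp
  have lo := lower_lim v (v / (1 + v * (lam * (q+b)))) (q+b) lam vs (θ - b) (ε/3) hv (by positivity) hl hvs (by positivity)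
    (by field_simp) (by linarith) (by linarith) (by
      rw [div_pow, mul_div_assoc', div_lt_one (by positivity)]
      have h3 : v * √lam < 1 + v * (lam * (q+b)) := by linarith
      have h4 : (v * √lam)^2 < (1 + v * (lam * (q+b)))^2 := pow_lt_pow_left₀ h3 (by positivity) (by norm_num)
      rw [mul_pow, Real.sq_sqrt hl.le] at h4
      linarith) (by linarith)
  rw [hvv, Real.log_inv] at lo
  obtain ⟨N, hN⟩ := eventually_atTop.1 (up.and lo)
  refine ⟨N, fun n hn => ?_⟩
  obtain ⟨hu, hlo⟩ := hN n (le_of_lt hn)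
  rw [Real.dist_eq, abs_lt]
  unfold LB at hbL
  constructor <;> linarith

/-- phase A -/
lemma Fn_limA (v vs lam : ℝ) (hv : 0 < v) (hvs : 0 < vs) (hle : vs ≤ v) (hl : 0 < lam) (h : lam ≤ 1 / v^2) :
    Tendsto (fun n : ℕ => Fn n vs v lam) atTop (nhds 0) := by
  have hA : lam * v^2 ≤ 1 := by rwa [le_div_iff₀ (by positivity)] at h
  have := Fn_lim v vs lam 0 1 hv hvs hl le_rfl (by nlinarith [mul_pos hv hl, mul_le_mul_of_nonneg_left hle (mul_pos hv hl).le]) (by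
    have h3 : (v * √lam)^2 ≤ 1 := by rw [mul_pow, Real.sq_sqrt hl.le]; linarith
    rw [mul_zero, mul_zero, add_zero]
    by_contra hc
    push Not at hc
    nlinarith) one_pos le_rfl (by simp [LB, fU])
  simpa [fU] using this

def phiB (v lam : ℝ) : ℝ := 1/4 * (1 - 1/(v * √lam))^2 + 1/2 * (1 - 1/(v * √lam)) - 1/2 * Real.log (v * √lam)

def phiC (v vs lam : ℝ) : ℝ := 1/4 * (lam * vs^2 - 2 * vs / v + 1/(v^2 * lam)) + 1/2 - 1/(2 * v * vs * lam) - 1/2 * Real.log (v * vs * lam)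

lemma Fn_limB (v vs lam : ℝ) (hv : 0 < v) (hvs : 0 < vs) (hl : 0 < lam) (h : 1 / v^2 ≤ lam) (h' : lam ≤ 1/vs^2) :
    Tendsto (fun n : ℕ => Fn n vs v lam) atTop (nhds (phiB v lam)) := by
  rw [div_le_iff₀ (by positivity)] at h
  rw [le_div_iff₀ (by positivity)] at h'
  have hx : 0 < √lam := Real.sqrt_pos.2 hl
  have hxx : √lam * √lam = lam := Real.mul_self_sqrt hl.le
  set x := √lam with hxd
  have h1 : 1 ≤ v * x := by
    by_contra hc
    push Not at hc
    have : (v * x) * (v * x) < 1 := by nlinarith [mul_pos hv hx]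
    nlinarith
  have h2 : vs * x ≤ 1 := by
    by_contra hc
    push Not at hc
    have : 1 < (vs * x) * (vs * x) := by nlinarith
    nlinarith
  have hq : v * (lam * ((x - 1/v)/lam)) = v * x - 1 := by field_simp
  have e : fU lam v ((x - 1/v)/lam) = phiB v lam := by
    rw [fU, hq, phiB, ← hxd, ← hxx]
    have : 1 + (v * x - 1) = v * x := by ring
    rw [this]
    field_simp
  rw [← e]
  refine Fn_lim v vs lam _ 1 hv hvs hl ?_ ?_ ?_ one_pos le_rfl ?_
  · refine div_nonneg ?_ hl.le
    rw [sub_nonneg, div_le_iff₀ hv]; linarith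
  · rw [hq, ← hxx]; nlinarith [mul_pos hv hx]
  · rw [hq]; linarith
  · rw [LB, fU, hq, ← hxd]
    have : 1 + (v * x - 1) = v * x := by ring
    rw [this, ← hxx]
    field_simp
    ring

lemma Fn_limC (v vs lam : ℝ) (hv : 0 < v) (hvs : 0 < vs) (hle : vs ≤ v) (hl : 0 < lam) (h : 1 / vs^2 ≤ lam) :
    Tendsto (fun n : ℕ => Fn n vs v lam) atTop (nhds (phiC v vs lam)) := by
  rw [div_le_iff₀ (by positivity)] at h
  have hx : 0 < √lam := Real.sqrt_pos.2 hl
  have hxx : √lam * √lam = lam := Real.mul_self_sqrt hl.le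
  set x := √lam with hxd
  have h2 : 1 ≤ vs * x := by
    by_contra hc
    push Not at hc
    have : (vs * x) * (vs * x) < 1 := by nlinarith [mul_pos hvs hx]
    nlinarith
  have h3 : 1 ≤ v * vs * lam := by nlinarith [mul_pos hvs hl, mul_le_mul_of_nonneg_right hle (mul_pos hvs hl).le]
  have hq : v * (lam * (vs - 1/(v * lam))) = v * vs * lam - 1 := by field_simp
  have hp : 1 + (v * vs * lam - 1) = v * vs * lam := by ring
  have e : fU lam v (vs - 1/(v*lam)) = phiC v vs lam := by
    rw [fU, hq, phiC, hp]
    field_simp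
    ring
  rw [← e]
  refine Fn_lim v vs lam _ (1/(vs * x)) hv hvs hl ?_ ?_ ?_ (by positivity) ?_ ?_
  · rw [sub_nonneg, div_le_iff₀ (by positivity)]; linarith
  · rw [hq]; linarith
  · rw [hq, hp]
    have h5 : v * x ≤ (v * x) * (vs * x) := le_mul_of_one_le_right (mul_pos hv hx).le h2
    have h6 : (v * x) * (vs * x) = v * vs * (x * x) := by ring
    rw [hxx] at h6
    linarith
  · rw [div_le_one (by positivity)]; exact h2
  · rw [LB, fU, hq, hp, ← hxd]
    have e1 : x * (1/(vs * x)) = 1/vs := by field_simp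
    have e2 : lam * vs * (1 - (1/(vs*x))^2) / 2 = (lam * vs - 1/vs)/2 := by rw [← hxx]; field_simp
    rw [e1, e2]
    field_simp
    ring

lemma deriv_phiB (v lam : ℝ) (hv : 0 < v) (hl : 0 < lam) :
    HasDerivAt (phiB v) (1/(2 * v * (lam * √lam)) - 1/(4 * v^2 * lam^2) - 1/(4 * lam)) lam := by
  have hx : 0 < √lam := Real.sqrt_pos.2 hl
  have hxx : √lam * √lam = lam := Real.mul_self_sqrt hl.le
  have d1 := (Real.hasDerivAt_sqrt hl.ne').const_mul v
  have d2 := ((d1.fun_inv (by positivity)).const_sub 1)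
  have d3 := (((d2.fun_pow 2).const_mul (1/4)).fun_add (d2.const_mul (1/2))).fun_sub ((d1.log (by positivity)).const_mul (1/2))
  have e : phiB v = fun y => 1/4 * (1 - (v * √y)⁻¹)^2 + 1/2 * (1 - (v * √y)⁻¹) - 1/2 * Real.log (v * √y) := by
    ext y; simp [phiB]
  rw [e]
  refine d3.congr_deriv ?_
  set x := √lam
  clear_value x
  subst hxx
  have hx0 : x ≠ 0 := hx.ne'
  have hv0 : v ≠ 0 := hv.ne'
  simp only [show (2:ℕ) - 1 = 1 from rfl, pow_one, Nat.cast_ofNat]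
  field_simp
  ring

lemma deriv_phiC (v vs lam : ℝ) (hv : 0 < v) (hvs : 0 < vs) (hl : 0 < lam) :
    HasDerivAt (phiC v vs) (1/4 * (vs^2 - 1/(v^2 * lam^2)) + 1/(2 * v * vs * lam^2) - 1/(2 * lam)) lam := by
  have d0 := (hasDerivAt_id' lam)
  have d1 := (d0.mul_const (vs^2)).sub_const (2 * vs / v)
  have d2 := (d0.const_mul (v^2)).fun_inv (by positivity)
  have d3 := (d0.const_mul (2*v*vs)).fun_inv (by positivity)
  have d4 := ((d0.const_mul (v*vs)).log (by positivity)).const_mul (1/2)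
  have d5 := (((((d1.fun_add d2).const_mul (1/4)).add_const (1/2)).fun_sub d3)).fun_sub d4
  have e : phiC v vs = fun lam => 1/4 * (lam * vs^2 - 2 * vs / v + (v^2 * lam)⁻¹) + 1/2 - (2 * v * vs * lam)⁻¹ - 1/2 * Real.log (v * vs * lam) := by
    ext y; simp [phiC]
  rw [e]
  refine d5.congr_deriv ?_
  field_simp
  ring

lemma final_core (sig sig' : ℝ) (hsig : 0 < sig) (F : ℝ → ℝ)
    (hunif : ∀ K : Set ℝ, IsCompact K → K ⊆ Set.Ioi 0 →
      TendstoUniformlyOn (fun n lam => MSE n sig sig' lam lam) F atTop K)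
    (hex : ∀ x, 0 < x → ∃ y, Tendsto (fun n : ℕ => Fn n (sig^2) (sig'^2) x) atTop (nhds y))
    (l u lam d : ℝ) (hl : 0 < l) (hlu : l < u) (hmem : lam ∈ Set.Icc l u) (ψ : ℝ → ℝ)
    (hψ : ∀ x ∈ Set.Icc l u, Tendsto (fun n : ℕ => Fn n (sig^2) (sig'^2) x) atTop (nhds (ψ x)))
    (hd : HasDerivAt ψ d lam) :
    Tendsto (fun n => MSE n sig sig' lam lam) atTop (nhds (sig^4 - 4 * d)) := by
  have hlam : 0 < lam := hl.trans_le hmem.1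
  have hv : 0 < sig^2 := by positivity
  choose! phi hphi using hex
  have mom : Tendsto (fun n : ℕ => (1 / (n:ℝ)^2) * ∫ s, (s ⬝ᵥ s)^2 ∂gaussPrior n (sig^2)) atTop (nhds (sig^4)) := by
    have hn0 : Tendsto (fun n : ℕ => (1:ℝ)/n) atTop (nhds 0) := tendsto_one_div_atTop_nhds_zero_nat
    have := (((hn0.const_mul 2).const_add 1).const_mul (sig^4))
    rw [mul_zero, add_zero, mul_one] at this
    refine this.congr' ?_
    filter_upwards [eventually_ge_atTop 1] with n hn
    have hn' : (0:ℝ) < n := by exact_mod_cast hn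
    rw [mom_dot2 n _ hv]
    field_simp
  have hder : HasDerivAt phi ((1/4) * (sig^4 - F lam)) lam := by
    refine hasDerivAt_of_tendstoLocallyUniformlyOn (l := atTop) (s := Set.Ioi 0)
      (f := fun n => Fn n (sig^2) (sig'^2)) (f' := fun n x => (1/4) * ((1 / (n:ℝ)^2) * ∫ s, (s ⬝ᵥ s)^2 ∂gaussPrior n (sig^2) - MSE n sig sig' x x))
      (g' := fun x => (1/4) * (sig^4 - F x)) isOpen_Ioi ?_ ?_ (fun x hx => hphi x hx) hlam
    · rw [tendstoLocallyUniformlyOn_iff_forall_isCompact isOpen_Ioi]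
      intro K hK hKc
      have h1 := Metric.tendstoUniformlyOn_iff.1 (hunif K hKc hK)
      rw [Metric.tendstoUniformlyOn_iff]
      intro ε hε
      filter_upwards [h1 ε hε, (Metric.tendsto_nhds.1 mom) ε hε] with n ha hb x hx
      have ha := ha x hx
      rw [Real.dist_eq, abs_lt] at *
      constructor <;> linarith [ha.1, ha.2, hb.1, hb.2]
    · filter_upwards [eventually_ge_atTop 1] with n hn x hx
      exact deriv_Fn n hn sig sig' x hx
  have heq : ∀ x ∈ Set.Icc l u, ψ x = phi x := fun x hx =>
    tendsto_nhds_unique (hψ x hx) (hphi x (hl.trans_le hx.1))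
  have huni := (uniqueDiffOn_Icc hlu) lam hmem
  have key := huni.eq_deriv _ hd.hasDerivWithinAt (hder.hasDerivWithinAt.congr heq (heq lam hmem))
  have hF := (hunif {lam} isCompact_singleton (by simpa using hlam)).tendsto_at (Set.mem_singleton lam)
  have : sig^4 - 4 * d = F lam := by linarith
  rw [this]; exact hF

theorem main_aux (sig sig' : ℝ)
    (hsig : 0 < sig) (hle : sig ≤ sig') (F : ℝ → ℝ)
    (hunif : ∀ K : Set ℝ, IsCompact K → K ⊆ Set.Ioi 0 →
      TendstoUniformlyOn (fun n lam => MSE n sig sig' lam lam) F atTop K) :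
    ∀ lam : ℝ, 0 < lam →
      (lam ≤ 1 / sig' ^ 4 →
        Tendsto (fun n => MSE n sig sig' lam lam) atTop (nhds (sig ^ 4))) ∧
      (1 / sig' ^ 4 ≤ lam → lam ≤ 1 / sig ^ 4 →
        Tendsto (fun n => MSE n sig sig' lam lam) atTop
          (nhds (sig ^ 4 + 1 / lam -
            (1 / (lam ^ ((3 : ℝ) / 2) * sig' ^ 2)) *
              (2 - 1 / (Real.sqrt lam * sig' ^ 2))))) ∧
      (1 / sig ^ 4 ≤ lam →
        Tendsto (fun n => MSE n sig sig' lam lam) atTop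
          (nhds (2 / lam - (1 / (lam ^ 2 * sig' ^ 2)) * (2 / sig ^ 2 - 1 / sig' ^ 2)))) := by
  have hsig' : 0 < sig' := hsig.trans_le hle
  have hv : 0 < sig'^2 := by positivity
  have hvs : 0 < sig^2 := by positivity
  have hvle : sig^2 ≤ sig'^2 := by gcongr
  have p4 : ∀ s : ℝ, s^4 = (s^2)^2 := fun s => by ring
  have hex : ∀ x, 0 < x → ∃ y, Tendsto (fun n : ℕ => Fn n (sig^2) (sig'^2) x) atTop (nhds y) := by
    intro x hx
    by_cases h1 : x ≤ 1/(sig'^2)^2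
    · exact ⟨_, Fn_limA _ _ x hv hvs hvle hx h1⟩
    · by_cases h2 : x ≤ 1/(sig^2)^2
      · exact ⟨_, Fn_limB _ _ x hv hvs hx (le_of_not_ge h1) h2⟩
      · exact ⟨_, Fn_limC _ _ x hv hvs hvle hx (le_of_not_ge h2)⟩
  intro lam hl
  have hA : lam ≤ 1 / sig' ^ 4 → Tendsto (fun n => MSE n sig sig' lam lam) atTop (nhds (sig ^ 4)) := by
    intro h
    have := final_core sig sig' hsig F hunif hex (lam/2) lam lam 0 (by linarith) (by linarith) ⟨by linarith, le_rfl⟩ (fun _ => 0)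
      (fun x hx => Fn_limA _ _ x hv hvs hvle (by linarith [hx.1]) (by rw [← p4]; linarith [hx.2])) (hasDerivAt_const _ _)
    simpa using this
  refine ⟨hA, fun h h' => ?_, fun h => ?_⟩
  · have hx : 0 < √lam := Real.sqrt_pos.2 hl
    have hxx : √lam * √lam = lam := Real.mul_self_sqrt hl.le
    have h32 : lam ^ ((3:ℝ)/2) = lam * √lam := by
      rw [show (3:ℝ)/2 = 1 + 1/2 by norm_num, Real.rpow_add hl, Real.rpow_one, ← Real.sqrt_eq_rpow]
    rw [h32]
    rcases h.eq_or_lt with heq | hlt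
    · have := hA heq.ge
      convert this using 2
      have hs : √lam = 1/sig'^2 := by
        rw [← heq, p4, show 1/(sig'^2)^2 = (1/sig'^2)^2 by ring, Real.sqrt_sq (by positivity)]
      rw [hs, ← heq]
      field_simp
      ring
    · have := final_core sig sig' hsig F hunif hex (1/sig'^4) lam lam _ (by positivity) hlt ⟨h, le_rfl⟩ (phiB (sig'^2))
        (fun x hx => Fn_limB _ _ x hv hvs (lt_of_lt_of_le (by positivity) hx.1) (by rw [← p4]; exact hx.1) (by rw [← p4]; linarith [hx.2])) (deriv_phiB _ _ hv hl)
      convert this using 2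
      set x := √lam
      clear_value x
      subst hxx
      field_simp
      ring
  · have := final_core sig sig' hsig F hunif hex lam (lam + 1) lam _ hl (by linarith) ⟨le_rfl, by linarith⟩ (phiC (sig'^2) (sig^2))
        (fun x hx => Fn_limC _ _ x hv hvs hvle (lt_of_lt_of_le hl hx.1) (by rw [← p4]; linarith [hx.1])) (deriv_phiC _ _ _ hv hvs hl)
    convert this using 2
    field_simp
    ring

/-- Matched-SNR (`λ' = λ`) limiting MSE for `σ' ≥ σ`, assuming
uniform convergence of `MSE_n(σ,σ',λ,λ)` in `λ` on compact subsets of `ℝ₊`. -/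
theorem matched_snr_mse_limit_overestimate (sig sig' : ℝ)
    (hsig : 0 < sig) (hle : sig ≤ sig') (F : ℝ → ℝ)
    (hunif : ∀ K : Set ℝ, IsCompact K → K ⊆ Set.Ioi 0 →
      TendstoUniformlyOn (fun n lam => MSE n sig sig' lam lam) F atTop K) :
    ∀ lam : ℝ, 0 < lam →
      (lam ≤ 1 / sig' ^ 4 →
        Tendsto (fun n => MSE n sig sig' lam lam) atTop (nhds (sig ^ 4))) ∧
      (1 / sig' ^ 4 ≤ lam → lam ≤ 1 / sig ^ 4 →
        Tendsto (fun n => MSE n sig sig' lam lam) atTop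
          (nhds (sig ^ 4 + 1 / lam -
            (1 / (lam ^ ((3 : ℝ) / 2) * sig' ^ 2)) *
              (2 - 1 / (Real.sqrt lam * sig' ^ 2))))) ∧
      (1 / sig ^ 4 ≤ lam →
        Tendsto (fun n => MSE n sig sig' lam lam) atTop
          (nhds (2 / lam - (1 / (lam ^ 2 * sig' ^ 2)) * (2 / sig ^ 2 - 1 / sig' ^ 2)))) := by
  exact main_aux sig sig' hsig hle F hunif

end
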